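/- arXiv:2106.13968 — 2 statements merged into one kernel-verified Lean document; each statement's English description precedes it below -/
import Mathlib

section
/- Fix p ∈ (0,1) and for each k ∈ ℕ set n = n_k = ⌊(1/(1−p))^k · k⌋. Then there exists a constant c' > 0 such that for all sufficiently large k, the probability under G(n_k, p) that X(k,k,k) > 0 is at least c'; in particular, lim inf over k of P(X(k,k,k) > 0 in G(n_k,p)) is strictly positive. -/
open MeasureTheory Filter Real

noncomputable instance simpleGraphMeasurableSpace {n : ℕ} :
    MeasurableSpace (SimpleGraph (Fin n)) := ⊤

/-- The binomial random graph `G(n,p)`: the measure on simple graphs on `Fin n`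
assigning to each graph `G` the probability `p^{e(G)} * (1-p)^{n(n-1)/2 - e(G)}`. -/
noncomputable def gnp (n : ℕ) (p : ℝ) : Measure (SimpleGraph (Fin n)) :=
  Measure.sum fun G : SimpleGraph (Fin n) =>
    ENNReal.ofReal (p ^ Nat.card G.edgeSet *
      (1 - p) ^ (n * (n - 1) / 2 - Nat.card G.edgeSet)) • Measure.dirac G

/-- The tuple `(X₁,x₁,X₂,x₂,X₃,x₃)` is special: the `Xᵢ` are pairwise disjoint, `xᵢ ∈ Xᵢ`,
every vertex outside `X₁ ∪ X₂ ∪ X₃` has a neighbor in each `Xᵢ`, and for distinct `i,j`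
the only edge between `Xᵢ` and `Xⱼ` is `{xᵢ, xⱼ}`. -/
def SpecialTuple {n : ℕ} (G : SimpleGraph (Fin n)) (X₁ X₂ X₃ : Finset (Fin n))
    (x₁ x₂ x₃ : Fin n) : Prop :=
  Disjoint X₁ X₂ ∧ Disjoint X₁ X₃ ∧ Disjoint X₂ X₃ ∧
  x₁ ∈ X₁ ∧ x₂ ∈ X₂ ∧ x₃ ∈ X₃ ∧
  (∀ v : Fin n, v ∉ X₁ → v ∉ X₂ → v ∉ X₃ →
    (∃ u ∈ X₁, G.Adj v u) ∧ (∃ u ∈ X₂, G.Adj v u) ∧ (∃ u ∈ X₃, G.Adj v u)) ∧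
  (∀ u ∈ X₁, ∀ v ∈ X₂, (G.Adj u v ↔ u = x₁ ∧ v = x₂)) ∧
  (∀ u ∈ X₁, ∀ v ∈ X₃, (G.Adj u v ↔ u = x₁ ∧ v = x₃)) ∧
  (∀ u ∈ X₂, ∀ v ∈ X₃, (G.Adj u v ↔ u = x₂ ∧ v = x₃))

/-- `X(k,ℓ,m)`: the number of special tuples `(X₁,x₁,X₂,x₂,X₃,x₃)` with
`|X₁| = k`, `|X₂| = ℓ`, `|X₃| = m`. -/
noncomputable def countX {n : ℕ} (G : SimpleGraph (Fin n)) (k l m : ℕ) : ℕ :=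
  Nat.card {t : Finset (Fin n) × Finset (Fin n) × Finset (Fin n) × Fin n × Fin n × Fin n //
    t.1.card = k ∧ t.2.1.card = l ∧ t.2.2.1.card = m ∧
    SpecialTuple G t.1 t.2.1 t.2.2.1 t.2.2.2.1 t.2.2.2.2.1 t.2.2.2.2.2}

/-- The expectation of `X(k,ℓ,m)` under `G(n,p)`. -/
noncomputable def expX (n : ℕ) (p : ℝ) (k l m : ℕ) : ℝ :=
  ∫ G, (countX G k l m : ℝ) ∂ gnp n p

/-- The sequence `n_k = ⌊(1/(1-p))^k · k⌋`. -/
noncomputable def nseq2 (p : ℝ) (k : ℕ) : ℕ :=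
  Nat.floor ((1 / (1 - p)) ^ k * (k : ℝ))

/-! ### Independent biased bits -/

section BiasedBits

lemma dependsOn_indicator {E : Type*} {A : Set (E → Bool)} {s : Set E}
    (h : ∀ ω ω' : E → Bool, (∀ e ∈ s, ω e = ω' e) → ω ∈ A → ω' ∈ A) :
    DependsOn (A.indicator (1 : (E → Bool) → ℝ)) s := by
  intro ω ω' hω
  by_cases hA : ω ∈ A
  · simp [hA, h ω ω' hω hA]
  · have : ω' ∉ A := fun h' => hA (h ω' ω (fun e he => (hω e he).symm) h')
    simp [hA, this]

lemma indicator_inter_iInter {ι Ω : Type*} (I : Finset ι) (A : Set Ω) (B : ι → Set Ω) (ω : Ω) :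
    ((A ∩ ⋂ i ∈ I, B i).indicator 1 ω : ℝ) =
      A.indicator 1 ω * ∏ i ∈ I, (B i).indicator 1 ω := by
  classical
  by_cases hA : ω ∈ A
  · by_cases hB : ∀ i ∈ I, ω ∈ B i
    · rw [Set.indicator_of_mem (by simpa [hA] using hB), Set.indicator_of_mem hA,
        Finset.prod_congr rfl fun i hi => Set.indicator_of_mem (hB i hi) _]
      simp
    · rw [Set.indicator_of_notMem (by simpa [hA] using hB)]
      push Not at hB
      obtain ⟨i, hi, hn⟩ := hB
      rw [Finset.prod_eq_zero hi (Set.indicator_of_notMem hn _), mul_zero]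
  · rw [Set.indicator_of_notMem (by simp [hA]), Set.indicator_of_notMem hA, zero_mul]

variable {E : Type*} [Fintype E] [DecidableEq E] {p : ℝ}

/-- The weight of a single bit which is `true` with probability `p`. -/
noncomputable def bitWeight (p : ℝ) (b : Bool) : ℝ := if b then p else 1 - p

/-- The expectation of `f` over independent bits, each `true` with probability `p`. -/
noncomputable def bitExp (p : ℝ) (f : (E → Bool) → ℝ) : ℝ :=
  ∑ ω : E → Bool, (∏ e, bitWeight p (ω e)) * f ω

/-- The probability of `A` for independent bits, each `true` with probability `p`. -/
noncomputable def bitProb (p : ℝ) (A : Set (E → Bool)) : ℝ := bitExp p (A.indicator 1)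

lemma sum_bitWeight (p : ℝ) : ∑ b, bitWeight p b = 1 := by simp [bitWeight]

lemma bitWeight_nonneg (hp : p ∈ Set.Ioo (0 : ℝ) 1) (b : Bool) : 0 ≤ bitWeight p b := by
  unfold bitWeight
  split_ifs
  · exact hp.1.le
  · linarith [hp.2]

lemma bitExp_add (f g : (E → Bool) → ℝ) :
    bitExp p (fun ω => f ω + g ω) = bitExp p f + bitExp p g := by
  simp [bitExp, mul_add, Finset.sum_add_distrib]

lemma bitExp_sub (f g : (E → Bool) → ℝ) :
    bitExp p (fun ω => f ω - g ω) = bitExp p f - bitExp p g := by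
  simp [bitExp, mul_sub, Finset.sum_sub_distrib]

lemma bitExp_const_mul (c : ℝ) (f : (E → Bool) → ℝ) :
    bitExp p (fun ω => c * f ω) = c * bitExp p f := by
  simp only [bitExp, Finset.mul_sum]
  exact Finset.sum_congr rfl fun ω _ => by ring

lemma bitExp_sum {ι : Type*} (s : Finset ι) (f : ι → (E → Bool) → ℝ) :
    bitExp p (fun ω => ∑ i ∈ s, f i ω) = ∑ i ∈ s, bitExp p (f i) := by
  simp only [bitExp, Finset.mul_sum]
  exact Finset.sum_comm

lemma bitExp_mono (hp : p ∈ Set.Ioo (0 : ℝ) 1) {f g : (E → Bool) → ℝ} (h : ∀ ω, f ω ≤ g ω) :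
    bitExp p f ≤ bitExp p g :=
  Finset.sum_le_sum fun ω _ =>
    mul_le_mul_of_nonneg_left (h ω) (Finset.prod_nonneg fun _ _ => bitWeight_nonneg hp _)

lemma bitProb_mono (hp : p ∈ Set.Ioo (0 : ℝ) 1) {A B : Set (E → Bool)} (h : A ⊆ B) :
    bitProb p A ≤ bitProb p B :=
  bitExp_mono hp fun ω => Set.indicator_le_indicator_of_subset h (fun _ => zero_le_one) ω

lemma bitProb_nonneg (hp : p ∈ Set.Ioo (0 : ℝ) 1) (A : Set (E → Bool)) : 0 ≤ bitProb p A :=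
  Finset.sum_nonneg fun ω _ => mul_nonneg
    (Finset.prod_nonneg fun _ _ => bitWeight_nonneg hp _)
    (Set.indicator_nonneg (fun _ _ => zero_le_one) ω)

/-- The probability that the bits in `F` take prescribed values. -/
lemma bitProb_cylinder (F : Finset E) (η : E → Bool) :
    bitProb p {ω : E → Bool | ∀ e ∈ F, ω e = η e} = ∏ e ∈ F, bitWeight p (η e) := by
  classical
  have h1 : ∀ ω : E → Bool, (∏ e, bitWeight p (ω e)) *
      ({ω : E → Bool | ∀ e ∈ F, ω e = η e}.indicator 1 ω : ℝ) =
      ∏ e, (if e ∈ F → ω e = η e then bitWeight p (ω e) else 0) := by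
    intro ω
    by_cases h : ∀ e ∈ F, ω e = η e
    · rw [Set.indicator_of_mem (by exact h), Pi.one_apply, mul_one]
      exact Finset.prod_congr rfl fun e _ => by rw [if_pos (h e)]
    · rw [Set.indicator_of_notMem (by exact h), mul_zero]
      push Not at h
      obtain ⟨e, he, hne⟩ := h
      exact (Finset.prod_eq_zero (Finset.mem_univ e)
        (if_neg fun h' => hne (h' he))).symm
  rw [bitProb, bitExp, Finset.sum_congr rfl fun ω _ => h1 ω, ← Fintype.piFinset_univ,
    Finset.sum_prod_piFinset Finset.univ
      (fun e b => if e ∈ F → b = η e then bitWeight p b else 0),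
    ← Finset.prod_subset (Finset.subset_univ F)]
  · refine Finset.prod_congr rfl fun e he => ?_
    simp only [he, true_implies]
    simp
  · intro e _ he
    simp only [he, false_implies, if_true]
    exact sum_bitWeight p

lemma bitProb_all_false (F : Finset E) :
    bitProb p {ω : E → Bool | ∀ e ∈ F, ω e = false} = (1 - p) ^ F.card := by
  rw [bitProb_cylinder F (fun _ => false)]
  simp [bitWeight]

lemma bitProb_univ : bitProb p (Set.univ : Set (E → Bool)) = 1 := by
  simpa using bitProb_cylinder (p := p) (∅ : Finset E) (fun _ => true)

/-- Functions of disjoint sets of bits are independent. -/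
lemma bitExp_mul {f g : (E → Bool) → ℝ} {s t : Set E} (hf : DependsOn f s) (hg : DependsOn g t)
    (hst : Disjoint s t) : bitExp p (fun ω => f ω * g ω) = bitExp p f * bitExp p g := by
  classical
  set φ := Equiv.piEquivPiSubtypeProd (· ∈ s) (fun _ : E => Bool) with hφ
  have hw : ∀ x : ({e // e ∈ s} → Bool) × ({e // e ∉ s} → Bool),
      ∏ e, bitWeight p (φ.symm x e) =
        (∏ e, bitWeight p (x.1 e)) * ∏ e, bitWeight p (x.2 e) := by
    intro x
    rw [← Fintype.prod_subtype_mul_prod_subtype (· ∈ s)]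
    congr 1
    · exact Finset.prod_congr rfl fun e _ => by simp [hφ, Equiv.piEquivPiSubtypeProd, e.2]
    · exact Finset.prod_congr rfl fun e _ => by simp [hφ, Equiv.piEquivPiSubtypeProd, e.2]
  have hone : ∀ (T : Type _) [Fintype T] [DecidableEq T],
      ∑ y : T → Bool, ∏ e, bitWeight p (y e) = 1 := by
    intro T _ _
    rw [← Fintype.piFinset_univ, Finset.sum_prod_piFinset Finset.univ (fun _ b => bitWeight p b)]
    simp only [sum_bitWeight, Finset.prod_const_one]
  have hf' : ∀ x y y', f (φ.symm (x, y)) = f (φ.symm (x, y')) := fun x y y' =>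
    hf fun e he => by simp [hφ, Equiv.piEquivPiSubtypeProd, he]
  have hg' : ∀ x x' y, g (φ.symm (x, y)) = g (φ.symm (x', y)) := fun x x' y =>
    hg fun e he => by
      have : e ∉ s := fun h => Set.disjoint_left.1 hst h he
      simp [hφ, Equiv.piEquivPiSubtypeProd, this]
  have hE : ∀ h : (E → Bool) → ℝ, bitExp p h =
      ∑ x : {e // e ∈ s} → Bool, ∑ y : {e // e ∉ s} → Bool,
        (∏ e, bitWeight p (x e)) * (∏ e, bitWeight p (y e)) * h (φ.symm (x, y)) := by
    intro h
    rw [bitExp, ← φ.symm.sum_comp, Fintype.sum_prod_type]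
    exact Finset.sum_congr rfl fun x _ => Finset.sum_congr rfl fun y _ => by rw [hw]
  have x₀ : {e // e ∈ s} → Bool := fun _ => true
  have y₀ : {e // e ∉ s} → Bool := fun _ => true
  have hEf : bitExp p f = ∑ x : {e // e ∈ s} → Bool,
      (∏ e, bitWeight p (x e)) * f (φ.symm (x, y₀)) := by
    rw [hE]
    refine Finset.sum_congr rfl fun x _ => ?_
    rw [Finset.sum_congr rfl fun y _ => by rw [hf' x y y₀], ← Finset.sum_mul, ← Finset.mul_sum,
      hone, mul_one]
  have hEg : bitExp p g = ∑ y : {e // e ∉ s} → Bool,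
      (∏ e, bitWeight p (y e)) * g (φ.symm (x₀, y)) := by
    rw [hE, Finset.sum_comm]
    refine Finset.sum_congr rfl fun y _ => ?_
    rw [Finset.sum_congr rfl fun x _ => by rw [hg' x x₀ y], ← Finset.sum_mul, ← Finset.sum_mul,
      hone, one_mul]
  rw [hE, hEf, hEg, Finset.sum_mul_sum]
  refine Finset.sum_congr rfl fun x _ => Finset.sum_congr rfl fun y _ => ?_
  rw [hf' x y y₀, hg' x x₀ y]
  ring

lemma bitExp_mul_prod {ι : Type*} (I : Finset ι) {g : ι → (E → Bool) → ℝ} {t : ι → Set E}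
    (hg : ∀ i ∈ I, DependsOn (g i) (t i)) (ht : (I : Set ι).PairwiseDisjoint t)
    {f : (E → Bool) → ℝ} {s : Set E} (hf : DependsOn f s) (hst : ∀ i ∈ I, Disjoint s (t i)) :
    bitExp p (fun ω => f ω * ∏ i ∈ I, g i ω) = bitExp p f * ∏ i ∈ I, bitExp p (g i) := by
  classical
  induction I using Finset.induction_on generalizing f s with
  | empty => simp
  | insert a I ha ih =>
    have hfa : DependsOn (fun ω => f ω * g a ω) (s ∪ t a) := fun ω ω' h => by
      simp only
      rw [hf fun e he => h e (Or.inl he),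
        hg a (Finset.mem_insert_self _ _) fun e he => h e (Or.inr he)]
    have := ih (fun i hi => hg i (Finset.mem_insert_of_mem hi))
      (ht.subset (by simp)) hfa (fun i hi => by
        refine Set.disjoint_union_left.2 ⟨hst i (Finset.mem_insert_of_mem hi), ?_⟩
        exact ht (by simp) (by simp [hi]) (by rintro rfl; exact ha hi))
    rw [Finset.prod_insert ha, ← mul_assoc, ← bitExp_mul hf (hg a (Finset.mem_insert_self _ _))
      (hst a (Finset.mem_insert_self _ _)), ← this]
    congr 1
    ext ω
    rw [Finset.prod_insert ha, mul_assoc]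

/-- Events determined by disjoint sets of bits are independent. -/
lemma bitProb_inter_iInter {ι : Type*} (I : Finset ι) {B : ι → Set (E → Bool)} {t : ι → Set E}
    (hB : ∀ i ∈ I, DependsOn ((B i).indicator (1 : (E → Bool) → ℝ)) (t i))
    (ht : (I : Set ι).PairwiseDisjoint t)
    {A : Set (E → Bool)} {s : Set E} (hA : DependsOn (A.indicator (1 : (E → Bool) → ℝ)) s)
    (hst : ∀ i ∈ I, Disjoint s (t i)) :
    bitProb p (A ∩ ⋂ i ∈ I, B i) = bitProb p A * ∏ i ∈ I, bitProb p (B i) := by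
  unfold bitProb
  rw [← bitExp_mul_prod I hB ht hA hst]
  congr 1
  ext ω
  exact indicator_inter_iInter I A B ω

/-- The second moment method. -/
lemma sq_bitExp_le {Z : (E → Bool) → ℝ} (hp : p ∈ Set.Ioo (0 : ℝ) 1) {A : Set (E → Bool)}
    (hZ : ∀ ω, Z ω ≠ 0 → ω ∈ A) :
    bitExp p Z ^ 2 ≤ bitExp p (fun ω => Z ω ^ 2) * bitProb p A := by
  have hw : ∀ ω : E → Bool, 0 ≤ ∏ e, bitWeight p (ω e) := fun ω =>
    Finset.prod_nonneg fun _ _ => bitWeight_nonneg hp _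
  have h := Finset.sum_mul_sq_le_sq_mul_sq (Finset.univ : Finset (E → Bool))
    (fun ω => √(∏ e, bitWeight p (ω e)) * Z ω)
    (fun ω => √(∏ e, bitWeight p (ω e)) * A.indicator 1 ω)
  have h1 : ∀ ω, √(∏ e, bitWeight p (ω e)) * Z ω *
      (√(∏ e, bitWeight p (ω e)) * A.indicator 1 ω) = (∏ e, bitWeight p (ω e)) * Z ω := by
    intro ω
    rw [mul_mul_mul_comm, Real.mul_self_sqrt (hw ω)]
    by_cases h : ω ∈ A
    · simp [h]
    · have : Z ω = 0 := by by_contra h'; exact h (hZ ω h')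
      simp [this]
  have h2 : ∀ ω, (√(∏ e, bitWeight p (ω e)) * A.indicator 1 ω) ^ 2 =
      (∏ e, bitWeight p (ω e)) * A.indicator 1 ω := by
    intro ω
    rw [mul_pow, Real.sq_sqrt (hw ω)]
    by_cases h : ω ∈ A <;> simp [h]
  simp only [h1, h2, mul_pow, Real.sq_sqrt (hw _)] at h
  exact h

end BiasedBits

/-! ### The random graph as a family of independent bits -/

section GraphOfBits

/-- The graph whose edges are the non-diagonal pairs marked `true`. -/
def graphOfBits {V : Type*} (ω : Sym2 V → Bool) : SimpleGraph V :=
  SimpleGraph.fromEdgeSet {e | ω e = true}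

lemma graphOfBits_adj {V : Type*} (ω : Sym2 V → Bool) (u v : V) :
    (graphOfBits ω).Adj u v ↔ ω s(u, v) = true ∧ u ≠ v := by
  simp [graphOfBits]

lemma bitProb_graphOfBits_eq {n : ℕ} (p : ℝ) (G : SimpleGraph (Fin n)) :
    bitProb p {ω | graphOfBits ω = G} =
      p ^ Nat.card G.edgeSet * (1 - p) ^ (n * (n - 1) / 2 - Nat.card G.edgeSet) := by
  classical
  have hset : {ω : Sym2 (Fin n) → Bool | graphOfBits ω = G} =
      {ω | ∀ e ∈ Finset.univ.filter (fun e : Sym2 (Fin n) => ¬ e.IsDiag),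
        ω e = decide (e ∈ G.edgeSet)} := by
    ext ω
    simp only [Set.mem_ofPred_eq, Finset.mem_filter, Finset.mem_univ, true_and]
    constructor
    · rintro rfl e he
      induction e with
      | _ u v =>
        have : u ≠ v := by simpa using he
        simp [graphOfBits_adj, this]
    · intro h
      ext u v
      rw [graphOfBits_adj]
      by_cases huv : u = v
      · simp [huv]
      · have := h s(u, v) (by simpa using huv)
        simp [this, huv]
  have hsub : G.edgeFinset ⊆ Finset.univ.filter (fun e : Sym2 (Fin n) => ¬ e.IsDiag) := by
    intro e he
    simpa using G.not_isDiag_of_mem_edgeSet (by simpa using he)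
  have hcard : (Finset.univ.filter (fun e : Sym2 (Fin n) => ¬ e.IsDiag)).card
      = n * (n - 1) / 2 := by
    rw [← Fintype.card_subtype, Sym2.card_subtype_not_diag, Fintype.card_fin, Nat.choose_two_right]
  have hG : Nat.card G.edgeSet = G.edgeFinset.card := by
    rw [Nat.card_eq_fintype_card, SimpleGraph.edgeFinset_card]
  have hin : ∏ e ∈ G.edgeFinset, bitWeight p (decide (e ∈ G.edgeSet)) =
      p ^ G.edgeFinset.card :=
    Finset.prod_eq_pow_card fun e he => by
      have : e ∈ G.edgeSet := by simpa using he
      simp [bitWeight, this]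
  have hout : ∏ e ∈ Finset.univ.filter (fun e : Sym2 (Fin n) => ¬ e.IsDiag) \ G.edgeFinset,
      bitWeight p (decide (e ∈ G.edgeSet)) =
      (1 - p) ^ (n * (n - 1) / 2 - G.edgeFinset.card) := by
    rw [← hcard, ← Finset.card_sdiff_of_subset hsub]
    refine Finset.prod_eq_pow_card fun e he => ?_
    have : e ∉ G.edgeSet := fun h => (Finset.mem_sdiff.1 he).2 (by simpa using h)
    simp [bitWeight, this]
  rw [hset, bitProb_cylinder, ← Finset.prod_sdiff hsub, mul_comm, hin, hout, hG]

lemma gnp_toReal {n : ℕ} {p : ℝ} (hp : p ∈ Set.Ioo (0 : ℝ) 1) (S : Set (SimpleGraph (Fin n))) :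
    (gnp n p S).toReal = bitProb p {ω | graphOfBits ω ∈ S} := by
  classical
  have hS : MeasurableSet S := trivial
  have hq : 0 ≤ 1 - p := by linarith [hp.2]
  have hw : ∀ G : SimpleGraph (Fin n), 0 ≤ p ^ Nat.card G.edgeSet *
      (1 - p) ^ (n * (n - 1) / 2 - Nat.card G.edgeSet) := fun G =>
    mul_nonneg (pow_nonneg hp.1.le _) (pow_nonneg hq _)
  have hind : ∀ ω : Sym2 (Fin n) → Bool, ({ω | graphOfBits ω ∈ S}.indicator 1 ω : ℝ) =
      ∑ G, S.indicator 1 G * {ω | graphOfBits ω = G}.indicator 1 ω := by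
    intro ω
    rw [Finset.sum_eq_single (graphOfBits ω)]
    · by_cases h : graphOfBits ω ∈ S <;> simp [h]
    · intro G _ hG
      simp [Ne.symm hG]
    · simp
  have hR : bitProb p {ω | graphOfBits ω ∈ S} = ∑ G, S.indicator 1 G *
      (p ^ Nat.card G.edgeSet * (1 - p) ^ (n * (n - 1) / 2 - Nat.card G.edgeSet)) := by
    rw [bitProb, funext hind, bitExp_sum]
    refine Finset.sum_congr rfl fun G _ => ?_
    rw [bitExp_const_mul, ← bitProb_graphOfBits_eq]
    rfl
  rw [hR, gnp, Measure.sum_apply _ hS, tsum_fintype, ENNReal.toReal_sum]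
  · refine Finset.sum_congr rfl fun G _ => ?_
    rw [Measure.smul_apply, Measure.dirac_apply' _ hS, smul_eq_mul, ENNReal.toReal_mul,
      ENNReal.toReal_ofReal (hw G), mul_comm]
    by_cases h : G ∈ S <;> simp [h]
  · intro G _
    rw [Measure.smul_apply, Measure.dirac_apply' _ hS, smul_eq_mul]
    refine ENNReal.mul_ne_top ENNReal.ofReal_ne_top ?_
    by_cases h : G ∈ S <;> simp [h]

end GraphOfBits

/-! ### Labelled triples -/

section Labellings

variable {V : Type*} [Fintype V]

/-- The vertices with label `i`. -/
def labelClass (φ : V → Option (Fin 3)) (i : Fin 3) : Finset V :=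
  Finset.univ.filter fun v => φ v = some i

/-- The labelled vertices. -/
def labelSupport (φ : V → Option (Fin 3)) : Finset V :=
  Finset.univ.filter fun v => φ v ≠ none

@[simp] lemma mem_labelClass {φ : V → Option (Fin 3)} {i : Fin 3} {v : V} :
    v ∈ labelClass φ i ↔ φ v = some i := by simp [labelClass]

@[simp] lemma mem_labelSupport {φ : V → Option (Fin 3)} {v : V} :
    v ∈ labelSupport φ ↔ φ v ≠ none := by simp [labelSupport]

/-- The pairs of labelled vertices with different labels. -/
def crossGraph (φ : V → Option (Fin 3)) : SimpleGraph V where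
  Adj u v := φ u ≠ none ∧ φ v ≠ none ∧ φ u ≠ φ v
  symm := ⟨fun _ _ h => ⟨h.2.1, h.1, h.2.2.symm⟩⟩
  loopless := ⟨fun _ h => h.2.2 rfl⟩

instance (φ : V → Option (Fin 3)) : DecidableRel (crossGraph φ).Adj := fun _ _ =>
  inferInstanceAs (Decidable (_ ∧ _ ∧ _))

lemma crossGraph_adj {V : Type*} {φ : V → Option (Fin 3)} {u v : V} :
    (crossGraph φ).Adj u v ↔ φ u ≠ none ∧ φ v ≠ none ∧ φ u ≠ φ v := Iff.rfl

/-- Between two label classes the only edge is the one joining the distinguished vertices. -/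
def crossEvent (φ : V → Option (Fin 3)) (x : Fin 3 → V) : Set (Sym2 V → Bool) :=
  {ω | ∀ i j, i ≠ j → ∀ u v, φ u = some i → φ v = some j →
    (ω s(u, v) = true ↔ u = x i ∧ v = x j)}

/-- The vertex `v` has a neighbour in each of the sets `Z z`. -/
def domEvent {ι : Type*} (Z : ι → Finset V) (v : V) : Set (Sym2 V → Bool) :=
  {ω | ∀ z, ∃ u ∈ Z z, ω s(v, u) = true}

/-- The labelled triple `(φ, x)` is special. -/
def specialEvent (φ : V → Option (Fin 3)) (x : Fin 3 → V) : Set (Sym2 V → Bool) :=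
  {ω | ω ∈ crossEvent φ x ∧ ∀ v, φ v = none → ω ∈ domEvent (labelClass φ) v}

lemma countX_pos_of_mem_specialEvent {n k : ℕ} {φ : Fin n → Option (Fin 3)} {x : Fin 3 → Fin n}
    {ω : Sym2 (Fin n) → Bool} (hφ : ∀ i, (labelClass φ i).card = k) (hx : ∀ i, φ (x i) = some i)
    (h : ω ∈ specialEvent φ x) : 0 < countX (graphOfBits ω) k k k := by
  have hdisj : ∀ i j, i ≠ j → Disjoint (labelClass φ i) (labelClass φ j) := by
    intro i j hij
    refine Finset.disjoint_left.2 fun v hv hv' => hij ?_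
    simpa [mem_labelClass.1 hv] using mem_labelClass.1 hv'
  have hcross : ∀ i j, i ≠ j → ∀ u ∈ labelClass φ i, ∀ v ∈ labelClass φ j,
      ((graphOfBits ω).Adj u v ↔ u = x i ∧ v = x j) := by
    intro i j hij u hu v hv
    have huv : u ≠ v := by
      rintro rfl
      exact Finset.disjoint_left.1 (hdisj i j hij) hu hv
    rw [graphOfBits_adj, ← h.1 i j hij u v (mem_labelClass.1 hu) (mem_labelClass.1 hv)]
    simp [huv]
  have hdom : ∀ v, φ v = none → ∀ i, ∃ u ∈ labelClass φ i, (graphOfBits ω).Adj v u := by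
    intro v hv i
    obtain ⟨u, hu, hvu⟩ := h.2 v hv i
    refine ⟨u, hu, (graphOfBits_adj _ _ _).2 ⟨hvu, ?_⟩⟩
    rintro rfl
    simp [hv] at hu
  refine Nat.card_pos_iff.2 ⟨⟨⟨(labelClass φ 0, labelClass φ 1, labelClass φ 2, x 0, x 1, x 2),
    hφ 0, hφ 1, hφ 2, hdisj 0 1 (by decide), hdisj 0 2 (by decide), hdisj 1 2 (by decide),
    by simp [hx], by simp [hx], by simp [hx], ?_, hcross 0 1 (by decide), hcross 0 2 (by decide),
    hcross 1 2 (by decide)⟩⟩, inferInstance⟩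
  intro v h0 h1 h2
  have hv : φ v = none := by
    simp only [mem_labelClass] at h0 h1 h2
    rcases hv : φ v with _ | i
    · rfl
    · fin_cases i <;> simp_all
  exact ⟨hdom v hv 0, hdom v hv 1, hdom v hv 2⟩

end Labellings

/-! ### Counting cross pairs -/

section CrossPairs

variable {V : Type*} [Fintype V] [DecidableEq V]

/-- The number of vertices labelled `i` by `φ` and `j` by `ψ`. -/
def overlap (φ ψ : V → Option (Fin 3)) (i j : Fin 3) : ℕ :=
  (labelClass φ i ∩ labelClass ψ j).card

lemma sum_eq_sum_overlap (φ ψ : V → Option (Fin 3)) (F : Option (Fin 3) → Option (Fin 3) → ℕ)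
    (hF₁ : ∀ b, F none b = 0) (hF₂ : ∀ a, F a none = 0) :
    ∑ v, F (φ v) (ψ v) = ∑ i, ∑ j, overlap φ ψ i j * F (some i) (some j) := by
  have h : ∀ v, F (φ v) (ψ v) =
      ∑ i, ∑ j, if v ∈ labelClass φ i ∩ labelClass ψ j then F (some i) (some j) else 0 := by
    intro v
    rcases hφ : φ v with _ | i
    · simp [hφ, hF₁]
    · rcases hψ : ψ v with _ | j
      · simp [hψ, hF₂]
      · simp [hφ, hψ, ite_and]
  simp only [h]
  rw [Finset.sum_comm]
  refine Finset.sum_congr rfl fun i _ => ?_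
  rw [Finset.sum_comm]
  refine Finset.sum_congr rfl fun j _ => ?_
  rw [← Finset.sum_filter, Finset.sum_const, smul_eq_mul, overlap]
  congr 2
  ext v
  simp

lemma two_mul_card_edgeFinset_inf (φ ψ : V → Option (Fin 3)) :
    2 * (crossGraph φ ⊓ crossGraph ψ).edgeFinset.card =
      ∑ i, ∑ j, overlap φ ψ i j *
        ∑ i', ∑ j', overlap φ ψ i' j' * if i ≠ i' ∧ j ≠ j' then 1 else 0 := by
  let R : Option (Fin 3) → Option (Fin 3) → Option (Fin 3) → Option (Fin 3) → ℕ :=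
    fun a b c d => if a ≠ none ∧ b ≠ none ∧ c ≠ none ∧ d ≠ none ∧ a ≠ c ∧ b ≠ d then 1 else 0
  have hdeg : ∀ v, (crossGraph φ ⊓ crossGraph ψ).degree v = ∑ w, R (φ v) (ψ v) (φ w) (ψ w) := by
    intro v
    rw [← SimpleGraph.card_neighborFinset_eq_degree, ← Finset.sum_filter, Finset.sum_const,
      smul_eq_mul, mul_one]
    congr 1
    ext w
    simp only [SimpleGraph.mem_neighborFinset, SimpleGraph.inf_adj, crossGraph_adj,
      Finset.mem_filter, Finset.mem_univ, true_and]
    tauto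
  have hin : ∀ a b, ∑ w, R a b (φ w) (ψ w) =
      ∑ i', ∑ j', overlap φ ψ i' j' * R a b (some i') (some j') := fun a b =>
    sum_eq_sum_overlap φ ψ (R a b) (by simp [R]) (by simp [R])
  have hE : 2 * (crossGraph φ ⊓ crossGraph ψ).edgeFinset.card =
      ∑ v, (crossGraph φ ⊓ crossGraph ψ).degree v := by
    rw [SimpleGraph.sum_degrees_eq_twice_card_edges]
    congr!
  rw [hE]
  simp only [hdeg, hin]
  rw [sum_eq_sum_overlap φ ψ
    (fun a b => ∑ i', ∑ j', overlap φ ψ i' j' * R a b (some i') (some j'))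
    (by simp [R]) (by simp [R])]
  simp [R]

lemma overlap_self {k : ℕ} {φ : V → Option (Fin 3)} (hφ : ∀ i, (labelClass φ i).card = k)
    (i j : Fin 3) : overlap φ φ i j = if i = j then k else 0 := by
  split_ifs with h
  · simp [overlap, h, hφ]
  · refine Finset.card_eq_zero.2 (Finset.disjoint_iff_inter_eq_empty.1 ?_)
    refine Finset.disjoint_left.2 fun v hv hv' => h ?_
    simpa [mem_labelClass.1 hv] using mem_labelClass.1 hv'

lemma card_edgeFinset_crossGraph {k : ℕ} {φ : V → Option (Fin 3)}
    (hφ : ∀ i, (labelClass φ i).card = k) : (crossGraph φ).edgeFinset.card = 3 * k ^ 2 := by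
  have h := two_mul_card_edgeFinset_inf φ φ
  simp only [SimpleGraph.edgeFinset_inf, Finset.inter_self, overlap_self hφ] at h
  simp [Fin.sum_univ_three] at h
  nlinarith

lemma card_edgeFinset_sup_add_inf {k : ℕ} {φ ψ : V → Option (Fin 3)}
    (hφ : ∀ i, (labelClass φ i).card = k) (hψ : ∀ i, (labelClass ψ i).card = k) :
    (crossGraph φ ⊔ crossGraph ψ).edgeFinset.card +
      (crossGraph φ ⊓ crossGraph ψ).edgeFinset.card = 6 * k ^ 2 := by
  rw [SimpleGraph.edgeFinset_sup, SimpleGraph.edgeFinset_inf, Finset.card_union_add_card_inter,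
    card_edgeFinset_crossGraph hφ, card_edgeFinset_crossGraph hψ]
  ring

end CrossPairs

/-! ### Probabilities of the events -/

section EventProbabilities

variable {V : Type*} [Fintype V] [DecidableEq V] {p : ℝ}

/-- The pairs of distinguished vertices. -/
def specialPairs (x : Fin 3 → V) : Finset (Sym2 V) := {s(x 0, x 1), s(x 0, x 2), s(x 1, x 2)}

omit [Fintype V] in
lemma mem_specialPairs_of_ne (x : Fin 3 → V) {i j : Fin 3} (h : i ≠ j) :
    s(x i, x j) ∈ specialPairs x := by
  fin_cases i <;> fin_cases j <;> simp [specialPairs, Sym2.eq_swap] at h ⊢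

omit [Fintype V] in
lemma mem_specialPairs_iff {φ : V → Option (Fin 3)} {x : Fin 3 → V} (hx : ∀ i, φ (x i) = some i)
    {i j : Fin 3} (hij : i ≠ j) {u v : V} (hu : φ u = some i) (hv : φ v = some j) :
    s(u, v) ∈ specialPairs x ↔ u = x i ∧ v = x j := by
  constructor
  · intro h
    have key : ∀ a b : Fin 3, u = x a → v = x b → u = x i ∧ v = x j := by
      rintro a b rfl rfl
      rw [hx] at hu hv
      simp_all
    simp only [specialPairs, Finset.mem_insert, Finset.mem_singleton, Sym2.eq_iff] at h
    rcases h with (h | h) | (h | h) | (h | h) <;> exact key _ _ h.1 h.2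
  · rintro ⟨rfl, rfl⟩
    exact mem_specialPairs_of_ne x hij

lemma eq_false_of_mem_crossEvent {φ : V → Option (Fin 3)} {x : Fin 3 → V} {ω : Sym2 V → Bool}
    (h : ω ∈ crossEvent φ x) {e : Sym2 V} (he : e ∈ (crossGraph φ).edgeFinset)
    (hx : e ∉ specialPairs x) : ω e = false := by
  induction e with
  | _ u v =>
    simp only [SimpleGraph.mem_edgeFinset, SimpleGraph.mem_edgeSet, crossGraph_adj] at he
    obtain ⟨i, hi⟩ := Option.ne_none_iff_exists'.1 he.1
    obtain ⟨j, hj⟩ := Option.ne_none_iff_exists'.1 he.2.1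
    have hij : i ≠ j := by
      rintro rfl
      exact he.2.2 (hi.trans hj.symm)
    by_contra hω
    obtain ⟨rfl, rfl⟩ := (h i j hij u v hi hj).1 (by simpa using hω)
    exact hx (mem_specialPairs_of_ne x hij)

lemma bitProb_crossEvent_inter_le (hp : p ∈ Set.Ioo (0 : ℝ) 1) (φ ψ : V → Option (Fin 3))
    (x y : Fin 3 → V) :
    bitProb p (crossEvent φ x ∩ crossEvent ψ y) * (1 - p) ^ 6 ≤
      (1 - p) ^ (crossGraph φ ⊔ crossGraph ψ).edgeFinset.card := by
  have hq0 : 0 ≤ 1 - p := by linarith [hp.2]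
  have hq1 : 1 - p ≤ 1 := by linarith [hp.1]
  set F := (crossGraph φ ⊔ crossGraph ψ).edgeFinset
  set S := specialPairs x ∪ specialPairs y
  have hS : S.card ≤ 6 := (Finset.card_union_le _ _).trans
    (add_le_add Finset.card_le_three Finset.card_le_three)
  have hle : bitProb p (crossEvent φ x ∩ crossEvent ψ y) ≤ (1 - p) ^ (F \ S).card := by
    rw [← bitProb_all_false]
    refine bitProb_mono hp fun ω hω e he => ?_
    simp only [F, S, Finset.mem_sdiff, SimpleGraph.edgeFinset_sup, Finset.mem_union,
      not_or] at he
    rcases he.1 with h | h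
    · exact eq_false_of_mem_crossEvent hω.1 h he.2.1
    · exact eq_false_of_mem_crossEvent hω.2 h he.2.2
  calc _ ≤ (1 - p) ^ (F \ S).card * (1 - p) ^ 6 := by gcongr
    _ = (1 - p) ^ ((F \ S).card + 6) := (pow_add _ _ _).symm
    _ ≤ _ := pow_le_pow_of_le_one hq0 hq1 (by have := Finset.le_card_sdiff S F; omega)

lemma le_bitProb_crossEvent (hp : p ∈ Set.Ioo (0 : ℝ) 1) {φ : V → Option (Fin 3)}
    {x : Fin 3 → V} (hx : ∀ i, φ (x i) = some i) :
    p ^ 3 * (1 - p) ^ (crossGraph φ).edgeFinset.card ≤ bitProb p (crossEvent φ x) := by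
  have hq0 : 0 ≤ 1 - p := by linarith [hp.2]
  have hq1 : 1 - p ≤ 1 := by linarith [hp.1]
  set F := (crossGraph φ).edgeFinset
  set S := specialPairs x
  have hS : S.card ≤ 3 := Finset.card_le_three
  have hsub : {ω : Sym2 V → Bool | ∀ e ∈ F, ω e = decide (e ∈ S)} ⊆ crossEvent φ x := by
    intro ω hω i j hij u v hu hv
    have hne : φ u ≠ φ v := by simpa [hu, hv] using hij
    have : ω s(u, v) = _ := hω s(u, v) (by simp [F, crossGraph_adj, hu, hv, hij])
    rw [this, decide_eq_true_eq, mem_specialPairs_iff hx hij hu hv]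
  refine le_trans ?_ (bitProb_mono hp hsub)
  rw [bitProb_cylinder, ← Finset.prod_inter_mul_prod_sdiff F S]
  have h1 : ∏ e ∈ F ∩ S, bitWeight p (decide (e ∈ S)) = p ^ (F ∩ S).card :=
    Finset.prod_eq_pow_card fun e he => by
      simp [bitWeight, (Finset.mem_inter.1 he).2]
  have h2 : ∏ e ∈ F \ S, bitWeight p (decide (e ∈ S)) = (1 - p) ^ (F \ S).card :=
    Finset.prod_eq_pow_card fun e he => by
      simp [bitWeight, (Finset.mem_sdiff.1 he).2]
  rw [h1, h2]
  have := hp.1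
  exact mul_le_mul (pow_le_pow_of_le_one hp.1.le hp.2.le
      ((Finset.card_le_card Finset.inter_subset_right).trans hS))
    (pow_le_pow_of_le_one hq0 hq1 (Finset.card_le_card Finset.sdiff_subset))
    (by positivity) (by positivity)

/-- No vertex of `Z` is a neighbour of `v`. -/
def missEvent (Z : Finset V) (v : V) : Set (Sym2 V → Bool) := {ω | ∀ u ∈ Z, ω s(v, u) = false}

lemma bitProb_missEvent (Z : Finset V) (v : V) :
    bitProb p (missEvent Z v) = (1 - p) ^ Z.card := by
  have hinj : Function.Injective fun u : V => s(v, u) := fun a b h => Sym2.congr_right.1 h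
  rw [← Finset.card_image_of_injective Z hinj, ← bitProb_all_false]
  congr 1
  ext ω
  simp [missEvent]

variable {ι : Type*} [Fintype ι]

lemma le_bitProb_domEvent (hp : p ∈ Set.Ioo (0 : ℝ) 1) (Z : ι → Finset V) (v : V) :
    1 - ∑ z, (1 - p) ^ (Z z).card ≤ bitProb p (domEvent Z v) := by
  simp only [← bitProb_missEvent (p := p) _ v, bitProb]
  have h1 : bitExp p (Set.univ.indicator 1 : (Sym2 V → Bool) → ℝ) = 1 := bitProb_univ
  refine (le_of_eq ?_).trans (bitExp_mono (f := fun ω => Set.univ.indicator 1 ω -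
    ∑ z, (missEvent (Z z) v).indicator 1 ω) hp fun ω => ?_)
  · rw [bitExp_sub, bitExp_sum, h1]
  by_cases h : ω ∈ domEvent Z v
  · rw [Set.indicator_of_mem h]
    simp only [Set.indicator_univ, Pi.one_apply]
    have : 0 ≤ ∑ z, ((missEvent (Z z) v).indicator 1 ω : ℝ) :=
      Finset.sum_nonneg fun z _ => Set.indicator_nonneg (fun _ _ => zero_le_one) ω
    linarith
  · rw [Set.indicator_of_notMem h]
    simp only [domEvent, Set.mem_ofPred_eq, not_forall, not_exists, not_and,
      Bool.not_eq_true] at h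
    obtain ⟨z, hz⟩ := h
    have : (1 : ℝ) ≤ ∑ z, ((missEvent (Z z) v).indicator 1 ω : ℝ) := by
      have h2 := Finset.single_le_sum (f := fun z => ((missEvent (Z z) v).indicator 1 ω : ℝ))
        (fun z _ => Set.indicator_nonneg (fun _ _ => zero_le_one) ω) (Finset.mem_univ z)
      rwa [Set.indicator_of_mem (show ω ∈ missEvent (Z z) v from hz)] at h2
    simp only [Set.indicator_univ, Pi.one_apply]
    linarith

lemma bitProb_domEvent_le (hp : p ∈ Set.Ioo (0 : ℝ) 1) (Z : ι → Finset V) (v : V) :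
    bitProb p (domEvent Z v) ≤ 1 - 3 / 2 * ∑ z, (1 - p) ^ (Z z).card +
      1 / 2 * ∑ z, ∑ z', (1 - p) ^ (Z z ∪ Z z').card := by
  simp only [← bitProb_missEvent (p := p) _ v, bitProb]
  have h1 : bitExp p (Set.univ.indicator 1 : (Sym2 V → Bool) → ℝ) = 1 := bitProb_univ
  refine (bitExp_mono (g := fun ω => Set.univ.indicator 1 ω -
    3 / 2 * ∑ z, (missEvent (Z z) v).indicator 1 ω +
    1 / 2 * ∑ z, ∑ z', (missEvent (Z z ∪ Z z') v).indicator 1 ω) hp fun ω => ?_).trans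
    (le_of_eq ?_)
  swap
  · simp only [bitExp_add, bitExp_sub, bitExp_const_mul, bitExp_sum, h1]
  classical
  set N : ℕ := (Finset.univ.filter fun z => ω ∈ missEvent (Z z) v).card with hN
  have hs1 : ∑ z, ((missEvent (Z z) v).indicator 1 ω : ℝ) = N := by
    simp only [Set.indicator_apply, Pi.one_apply, Finset.sum_boole, hN]
  have hs2 : ∑ z, ∑ z', ((missEvent (Z z ∪ Z z') v).indicator 1 ω : ℝ) = N * N := by
    rw [← hs1, Finset.sum_mul_sum]
    refine Finset.sum_congr rfl fun z _ => Finset.sum_congr rfl fun z' _ => ?_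
    rw [← Pi.mul_apply, ← Set.inter_indicator_one]
    congr 2
    ext ω
    simp only [missEvent, Finset.mem_union, Set.mem_ofPred_eq, Set.mem_inter_iff]
    exact ⟨fun h => ⟨fun u hu => h u (Or.inl hu), fun u hu => h u (Or.inr hu)⟩,
      fun h u hu => hu.elim (h.1 u) (h.2 u)⟩
  rw [hs1, hs2]
  simp only [Set.indicator_univ, Pi.one_apply]
  by_cases h : ω ∈ domEvent Z v
  · have hN0 : N = 0 := by
      refine Finset.card_eq_zero.2 (Finset.filter_eq_empty_iff.2 fun z _ hz => ?_)
      obtain ⟨u, hu, hvu⟩ := h z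
      simp [hz u hu] at hvu
    rw [Set.indicator_of_mem h, hN0]
    simp
  · rw [Set.indicator_of_notMem h]
    have hint : (0 : ℝ) ≤ (N - 1) * (N - 2) := by
      rcases Nat.lt_or_ge N 2 with h2 | h2
      · interval_cases N <;> norm_num
      · have : (2 : ℝ) ≤ N := by exact_mod_cast h2
        nlinarith
    nlinarith

omit [Fintype V] [DecidableEq V] [Fintype ι] in
lemma dependsOn_domEvent (Z : ι → Finset V) (v : V) :
    DependsOn ((domEvent Z v).indicator (1 : (Sym2 V → Bool) → ℝ))
      {e | ∃ z, ∃ u ∈ Z z, e = s(v, u)} :=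
  dependsOn_indicator fun ω ω' h hω z => by
    obtain ⟨u, hu, hvu⟩ := hω z
    exact ⟨u, hu, by rw [← h s(v, u) ⟨z, u, hu, rfl⟩, hvu]⟩

omit [Fintype V] [DecidableEq V] in
lemma dependsOn_crossEvent (φ : V → Option (Fin 3)) (x : Fin 3 → V) :
    DependsOn ((crossEvent φ x).indicator (1 : (Sym2 V → Bool) → ℝ))
      {e | ∀ u ∈ e, φ u ≠ none} :=
  dependsOn_indicator fun ω ω' h hω i j hij u v hu hv => by
    rw [← h s(u, v) (by simp [hu, hv])]
    exact hω i j hij u v hu hv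

omit [Fintype V] [DecidableEq V] [Fintype ι] in
lemma pairwiseDisjoint_domEvent_bits {Z : ι → Finset V} {W I : Finset V}
    (hZ : ∀ z, Z z ⊆ W) (hI : Disjoint I W) :
    (I : Set V).PairwiseDisjoint fun v => {e | ∃ z, ∃ u ∈ Z z, e = s(v, u)} := by
  intro v hv w hw hvw
  refine Set.disjoint_left.2 ?_
  rintro e ⟨z, u, hu, rfl⟩ ⟨y, u₂, hu₂, h⟩
  rcases Sym2.eq_iff.1 h with ⟨h1, -⟩ | ⟨h1, -⟩
  · exact hvw h1
  · exact Finset.disjoint_left.1 hI hv (h1 ▸ hZ y hu₂)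

/-- A lower bound for the probability that a labelled triple is special. -/
lemma le_bitProb_specialEvent {k : ℕ} (hp : p ∈ Set.Ioo (0 : ℝ) 1) {φ : V → Option (Fin 3)}
    {x : Fin 3 → V} (hφ : ∀ i, (labelClass φ i).card = k) (hx : ∀ i, φ (x i) = some i)
    (hk : 3 * (1 - p) ^ k ≤ 1) :
    p ^ 3 * (1 - p) ^ (3 * k ^ 2) * (1 - 3 * (1 - p) ^ k) ^ Fintype.card V ≤
      bitProb p (specialEvent φ x) := by
  classical
  have hq0 : 0 < 1 - p := by linarith [hp.2]
  have hset : specialEvent φ x =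
      crossEvent φ x ∩ ⋂ v ∈ (labelSupport φ)ᶜ, domEvent (labelClass φ) v := by
    ext ω
    simp [specialEvent]
  have hdisj : Disjoint (labelSupport φ)ᶜ (labelSupport φ) := disjoint_compl_left
  rw [hset, bitProb_inter_iInter _ (fun v _ => dependsOn_domEvent (labelClass φ) v)
    (pairwiseDisjoint_domEvent_bits (W := labelSupport φ)
      (fun i v hv => by simp [mem_labelClass.1 hv]) hdisj)
    (dependsOn_crossEvent φ x) (fun v hv => ?_), ← card_edgeFinset_crossGraph hφ]
  · have hle : 1 - 3 * (1 - p) ^ k ≤ 1 := by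
      have := pow_pos hq0 k
      linarith
    refine mul_le_mul (le_bitProb_crossEvent hp hx) ?_ (pow_nonneg (by linarith) _)
      (bitProb_nonneg hp _)
    calc _ ≤ (1 - 3 * (1 - p) ^ k) ^ (labelSupport φ)ᶜ.card :=
          pow_le_pow_of_le_one (by linarith) hle (Finset.card_le_univ _)
      _ = ∏ v ∈ (labelSupport φ)ᶜ, (1 - 3 * (1 - p) ^ k) := by rw [Finset.prod_const]
      _ ≤ _ := Finset.prod_le_prod (fun _ _ => by linarith) fun v _ => by
        have := le_bitProb_domEvent hp (labelClass φ) v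
        simp only [hφ, Finset.sum_const, Finset.card_univ, Fintype.card_fin, nsmul_eq_mul] at this
        exact_mod_cast this
  · refine Set.disjoint_left.2 ?_
    rintro e he ⟨z, u, hu, rfl⟩
    simp at hv
    exact he v (by simp) hv

/-- An upper bound for the probability that two labelled triples are both special. -/
lemma bitProb_specialEvent_inter_le {k : ℕ} (hp : p ∈ Set.Ioo (0 : ℝ) 1)
    {φ ψ : V → Option (Fin 3)} (x y : Fin 3 → V) (hφ : ∀ i, (labelClass φ i).card = k)
    (hψ : ∀ i, (labelClass ψ i).card = k) :
    bitProb p (specialEvent φ x ∩ specialEvent ψ y) * (1 - p) ^ 6 ≤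
      (1 - p) ^ (crossGraph φ ⊔ crossGraph ψ).edgeFinset.card *
        Real.exp ((labelSupport φ ∪ labelSupport ψ)ᶜ.card *
          (-6 * (1 - p) ^ k + 6 * (1 - p) ^ (2 * k) +
            ∑ i, ∑ j, (1 - p) ^ (2 * k - overlap φ ψ i j))) := by
  set W := labelSupport φ ∪ labelSupport ψ with hW
  set Z : Fin 3 ⊕ Fin 3 → Finset V := Sum.elim (labelClass φ) (labelClass ψ) with hZ
  have hq0 : 0 < 1 - p := by linarith [hp.2]
  have hZW : ∀ z, Z z ⊆ W := by
    rintro (i | i) v hv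
    · simp [hZ, hW] at hv ⊢
      simp [hv]
    · simp [hZ, hW] at hv ⊢
      simp [hv]
  have hset : specialEvent φ x ∩ specialEvent ψ y ⊆
      (crossEvent φ x ∩ crossEvent ψ y) ∩ ⋂ v ∈ Wᶜ, domEvent Z v := by
    rintro ω ⟨h1, h2⟩
    refine ⟨⟨h1.1, h2.1⟩, Set.mem_iInter₂.2 fun v hv => ?_⟩
    simp [hW] at hv
    rintro (i | i)
    · exact h1.2 v hv.1 i
    · exact h2.2 v hv.2 i
  have hdep : DependsOn ((crossEvent φ x ∩ crossEvent ψ y).indicator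
      (1 : (Sym2 V → Bool) → ℝ)) {e | ∀ u ∈ e, u ∈ W} := by
    refine dependsOn_indicator fun ω ω' h hω => ⟨fun i j hij u v hu hv => ?_,
      fun i j hij u v hu hv => ?_⟩
    · rw [← h s(u, v) (by simp [hW, hu, hv])]
      exact hω.1 i j hij u v hu hv
    · rw [← h s(u, v) (by simp [hW, hu, hv])]
      exact hω.2 i j hij u v hu hv
  have hunion : ∀ A B : Finset V, A.card = k → B.card = k →
      (A ∪ B).card = 2 * k - (A ∩ B).card := fun A B hA hB => by
    have := Finset.card_union_add_card_inter A B
    omega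
  have hself : ∀ {χ : V → Option (Fin 3)}, (∀ i, (labelClass χ i).card = k) →
      ∑ i, ∑ j, (1 - p) ^ (labelClass χ i ∪ labelClass χ j).card =
        3 * (1 - p) ^ k + 6 * (1 - p) ^ (2 * k) := by
    intro χ hχ
    have : ∀ i j, (labelClass χ i ∪ labelClass χ j).card = if i = j then k else 2 * k := by
      intro i j
      have h1 := overlap_self hχ i j
      rw [overlap] at h1
      rw [hunion _ _ (hχ i) (hχ j), h1]
      split_ifs <;> omega
    simp [this, Fin.sum_univ_three]
    ring
  have hdom : ∀ v, bitProb p (domEvent Z v) ≤ Real.exp (-6 * (1 - p) ^ k +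
      6 * (1 - p) ^ (2 * k) + ∑ i, ∑ j, (1 - p) ^ (2 * k - overlap φ ψ i j)) := by
    intro v
    refine (bitProb_domEvent_le hp Z v).trans (le_trans (le_of_eq ?_) (Real.add_one_le_exp _))
    have h12 : ∑ i, ∑ j, (1 - p) ^ (labelClass φ i ∪ labelClass ψ j).card =
        ∑ i, ∑ j, (1 - p) ^ (2 * k - overlap φ ψ i j) :=
      Finset.sum_congr rfl fun i _ => Finset.sum_congr rfl fun j _ => by
        rw [hunion _ _ (hφ i) (hψ j), overlap]
    have h21 : ∑ j, ∑ i, (1 - p) ^ (labelClass ψ j ∪ labelClass φ i).card =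
        ∑ i, ∑ j, (1 - p) ^ (2 * k - overlap φ ψ i j) := by
      rw [← h12, Finset.sum_comm]
      simp only [Finset.union_comm]
    simp only [Fintype.sum_sum_type, hZ, Sum.elim_inl, Sum.elim_inr, Finset.sum_add_distrib,
      hself hφ, hself hψ, h12, h21, hφ, hψ, Finset.sum_const, Finset.card_univ,
      Fintype.card_fin, nsmul_eq_mul]
    push_cast
    ring
  calc _ ≤ bitProb p ((crossEvent φ x ∩ crossEvent ψ y) ∩ ⋂ v ∈ Wᶜ, domEvent Z v) *
          (1 - p) ^ 6 := by
        gcongr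
        exact bitProb_mono hp hset
    _ = (bitProb p (crossEvent φ x ∩ crossEvent ψ y) * (1 - p) ^ 6) *
          ∏ v ∈ Wᶜ, bitProb p (domEvent Z v) := by
        rw [bitProb_inter_iInter _ (fun v _ => dependsOn_domEvent Z v)
          (pairwiseDisjoint_domEvent_bits hZW disjoint_compl_left) hdep]
        · ring
        · intro v hv
          refine Set.disjoint_left.2 ?_
          rintro e he ⟨z, u, hu, rfl⟩
          exact (Finset.mem_compl.1 hv) (he v (by simp))
    _ ≤ _ := by
        refine mul_le_mul (bitProb_crossEvent_inter_le hp φ ψ x y) ?_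
          (Finset.prod_nonneg fun _ _ => bitProb_nonneg hp _) (by positivity)
        rw [Real.exp_nat_mul, ← Finset.prod_const]
        exact Finset.prod_le_prod (fun _ _ => bitProb_nonneg hp _) fun v _ => hdom v

end EventProbabilities

/-! ### The overlap inequality -/

section OverlapInequality

/-- For a nonnegative `3 × 3` matrix with row sums at most `K`, the quantity
`K * ∑ a - c`, where `2 * c` is the sum of the products of entries in different rows and different
columns, is large unless the matrix is close to `0` or to a multiple of a permutation matrix. -/
lemma overlap_trichotomy {K : ℝ} (hK : 0 < K) {a : Fin 3 → Fin 3 → ℝ} (ha : ∀ i j, 0 ≤ a i j)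
    (hrow : ∀ i, ∑ j, a i j ≤ K) {D : ℝ}
    (hD : 2 * D = 2 * K * (∑ i, ∑ j, a i j) -
      ∑ i, ∑ j, a i j * ∑ i', ∑ j', a i' j' * if i ≠ i' ∧ j ≠ j' then 1 else 0) :
    ((∀ i j, a i j ≤ K / 4) ∧ K / 2 * (∑ i, ∑ j, a i j) ≤ D) ∨ K ^ 2 / 32 ≤ D ∨
      ∃ σ : Equiv.Perm (Fin 3), (∀ i, K / 4 ≤ a i (σ i)) ∧
        K / 4 * (3 * K - ∑ i, a i (σ i)) ≤ D := by
  have hDr : D = 1 / 2 * (∑ i, ∑ j, if i ≠ j then (∑ β, a i β) * (K - ∑ β, a j β) else 0) +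
      1 / 2 * ∑ β, ∑ i, ∑ j, if i ≠ j then a i β * a j β else 0 := by
    simp [Fin.sum_univ_three] at hD ⊢
    linarith
  have hR0 : ∀ i, 0 ≤ ∑ β, a i β := fun i => Finset.sum_nonneg fun j _ => ha i j
  have hRK : ∀ i, 0 ≤ K - ∑ β, a i β := fun i => sub_nonneg.2 (hrow i)
  have hA : ∀ i j, 0 ≤ (∑ β, a i β) * (K - ∑ β, a j β) := fun i j => mul_nonneg (hR0 i) (hRK j)
  have hB : ∀ i j β, 0 ≤ a i β * a j β := fun i j β => mul_nonneg (ha i β) (ha j β)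
  have hpairR : ∀ i j, i ≠ j → (∑ β, a i β) * (K - ∑ β, a j β) ≤ 2 * D := by
    intro i j hij
    have h1 : (∑ β, a i β) * (K - ∑ β, a j β) ≤
        ∑ i, ∑ j, if i ≠ j then (∑ β, a i β) * (K - ∑ β, a j β) else 0 := by
      refine le_trans ?_ (Finset.single_le_sum (f := fun i => ∑ j, if i ≠ j then
        (∑ β, a i β) * (K - ∑ β, a j β) else 0) (fun i _ => Finset.sum_nonneg fun j _ => ?_)
        (Finset.mem_univ i))
      · refine le_trans (by simp [hij]) (Finset.single_le_sum (f := fun j => if i ≠ j then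
          (∑ β, a i β) * (K - ∑ β, a j β) else 0) (fun j _ => ?_) (Finset.mem_univ j))
        split_ifs
        exacts [hA _ _, le_rfl]
      · split_ifs
        exacts [hA _ _, le_rfl]
    have h2 : 0 ≤ ∑ β, ∑ i, ∑ j, if i ≠ j then a i β * a j β else 0 :=
      Finset.sum_nonneg fun β _ => Finset.sum_nonneg fun i _ => Finset.sum_nonneg fun j _ => by
        split_ifs
        exacts [hB _ _ _, le_rfl]
    linarith
  have hpairC : ∀ i j β, i ≠ j → a i β * a j β ≤ 2 * D := by
    intro i j β hij
    have h1 : 0 ≤ ∑ i, ∑ j, if i ≠ j then (∑ β, a i β) * (K - ∑ β, a j β) else 0 :=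
      Finset.sum_nonneg fun i _ => Finset.sum_nonneg fun j _ => by
        split_ifs
        exacts [hA _ _, le_rfl]
    have h2 : a i β * a j β ≤ ∑ β, ∑ i, ∑ j, if i ≠ j then a i β * a j β else 0 := by
      refine le_trans ?_ (Finset.single_le_sum (f := fun β => ∑ i, ∑ j, if i ≠ j then
        a i β * a j β else 0) (fun β _ => Finset.sum_nonneg fun i _ =>
          Finset.sum_nonneg fun j _ => ?_) (Finset.mem_univ β))
      · refine le_trans ?_ (Finset.single_le_sum (f := fun i => ∑ j, if i ≠ j then
          a i β * a j β else 0) (fun i _ => Finset.sum_nonneg fun j _ => ?_) (Finset.mem_univ i))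
        · refine le_trans (by simp [hij]) (Finset.single_le_sum (f := fun j => if i ≠ j then
            a i β * a j β else 0) (fun j _ => ?_) (Finset.mem_univ j))
          split_ifs
          exacts [hB _ _ _, le_rfl]
        · split_ifs
          exacts [hB _ _ _, le_rfl]
      · split_ifs
        exacts [hB _ _ _, le_rfl]
    linarith
  by_cases hsmall : ∀ i j, a i j ≤ K / 4
  · refine Or.inl ⟨hsmall, ?_⟩
    have hM : ∀ i j, ∑ i', ∑ j', a i' j' * (if i ≠ i' ∧ j ≠ j' then 1 else 0) ≤ K := by
      intro i j
      fin_cases i <;> fin_cases j <;> simp [Fin.sum_univ_three] <;>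
        linarith [hsmall 0 0, hsmall 0 1, hsmall 0 2, hsmall 1 0, hsmall 1 1, hsmall 1 2,
          hsmall 2 0, hsmall 2 1, hsmall 2 2]
    have : ∑ i, ∑ j, a i j * ∑ i', ∑ j', a i' j' * (if i ≠ i' ∧ j ≠ j' then 1 else 0) ≤
        ∑ i, ∑ j, a i j * K :=
      Finset.sum_le_sum fun i _ => Finset.sum_le_sum fun j _ =>
        mul_le_mul_of_nonneg_left (hM i j) (ha i j)
    simp only [← Finset.sum_mul] at this
    linarith
  refine Or.inr ?_
  by_cases hbig : K ^ 2 / 32 ≤ D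
  · exact Or.inl hbig
  refine Or.inr ?_
  push Not at hsmall hbig
  obtain ⟨i₀, j₀, h₀⟩ := hsmall
  have hentry : ∀ i, ∃ j, K / 4 ≤ a i j := by
    intro i
    by_cases hi : i = i₀
    · exact ⟨j₀, hi ▸ h₀.le⟩
    · by_contra hcon
      push Not at hcon
      have h1 : ∑ β, a i β < 3 / 4 * K := by
        simp only [Fin.sum_univ_three]
        linarith [hcon 0, hcon 1, hcon 2]
      have h2 : K / 4 ≤ ∑ β, a i₀ β :=
        h₀.le.trans (Finset.single_le_sum (fun j _ => ha i₀ j) (Finset.mem_univ j₀))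
      have h3 : K / 4 * (K / 4) ≤ (∑ β, a i₀ β) * (K - ∑ β, a i β) :=
        mul_le_mul h2 (by linarith) (by positivity) (hR0 _)
      nlinarith [hpairR i₀ i (Ne.symm hi)]
  choose τ hτ using hentry
  have hinj : Function.Injective τ := by
    intro i j hij
    by_contra hne
    have h1 : K / 4 * (K / 4) ≤ a i (τ i) * a j (τ i) :=
      mul_le_mul (hτ i) (hij ▸ hτ j) (by positivity) (ha _ _)
    nlinarith [hpairC i j (τ i) hne]
  refine ⟨Equiv.ofBijective τ (Finite.injective_iff_bijective.1 hinj), hτ, ?_⟩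
  simp only [Equiv.ofBijective_apply]
  have hRτ : ∀ i, K / 4 ≤ ∑ β, a i β := fun i =>
    (hτ i).trans (Finset.single_le_sum (fun j _ => ha i j) (Finset.mem_univ _))
  have h1 : ∑ i, ∑ j, (if i ≠ j then K / 4 * (K - ∑ β, a j β) else 0) ≤
      ∑ i, ∑ j, if i ≠ j then (∑ β, a i β) * (K - ∑ β, a j β) else 0 :=
    Finset.sum_le_sum fun i _ => Finset.sum_le_sum fun j _ => by
      split_ifs
      exacts [mul_le_mul_of_nonneg_right (hRτ i) (hRK j), le_rfl]
  have h2 : K / 2 * (∑ i, ∑ j, a i j - ∑ i, a i (τ i)) ≤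
      ∑ β, ∑ i, ∑ j, if i ≠ j then a i β * a j β else 0 := by
    have hcolumn : ∀ i, K / 2 * ∑ j, (if i ≠ j then a j (τ i) else 0) ≤
        ∑ i', ∑ j, if i' ≠ j then a i' (τ i) * a j (τ i) else 0 := by
      intro i
      have e : ∀ j, K / 4 * a j (τ i) ≤ a i (τ i) * a j (τ i) := fun j =>
        mul_le_mul_of_nonneg_right (hτ i) (ha _ _)
      have e' := e 0
      have e'' := e 1
      have e''' := e 2
      fin_cases i <;> simp [Fin.sum_univ_three] at e' e'' e''' ⊢ <;>
        nlinarith [hB 0 1 (τ 0), hB 0 2 (τ 0), hB 1 2 (τ 0), hB 0 1 (τ 1), hB 0 2 (τ 1),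
          hB 1 2 (τ 1), hB 0 1 (τ 2), hB 0 2 (τ 2), hB 1 2 (τ 2)]
    have hre : ∀ f : Fin 3 → ℝ, ∑ i, f (τ i) = ∑ β, f β := fun f =>
      (Equiv.ofBijective τ (Finite.injective_iff_bijective.1 hinj)).sum_comp f
    rw [← hre (fun β => ∑ i, ∑ j, if i ≠ j then a i β * a j β else 0)]
    refine le_trans (le_of_eq ?_) (Finset.sum_le_sum fun i _ => hcolumn i)
    rw [← Finset.mul_sum, Finset.sum_comm (f := fun i j => a i j),
      ← hre (fun β => ∑ i, a i β), ← Finset.sum_sub_distrib]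
    congr 1
    refine Finset.sum_congr rfl fun i _ => ?_
    have : ∀ j, (if i ≠ j then a j (τ i) else 0) = a j (τ i) - if i = j then a j (τ i) else 0 := by
      intro j
      by_cases h : i = j <;> simp [h]
    simp [this]
  have h3 : ∑ i, ∑ j, (if i ≠ j then K / 4 * (K - ∑ β, a j β) else 0) =
      K / 2 * (3 * K - ∑ i, ∑ j, a i j) := by
    simp [Fin.sum_univ_three]
    ring
  rw [h3] at h1
  linarith

end OverlapInequality

/-! ### Counting balanced labellings -/

section BalancedLabellings

variable {V : Type*} [Fintype V] [DecidableEq V]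

/-- The labellings all of whose classes have exactly `k` elements. -/
def balancedLabellings (V : Type*) [Fintype V] [DecidableEq V] (k : ℕ) :
    Finset (V → Option (Fin 3)) :=
  Finset.univ.filter fun φ => ∀ i, (labelClass φ i).card = k

@[simp] lemma mem_balancedLabellings {k : ℕ} {φ : V → Option (Fin 3)} :
    φ ∈ balancedLabellings V k ↔ ∀ i, (labelClass φ i).card = k := by
  simp [balancedLabellings]

lemma pow_le_card_balancedLabellings (k : ℕ) :
    (Fintype.card V - 3 * k) ^ (3 * k) ≤ (balancedLabellings V k).card * k.factorial ^ 3 := by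
  set n := Fintype.card V
  let T : Finset (Σ _ : Finset V, Σ _ : Finset V, Finset V) :=
    (Finset.univ.powersetCard k).sigma fun A =>
      (Aᶜ.powersetCard k).sigma fun B => (A ∪ B)ᶜ.powersetCard k
  have hT : T.card = n.choose k * ((n - k).choose k * (n - 2 * k).choose k) := by
    rw [Finset.card_sigma, Finset.sum_const_nat (m := (n - k).choose k * (n - 2 * k).choose k),
      Finset.card_powersetCard, Finset.card_univ]
    intro A hA
    rw [Finset.card_sigma, Finset.sum_const_nat (m := (n - 2 * k).choose k),
      Finset.card_powersetCard, Finset.card_compl, (Finset.mem_powersetCard.1 hA).2]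
    intro B hB
    obtain ⟨hBA, hBk⟩ := Finset.mem_powersetCard.1 hB
    rw [Finset.card_powersetCard, Finset.card_compl, Finset.card_union_of_disjoint
      (Finset.disjoint_left.2 fun v hv hv' => Finset.mem_compl.1 (hBA hv') hv), hBk,
      (Finset.mem_powersetCard.1 hA).2, two_mul]
  have hTle : T.card ≤ (balancedLabellings V k).card := by
    have hmem : ∀ t ∈ T, t.1.card = k ∧ t.2.1.card = k ∧ t.2.2.card = k ∧
        (∀ v ∈ t.2.1, v ∉ t.1) ∧ (∀ v ∈ t.2.2, v ∉ t.1 ∧ v ∉ t.2.1) := by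
      rintro ⟨A, B, C⟩ h
      simp only [T, Finset.mem_sigma, Finset.mem_powersetCard] at h
      refine ⟨h.1.2, h.2.1.2, h.2.2.2, fun v hv => Finset.mem_compl.1 (h.2.1.1 hv),
        fun v hv => ?_⟩
      simpa using h.2.2.1 hv
    let f : (Σ _ : Finset V, Σ _ : Finset V, Finset V) → V → Option (Fin 3) := fun t v =>
      if v ∈ t.1 then some 0 else if v ∈ t.2.1 then some 1 else if v ∈ t.2.2 then some 2 else none
    have hcls : ∀ t ∈ T, labelClass (f t) 0 = t.1 ∧ labelClass (f t) 1 = t.2.1 ∧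
        labelClass (f t) 2 = t.2.2 := by
      intro t ht
      obtain ⟨-, -, -, h1, h2⟩ := hmem t ht
      refine ⟨?_, ?_, ?_⟩ <;> ext v <;> simp only [mem_labelClass, f] <;>
        have h1' := h1 v <;> have h2' := h2 v <;>
        by_cases v ∈ t.1 <;> by_cases v ∈ t.2.1 <;> by_cases v ∈ t.2.2 <;> simp_all
    refine Finset.card_le_card_of_injOn f (fun t ht => ?_) (fun t ht t' ht' h => ?_)
    · obtain ⟨h0, h1, h2⟩ := hcls t ht
      obtain ⟨c0, c1, c2, -⟩ := hmem t ht
      refine mem_balancedLabellings.2 fun i => ?_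
      fin_cases i <;> simp [h0, h1, h2, c0, c1, c2]
    · obtain ⟨h0, h1, h2⟩ := hcls t ht
      obtain ⟨h0', h1', h2'⟩ := hcls t' ht'
      rw [h] at h0 h1 h2
      obtain ⟨A, B, C⟩ := t
      obtain ⟨A', B', C'⟩ := t'
      simp_all
  have hch : ∀ m, n - 2 * k ≤ m → (n - 3 * k) ^ k ≤ m.choose k * k.factorial := by
    intro m hm
    rw [mul_comm (m.choose k), ← Nat.descFactorial_eq_factorial_mul_choose]
    exact (Nat.pow_le_pow_left (by omega) k).trans (Nat.pow_sub_le_descFactorial m k)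
  calc (n - 3 * k) ^ (3 * k) = (n - 3 * k) ^ k * ((n - 3 * k) ^ k * (n - 3 * k) ^ k) := by ring
    _ ≤ (n.choose k * k.factorial) * (((n - k).choose k * k.factorial) *
        ((n - 2 * k).choose k * k.factorial)) :=
      Nat.mul_le_mul (hch _ (by omega)) (Nat.mul_le_mul (hch _ (by omega)) (hch _ le_rfl))
    _ = T.card * k.factorial ^ 3 := by rw [hT]; ring
    _ ≤ _ := Nat.mul_le_mul_right _ hTle

/-- The number of vertices of `W` with label `j`. -/
def labelCount (W : Finset V) (ψ : V → Option (Fin 3)) (j : Fin 3) : ℕ :=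
  (W.filter fun w => ψ w = some j).card

/-- The number of balanced labellings with prescribed values on `W`. -/
lemma card_balancedLabellings_restrict_le (k : ℕ) (W : Finset V) (ψ₀ : V → Option (Fin 3)) :
    ((balancedLabellings V k).filter fun ψ => ∀ w ∈ W, ψ w = ψ₀ w).card ≤
      ∏ j, (Fintype.card V).choose (k - labelCount W ψ₀ j) := by
  have : ∏ j, (Fintype.card V).choose (k - labelCount W ψ₀ j) =
      (Fintype.piFinset fun j =>
        (Finset.univ : Finset V).powersetCard (k - labelCount W ψ₀ j)).card := by
    simp [Fintype.card_piFinset, Finset.card_powersetCard]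
  rw [this]
  refine Finset.card_le_card_of_injOn (fun ψ j => labelClass ψ j \ W) (fun ψ hψ => ?_)
    (fun ψ hψ ψ' hψ' h => ?_)
  · obtain ⟨hb, hW⟩ := Finset.mem_filter.1 hψ
    refine Fintype.mem_piFinset.2 fun j => Finset.mem_powersetCard.2 ⟨Finset.subset_univ _, ?_⟩
    rw [Finset.card_sdiff, mem_balancedLabellings.1 hb j, labelCount]
    congr 2
    ext w
    simp only [Finset.mem_inter, mem_labelClass, Finset.mem_filter]
    exact and_congr_right fun hw => by rw [hW w hw]
  · obtain ⟨-, hW⟩ := Finset.mem_filter.1 hψ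
    obtain ⟨-, hW'⟩ := Finset.mem_filter.1 hψ'
    ext1 v
    by_cases hv : v ∈ W
    · rw [hW v hv, hW' v hv]
    · refine Option.ext fun j => ?_
      have h1 : v ∈ labelClass ψ j \ W ↔ v ∈ labelClass ψ' j \ W := by
        have := congrFun h j
        simp only at this
        rw [this]
      simpa [hv] using h1

/-- Averaging a product weight over the balanced labellings. -/
lemma sum_balancedLabellings_le {k : ℕ} (hV : 0 < Fintype.card V) (W : Finset V)
    (u : V → Option (Fin 3) → ℝ) (hu : ∀ w b, 0 ≤ u w b) :
    ∑ ψ ∈ balancedLabellings V k,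
      (∏ j, ((k - labelCount W ψ j).factorial / (Fintype.card V : ℝ) ^ (k - labelCount W ψ j))) *
        ∏ w ∈ W, u w (ψ w) ≤ ∏ w ∈ W, ∑ b, u w b := by
  set n := Fintype.card V
  have hn : (0 : ℝ) < n := by exact_mod_cast hV
  set P : Finset (V → Option (Fin 3)) :=
    Fintype.piFinset fun w => if w ∈ W then Finset.univ else {none} with hP
  let ρ : (V → Option (Fin 3)) → V → Option (Fin 3) := fun ψ w => if w ∈ W then ψ w else none
  have hρP : ∀ ψ, ρ ψ ∈ P := fun ψ => Fintype.mem_piFinset.2 fun w => by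
    by_cases hw : w ∈ W <;> simp [ρ, hw]
  have hρW : ∀ ψ, ∀ w ∈ W, ρ ψ w = ψ w := fun ψ w hw => by simp [ρ, hw]
  have hcount : ∀ {ψ ψ' : V → Option (Fin 3)}, (∀ w ∈ W, ψ w = ψ' w) →
      ∀ j, labelCount W ψ j = labelCount W ψ' j := by
    intro ψ ψ' h j
    unfold labelCount
    congr 1
    exact Finset.filter_congr fun w hw => by rw [h w hw]
  have hright : ∏ w ∈ W, ∑ b, u w b = ∑ ψ₀ ∈ P, ∏ w ∈ W, u w (ψ₀ w) := by
    have h1 := Finset.prod_univ_sum (fun w => if w ∈ W then (Finset.univ : Finset (Option (Fin 3)))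
      else {none}) (fun w b => if w ∈ W then u w b else 1)
    have h2 : ∀ g : V → ℝ, ∏ w, (if w ∈ W then g w else 1) = ∏ w ∈ W, g w := fun g => by
      simp
    simp only [h2] at h1
    rw [hP, ← h1, ← h2]
    refine Finset.prod_congr rfl fun w _ => ?_
    by_cases hw : w ∈ W <;> simp [hw]
  rw [hright, ← Finset.sum_fiberwise_of_maps_to (fun ψ _ => hρP ψ)]
  refine Finset.sum_le_sum fun ψ₀ hψ₀ => ?_
  have hprod : 0 ≤ ∏ w ∈ W, u w (ψ₀ w) := Finset.prod_nonneg fun w _ => hu _ _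
  set c : ℝ := ∏ j, ((k - labelCount W ψ₀ j).factorial / (n : ℝ) ^ (k - labelCount W ψ₀ j))
  have hc : 0 ≤ c := Finset.prod_nonneg fun j _ => by positivity
  have hfib : ∀ ψ, ρ ψ = ψ₀ → ∀ w ∈ W, ψ w = ψ₀ w := fun ψ h w hw => by
    rw [← h, hρW ψ w hw]
  have hterm : ∀ ψ ∈ (balancedLabellings V k).filter (fun ψ => ρ ψ = ψ₀),
      (∏ j, ((k - labelCount W ψ j).factorial / (n : ℝ) ^ (k - labelCount W ψ j))) *
        ∏ w ∈ W, u w (ψ w) = c * ∏ w ∈ W, u w (ψ₀ w) := by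
    intro ψ hψ
    have h := hfib ψ (Finset.mem_filter.1 hψ).2
    congr 1
    · exact Finset.prod_congr rfl fun j _ => by rw [hcount h j]
    · exact Finset.prod_congr rfl fun w hw => by rw [h w hw]
  rw [Finset.sum_congr rfl hterm, Finset.sum_const, nsmul_eq_mul, ← mul_assoc]
  refine mul_le_of_le_one_left hprod ?_
  have hcard : (((balancedLabellings V k).filter fun ψ => ρ ψ = ψ₀).card : ℝ) ≤
      ∏ j, ((n.choose (k - labelCount W ψ₀ j) : ℕ) : ℝ) := by
    rw [← Nat.cast_prod]
    exact_mod_cast (Finset.card_le_card fun ψ hψ => by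
      obtain ⟨h1, h2⟩ := Finset.mem_filter.1 hψ
      exact Finset.mem_filter.2 ⟨h1, hfib ψ h2⟩).trans
      (card_balancedLabellings_restrict_le k W ψ₀)
  refine (mul_le_mul_of_nonneg_right hcard hc).trans ?_
  rw [← Finset.prod_mul_distrib]
  refine Finset.prod_le_one (fun j _ => by positivity) fun j _ => ?_
  have := Nat.choose_le_pow_div (α := ℝ) (k - labelCount W ψ₀ j) n
  calc _ ≤ (n : ℝ) ^ (k - labelCount W ψ₀ j) / (k - labelCount W ψ₀ j).factorial *
        ((k - labelCount W ψ₀ j).factorial / (n : ℝ) ^ (k - labelCount W ψ₀ j)) := by gcongr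
    _ = 1 := by field_simp

end BalancedLabellings

/-! ### The range of parameters -/

section Parameters

/-- The assumptions on `k` and `n`, where `1 - p = r ^ 32`, under which the second moment estimates
hold. -/
structure SecondMomentRange (r : ℝ) (k n : ℕ) : Prop where
  pos : 0 < r
  lt_one : r < 1
  one_le : 1 ≤ k
  pow_mul_le : (k : ℝ) ^ 5 * r ^ k ≤ 1 / 1000
  exp_mul_le : 64 * Real.exp 9 * r ^ k ≤ 1
  le : n * (r ^ 32) ^ k ≤ k
  ge : k - (r ^ 32) ^ k ≤ n * (r ^ 32) ^ k

lemma eventually_secondMomentRange {p r : ℝ} (hp : p ∈ Set.Ioo (0 : ℝ) 1) (hr : 0 < r)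
    (hpr : 1 - p = r ^ 32) : ∀ᶠ k in atTop, SecondMomentRange r k (nseq2 p k) := by
  have hr1 : r < 1 := by
    by_contra! h
    have := one_le_pow₀ (n := 32) h
    linarith [hp.1]
  have h1 := (tendsto_pow_const_mul_const_pow_of_abs_lt_one 5
    (by rwa [abs_of_pos hr] : |r| < 1)).eventually_le_const (show (0 : ℝ) < 1 / 1000 by norm_num)
  have h2 := ((tendsto_pow_atTop_nhds_zero_of_lt_one hr.le hr1).const_mul
    (64 * Real.exp 9)).eventually_le_const (show 64 * Real.exp 9 * 0 < 1 by norm_num)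
  filter_upwards [h1, h2, eventually_ge_atTop 1] with k h1 h2 hk
  have hβ : 0 < (r ^ 32) ^ k := by positivity
  have e : (1 / (1 - p)) ^ k * (k : ℝ) * (r ^ 32) ^ k = k := by
    rw [hpr, mul_right_comm, ← mul_pow, one_div_mul_cancel (by positivity), one_pow, one_mul]
  refine ⟨hr, hr1, hk, h1, h2, ?_, ?_⟩
  · have := Nat.floor_le (show 0 ≤ (1 / (1 - p)) ^ k * (k : ℝ) by rw [hpr]; positivity)
    calc _ ≤ (1 / (1 - p)) ^ k * (k : ℝ) * (r ^ 32) ^ k := by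
          rw [nseq2]
          gcongr
      _ = k := e
  · have := (Nat.lt_floor_add_one ((1 / (1 - p)) ^ k * (k : ℝ))).le
    have h3 := mul_le_mul_of_nonneg_right this hβ.le
    rw [e] at h3
    rw [nseq2]
    linarith

lemma factorial_le_exp_mul {k : ℕ} (hk : 1 ≤ k) :
    (k.factorial : ℝ) ≤ Real.exp 1 * k ^ (k + 1) * Real.exp (-k) := by
  induction k, hk using Nat.le_induction with
  | base => simp [← Real.exp_add]
  | succ k hk ih =>
    have hk0 : (0 : ℝ) < k := by exact_mod_cast hk
    have h1 : (k : ℝ) ≤ (k + 1) * Real.exp (-1 / (k + 1)) := by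
      have := mul_le_mul_of_nonneg_left (Real.add_one_le_exp (-1 / ((k : ℝ) + 1)))
        (show (0 : ℝ) ≤ k + 1 by positivity)
      refine le_trans (le_of_eq ?_) this
      field_simp
      ring
    have h2 : (k : ℝ) ^ (k + 1) ≤ (k + 1) ^ (k + 1) * Real.exp (-1) := by
      refine (pow_le_pow_left₀ hk0.le h1 (k + 1)).trans (le_of_eq ?_)
      rw [mul_pow, ← Real.exp_nat_mul]
      congr 2
      push_cast
      field_simp
    rw [Nat.factorial_succ]
    push_cast
    calc ((k : ℝ) + 1) * k.factorial
        ≤ (k + 1) * (Real.exp 1 * ((k + 1) ^ (k + 1) * Real.exp (-1)) * Real.exp (-k)) := by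
          refine mul_le_mul_of_nonneg_left (ih.trans ?_) (by positivity)
          gcongr
      _ = Real.exp 1 * (k + 1) ^ (k + 1 + 1) * Real.exp (-(k + 1)) := by
          rw [neg_add, Real.exp_add]
          ring

namespace SecondMomentRange

variable {r : ℝ} {k n : ℕ}

lemma one_le_cast (h : SecondMomentRange r k n) : (1 : ℝ) ≤ k := by exact_mod_cast h.one_le

lemma pow_pos (h : SecondMomentRange r k n) : 0 < r ^ k := _root_.pow_pos h.pos k

lemma pow_mul_le' (h : SecondMomentRange r k n) {m : ℕ} (hm : m ≤ 5) :
    (k : ℝ) ^ m * r ^ k ≤ 1 / 1000 :=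
  (mul_le_mul_of_nonneg_right (pow_le_pow_right₀ h.one_le_cast hm) h.pow_pos.le).trans h.pow_mul_le

lemma beta_le (h : SecondMomentRange r k n) : (r ^ 32) ^ k ≤ r ^ k := by
  rw [← pow_mul]
  exact pow_le_pow_of_le_one h.pos.le h.lt_one.le (by omega)

lemma beta_pos (h : SecondMomentRange r k n) : 0 < (r ^ 32) ^ k :=
  _root_.pow_pos (_root_.pow_pos h.pos _) _

lemma pow_mul_beta_le (h : SecondMomentRange r k n) {m : ℕ} (hm : m ≤ 5) :
    (k : ℝ) ^ m * (r ^ 32) ^ k ≤ 1 / 1000 :=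
  (mul_le_mul_of_nonneg_left h.beta_le (by positivity)).trans (h.pow_mul_le' hm)

lemma sq_le (h : SecondMomentRange r k n) : 18 * (k : ℝ) ^ 2 ≤ n := by
  refine le_of_mul_le_mul_right ?_ h.beta_pos
  have h0 := h.pow_mul_beta_le (show 0 ≤ 5 by norm_num)
  have h2 := h.pow_mul_beta_le (show 2 ≤ 5 by norm_num)
  rw [pow_zero, one_mul] at h0
  linarith [h.ge, h.one_le_cast]

lemma n_pos (h : SecondMomentRange r k n) : (0 : ℝ) < n := by
  have := h.sq_le
  have := h.one_le_cast
  nlinarith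

lemma pow_le_two_mul (h : SecondMomentRange r k n) :
    (n : ℝ) ^ (3 * k) ≤ 2 * ((n - 3 * k : ℕ) : ℝ) ^ (3 * k) := by
  have hn := h.n_pos
  have hk := h.one_le_cast
  have hle : 3 * k ≤ n := by
    have : (3 : ℝ) * k ≤ n := by nlinarith [h.sq_le]
    exact_mod_cast this
  have h1 : 1 / 2 ≤ (1 + -(3 * k / n : ℝ)) ^ (3 * k) := by
    refine le_trans ?_ (one_add_mul_le_pow ?_ (3 * k))
    · have : (3 * k : ℝ) * (3 * k / n) ≤ 1 / 2 := by
        rw [mul_div_assoc', div_le_iff₀ hn]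
        nlinarith [h.sq_le]
      push_cast
      linarith
    · have : (3 * k / n : ℝ) ≤ 1 := (div_le_one hn).2 (by exact_mod_cast hle)
      linarith
  have h2 : ((n - 3 * k : ℕ) : ℝ) = n * (1 + -(3 * k / n : ℝ)) := by
    rw [Nat.cast_sub hle]
    push_cast
    field_simp
    ring
  rw [h2, mul_pow]
  nlinarith [_root_.pow_pos hn (3 * k)]

lemma pow_le_two_mul_pow (h : SecondMomentRange r k n) {s : ℕ} (hs : s ≤ 3 * k) :
    (k : ℝ) ^ s ≤ 2 * (n * (r ^ 32) ^ k) ^ s := by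
  have hk := h.one_le_cast
  have hβ := h.beta_pos
  have h0 := h.pow_mul_beta_le (show 0 ≤ 5 by norm_num)
  have h1 := h.pow_mul_beta_le (show 1 ≤ 5 by norm_num)
  simp only [pow_zero, one_mul, pow_one] at h0 h1
  have hs' : (s : ℝ) ≤ 3 * k := by exact_mod_cast hs
  have h2 : 1 / 2 ≤ (1 + -(r ^ 32) ^ k) ^ s := by
    refine le_trans ?_ (one_add_mul_le_pow (by linarith) s)
    nlinarith
  have h3 : (k : ℝ) * (1 + -(r ^ 32) ^ k) ≤ n * (r ^ 32) ^ k := by nlinarith [h.ge]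
  have h4 := pow_le_pow_left₀ (mul_nonneg (by positivity) (by linarith)) h3 s
  rw [mul_pow] at h4
  have : (0 : ℝ) < k ^ s := by positivity
  nlinarith

lemma exp_neg_le_pow (h : SecondMomentRange r k n) :
    Real.exp (-1) * Real.exp (-3 * k) ≤ (1 - 3 * (r ^ 32) ^ k) ^ n := by
  set β := (r ^ 32) ^ k with hβdef
  have hk := h.one_le_cast
  have hβ : 0 < β := h.beta_pos
  have h0 := h.pow_mul_beta_le (show 0 ≤ 5 by norm_num)
  have h1 := h.pow_mul_beta_le (show 1 ≤ 5 by norm_num)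
  simp only [pow_zero, one_mul, pow_one, ← hβdef] at h0 h1
  have hpos : 0 < 1 - 3 * β := by linarith
  have h2 : Real.exp (-(3 * β / (1 - 3 * β))) ≤ 1 - 3 * β := by
    rw [Real.exp_neg, inv_le_comm₀ (Real.exp_pos _) hpos]
    refine le_trans (le_of_eq ?_) (Real.add_one_le_exp _)
    field_simp
    ring
  refine le_trans ?_ (pow_le_pow_left₀ (Real.exp_pos _).le h2 n)
  rw [← Real.exp_add, ← Real.exp_nat_mul, Real.exp_le_exp]
  have h3 : n * (3 * β / (1 - 3 * β)) ≤ 3 * k + 1 := by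
    rw [mul_div_assoc', div_le_iff₀ hpos]
    nlinarith [h.le]
  linarith

lemma one_add_pow_le_exp {r : ℝ} {k n : ℕ} (h : SecondMomentRange r k n) {m : ℕ} (hm : m ≤ 4) :
    (1 + 3 * ((k : ℝ) ^ m * r ^ k)) ^ (3 * k) ≤ Real.exp 1 := by
  have hη := h.pow_pos
  have h1 := h.pow_mul_le' (show m + 1 ≤ 5 by omega)
  have h2 := Real.add_one_le_exp (3 * ((k : ℝ) ^ m * r ^ k))
  rw [add_comm] at h2
  refine (pow_le_pow_left₀ (by positivity) h2 _).trans ?_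
  rw [← Real.exp_nat_mul, Real.exp_le_exp]
  push_cast
  rw [pow_succ] at h1
  linarith

end SecondMomentRange

end Parameters

/-! ### Pairs of balanced labellings -/

section LabellingPairs

variable {V : Type*} [Fintype V] [DecidableEq V]

lemma sum_overlap_le (φ ψ : V → Option (Fin 3)) (i : Fin 3) :
    ∑ j, overlap φ ψ i j ≤ (labelClass φ i).card := by
  have h : ((Finset.univ : Finset (Fin 3)) : Set (Fin 3)).PairwiseDisjoint
      fun j => labelClass φ i ∩ labelClass ψ j := by
    intro j _ j' _ hj
    refine Finset.disjoint_left.2 fun v hv hv' => hj ?_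
    simp only [Finset.mem_inter, mem_labelClass] at hv hv'
    exact Option.some_injective _ (hv.2.symm.trans hv'.2)
  simp only [overlap]
  rw [← Finset.card_biUnion fun j hj j' hj' => h hj hj']
  exact Finset.card_le_card (Finset.biUnion_subset.2 fun j _ => Finset.inter_subset_left)

lemma card_labelSupport (φ : V → Option (Fin 3)) :
    (labelSupport φ).card = ∑ i, (labelClass φ i).card := by
  have h : labelSupport φ = Finset.univ.biUnion fun i => labelClass φ i := by
    ext v
    simp [Option.ne_none_iff_exists']
  rw [h, Finset.card_biUnion]
  intro i _ j _ hij
  refine Finset.disjoint_left.2 fun v hv hv' => hij ?_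
  simp only [mem_labelClass] at hv hv'
  exact Option.some_injective _ (hv.symm.trans hv')

lemma card_filter_labelSupport (φ : V → Option (Fin 3)) (P : V → Prop) [DecidablePred P] :
    ((labelSupport φ).filter P).card = ∑ i, ((labelClass φ i).filter P).card := by
  have h : (labelSupport φ).filter P = Finset.univ.biUnion fun i => (labelClass φ i).filter P := by
    ext v
    simp [Option.ne_none_iff_exists']
  rw [h, Finset.card_biUnion]
  intro i _ j _ hij
  refine Finset.disjoint_left.2 fun v hv hv' => hij ?_
  simp only [Finset.mem_filter, mem_labelClass] at hv hv'
  exact Option.some_injective _ (hv.1.symm.trans hv'.1)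

lemma labelCount_labelSupport (φ ψ : V → Option (Fin 3)) (j : Fin 3) :
    labelCount (labelSupport φ) ψ j = ∑ i, overlap φ ψ i j := by
  rw [labelCount, card_filter_labelSupport]
  refine Finset.sum_congr rfl fun i _ => congrArg _ ?_
  ext v
  simp

/-- The three possible kinds of pairs of balanced labellings. -/
lemma exists_overlap_defect {k : ℕ} (hk : 1 ≤ k) {φ ψ : V → Option (Fin 3)}
    (hφ : ∀ i, (labelClass φ i).card = k) (hψ : ∀ i, (labelClass ψ i).card = k) :
    ∃ D : ℕ, (crossGraph φ ⊔ crossGraph ψ).edgeFinset.card + k * ∑ i, ∑ j, overlap φ ψ i j =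
        6 * k ^ 2 + D ∧
      (((∀ i j, 4 * overlap φ ψ i j ≤ k) ∧ k * (∑ i, ∑ j, overlap φ ψ i j) ≤ 2 * D) ∨
        k ^ 2 ≤ 32 * D ∨
        ∃ σ : Equiv.Perm (Fin 3), (∀ i, k ≤ 4 * overlap φ ψ i (σ i)) ∧
          k * (3 * k) ≤ 4 * D + k * ∑ i, overlap φ ψ i (σ i)) := by
  set a : Fin 3 → Fin 3 → ℕ := overlap φ ψ
  have hrow : ∀ i, ∑ j, a i j ≤ k := fun i => (sum_overlap_le φ ψ i).trans (hφ i).le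
  have hsup := card_edgeFinset_sup_add_inf hφ hψ
  have hinf := two_mul_card_edgeFinset_inf φ ψ
  set c := (crossGraph φ ⊓ crossGraph ψ).edgeFinset.card
  set S := ∑ i, ∑ j, a i j with hS
  have hrowR : ∀ i, ∑ j, (a i j : ℝ) ≤ k := fun i => by exact_mod_cast hrow i
  have hinfR : 2 * (c : ℝ) = ∑ i, ∑ j, (a i j : ℝ) *
      ∑ i', ∑ j', (a i' j' : ℝ) * if i ≠ i' ∧ j ≠ j' then 1 else 0 := by
    have := congrArg (Nat.cast (R := ℝ)) hinf
    push_cast at this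
    exact this
  have hSR : (S : ℝ) = ∑ i, ∑ j, (a i j : ℝ) := by rw [hS]; push_cast; rfl
  have hk0 : (0 : ℝ) < k := by exact_mod_cast hk
  have htri := overlap_trichotomy (K := k) (a := fun i j => (a i j : ℝ)) (D := k * S - c) hk0
    (fun i j => Nat.cast_nonneg _) hrowR (by rw [← hSR]; linarith)
  rw [← hSR] at htri
  have hcS : c ≤ k * S := by
    have : (0 : ℝ) ≤ k * S - c := by
      rcases htri with h | h | ⟨σ, -, h⟩
      · exact le_trans (by positivity) h.2
      · exact le_trans (by positivity) h
      · refine le_trans (mul_nonneg (by positivity) (sub_nonneg.2 ?_)) h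
        calc ∑ i, (a i (σ i) : ℝ) ≤ ∑ _i : Fin 3, (k : ℝ) := Finset.sum_le_sum fun i _ =>
              (Finset.single_le_sum (f := fun j => (a i j : ℝ)) (fun j _ => Nat.cast_nonneg _)
                (Finset.mem_univ _)).trans (hrowR i)
          _ = 3 * k := by simp
    exact_mod_cast sub_nonneg.1 this
  have hDcast : ((k * S - c : ℕ) : ℝ) = k * S - c := by
    rw [Nat.cast_sub hcS]
    push_cast
    rfl
  refine ⟨k * S - c, by omega, ?_⟩
  rw [← hDcast] at htri
  rcases htri with ⟨h1, h2⟩ | h | ⟨σ, h1, h2⟩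
  · refine Or.inl ⟨fun i j => ?_, ?_⟩
    · have : (4 : ℝ) * a i j ≤ k := by linarith [h1 i j]
      exact_mod_cast this
    · have : (k : ℝ) * S ≤ 2 * (k * S - c : ℕ) := by linarith
      exact_mod_cast this
  · refine Or.inr (Or.inl ?_)
    have : (k : ℝ) ^ 2 ≤ 32 * (k * S - c : ℕ) := by linarith
    exact_mod_cast this
  · refine Or.inr (Or.inr ⟨σ, fun i => ?_, ?_⟩)
    · have : (k : ℝ) ≤ 4 * a i (σ i) := by linarith [h1 i]
      exact_mod_cast this
    · have : (k : ℝ) * (3 * k) ≤ 4 * (k * S - c : ℕ) + k * ∑ i, (a i (σ i) : ℝ) := by linarith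
      exact_mod_cast this

/-- If the classes of `ψ` are those of `φ` permuted, then the designated vertices of a common
special tuple agree up to this permutation. -/
lemma eq_comp_symm_of_specialEvent_inter {φ ψ : V → Option (Fin 3)} {σ : Equiv.Perm (Fin 3)}
    (hσ : ∀ i, overlap φ ψ i (σ i) = (labelClass φ i).card) {x y : Fin 3 → V}
    (hx : ∀ i, φ (x i) = some i) (hxy : (specialEvent φ x ∩ specialEvent ψ y).Nonempty) :
    y = x ∘ σ.symm := by
  obtain ⟨ω, h1, h2⟩ := hxy
  have hψx : ∀ i, ψ (x i) = some (σ i) := by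
    intro i
    have h := Finset.eq_of_subset_of_card_le
      (Finset.inter_subset_left (s₁ := labelClass φ i) (s₂ := labelClass ψ (σ i))) (hσ i).ge
    have : x i ∈ labelClass φ i ∩ labelClass ψ (σ i) := by
      rw [h]
      simpa using hx i
    simpa using (Finset.mem_inter.1 this).2
  have hcomp : ∀ i, x i = y (σ i) := by
    intro i
    obtain ⟨j, hj⟩ := exists_ne i
    have ht : ω s(x i, x j) = true := (h1.1 i j hj.symm _ _ (hx i) (hx j)).2 ⟨rfl, rfl⟩
    exact ((h2.1 (σ i) (σ j) (fun h => hj (σ.injective h).symm) _ _ (hψx i) (hψx j)).1 ht).1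
  ext1 j
  simp [hcomp]

lemma card_filter_ne_none_labelSupport (φ ψ : V → Option (Fin 3)) :
    ((labelSupport φ).filter fun w => ψ w ≠ none).card = ∑ i, ∑ j, overlap φ ψ i j := by
  have := sum_eq_sum_overlap φ ψ (fun a b => if a ≠ none ∧ b ≠ none then 1 else 0)
    (by simp) (by simp)
  rw [← Finset.sum_filter, Finset.sum_const, smul_eq_mul, mul_one] at this
  simp only [ne_eq, reduceCtorEq, not_false_eq_true, and_self, if_true, mul_one] at this
  rw [← this]
  congr 1
  ext v
  simp

lemma card_filter_eq_map_labelSupport (φ ψ : V → Option (Fin 3)) (σ : Equiv.Perm (Fin 3)) :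
    ((labelSupport φ).filter fun w => ψ w = (φ w).map σ).card = ∑ i, overlap φ ψ i (σ i) := by
  rw [card_filter_labelSupport]
  refine Finset.sum_congr rfl fun i _ => congrArg _ ?_
  ext v
  simp only [Finset.mem_filter, Finset.mem_inter, mem_labelClass]
  refine and_congr_right fun h => ?_
  rw [h]
  simp

lemma prod_ite_none_labelSupport (φ ψ : V → Option (Fin 3)) (c : ℝ) :
    ∏ w ∈ labelSupport φ, (if ψ w = none then 1 else c) = c ^ ∑ i, ∑ j, overlap φ ψ i j := by
  rw [← card_filter_ne_none_labelSupport, Finset.prod_ite]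
  simp

lemma prod_ite_map_labelSupport {k : ℕ} {φ : V → Option (Fin 3)}
    (hφ : ∀ i, (labelClass φ i).card = k) (ψ : V → Option (Fin 3)) (σ : Equiv.Perm (Fin 3))
    (c : ℝ) :
    ∏ w ∈ labelSupport φ, (if ψ w = (φ w).map σ then 1 else c) =
      c ^ (3 * k - ∑ i, overlap φ ψ i (σ i)) := by
  rw [← card_filter_eq_map_labelSupport, Finset.prod_ite]
  simp only [Finset.prod_const_one, Finset.prod_const, one_mul]
  have h1 := card_labelSupport φ
  have h2 := Finset.card_filter_add_card_filter_not (s := labelSupport φ)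
    (fun w => ψ w = (φ w).map σ)
  simp only [hφ, Finset.sum_const, Finset.card_univ, Fintype.card_fin, smul_eq_mul] at h1
  congr 1
  omega

end LabellingPairs

/-! ### The weight of a pair of labellings -/

section PairWeight

lemma prod_factorial_div_le_pow {k : ℕ} {ρ : Fin 3 → ℕ} (hρ : ∀ j, ρ j ≤ k) :
    ∏ j, ((k.factorial : ℝ) / (k - ρ j).factorial) ≤ (k : ℝ) ^ ∑ j, ρ j := by
  rw [← Finset.prod_pow_eq_pow_sum]
  refine Finset.prod_le_prod (fun j _ => by positivity) fun j _ => ?_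
  rw [div_le_iff₀ (by positivity), ← Nat.factorial_mul_descFactorial (hρ j), mul_comm]
  exact_mod_cast Nat.mul_le_mul_right _ (Nat.descFactorial_le_pow k (ρ j))

lemma prod_factorial_div_le_factorial_pow (k : ℕ) (ρ : Fin 3 → ℕ) :
    ∏ j, ((k.factorial : ℝ) / (k - ρ j).factorial) ≤ (k.factorial : ℝ) ^ 3 := by
  calc _ ≤ ∏ _j : Fin 3, (k.factorial : ℝ) :=
        Finset.prod_le_prod (fun j _ => by positivity) fun j _ =>
          div_le_self (by positivity) (by exact_mod_cast Nat.one_le_of_lt (Nat.factorial_pos _))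
    _ = _ := by simp

variable {r : ℝ} {k n : ℕ} {a : Fin 3 → Fin 3 → ℕ} {D : ℕ}

/-- The sum over the possible kinds of pairs of labellings of the bounds for their weights. -/
noncomputable def overlapBound (r : ℝ) (k : ℕ) (a : Fin 3 → Fin 3 → ℕ) : ℝ :=
  2 * Real.exp 1 * (r ^ k) ^ (∑ i, ∑ j, a i j) + 2 * (Real.exp 9 * r ^ k) ^ k +
    ∑ σ : Equiv.Perm (Fin 3),
      2 * Real.exp 4 * ((k : ℝ) ^ 4 * r ^ k) ^ (3 * k - ∑ i, a i (σ i))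

namespace SecondMomentRange

lemma pow_sub_le (h : SecondMomentRange r k n) {m : ℕ} (hm : 4 * m ≤ 3 * k) :
    (r ^ 32) ^ (k - m) ≤ r ^ k := by
  rw [← pow_mul]
  exact pow_le_pow_of_le_one h.pos.le h.lt_one.le (by omega)

lemma pow_sub_le_one (h : SecondMomentRange r k n) (m : ℕ) : (r ^ 32) ^ m ≤ 1 :=
  pow_le_one₀ (by have := h.pos; positivity) (pow_le_one₀ h.pos.le h.lt_one.le)

/-- The weight of a pair with small overlaps. -/
lemma weight_le_of_overlap_le (h : SecondMomentRange r k n) (hcol : ∀ j, ∑ i, a i j ≤ k)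
    (ha : ∀ i j, 4 * a i j ≤ k) (hD : k * (∑ i, ∑ j, a i j) ≤ 2 * D) :
    (r ^ 32) ^ D * Real.exp (k * ∑ i, ∑ j, (r ^ 32) ^ (k - a i j)) *
        ∏ j, ((k.factorial : ℝ) / (k - ∑ i, a i j).factorial) ≤
      (n * (r ^ 32) ^ k) ^ (∑ i, ∑ j, a i j) *
        (2 * Real.exp 1 * (r ^ k) ^ (∑ i, ∑ j, a i j)) := by
  have hr := h.pos
  set s := ∑ i, ∑ j, a i j with hs
  have hs' : ∑ j, ∑ i, a i j = s := Finset.sum_comm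
  have hs3 : s ≤ 3 * k := by
    rw [← hs']
    exact (Finset.sum_le_sum fun j _ => hcol j).trans (by simp)
  have h1 : (r ^ 32) ^ D ≤ (r ^ k) ^ s := by
    rw [← pow_mul, ← pow_mul]
    exact pow_le_pow_of_le_one hr.le h.lt_one.le (by omega)
  have h2 : Real.exp (k * ∑ i, ∑ j, (r ^ 32) ^ (k - a i j)) ≤ Real.exp 1 := by
    rw [Real.exp_le_exp]
    have : ∑ i, ∑ j, (r ^ 32) ^ (k - a i j) ≤ ∑ _i : Fin 3, ∑ _j : Fin 3, r ^ k :=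
      Finset.sum_le_sum fun i _ => Finset.sum_le_sum fun j _ =>
        h.pow_sub_le (by have := ha i j; omega)
    have h3 := h.pow_mul_le' (show 1 ≤ 5 by norm_num)
    simp only [Finset.sum_const, Finset.card_univ, Fintype.card_fin, nsmul_eq_mul] at this
    rw [pow_one] at h3
    have := mul_le_mul_of_nonneg_left this (Nat.cast_nonneg (α := ℝ) k)
    norm_num at this
    linarith
  have h3 := (prod_factorial_div_le_pow hcol).trans
    (le_of_le_of_eq (h.pow_le_two_mul_pow (hs'.le.trans hs3)) (by rw [hs']))
  calc _ ≤ (r ^ k) ^ s * Real.exp 1 * (2 * (n * (r ^ 32) ^ k) ^ s) := by gcongr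
    _ = _ := by ring

/-- The weight of a pair with a large defect. -/
lemma weight_le_of_le_defect (h : SecondMomentRange r k n) (hcol : ∀ j, ∑ i, a i j ≤ k)
    (hD : k ^ 2 ≤ 32 * D) :
    (r ^ 32) ^ D * Real.exp (k * ∑ i, ∑ j, (r ^ 32) ^ (k - a i j)) *
        ∏ j, ((k.factorial : ℝ) / (k - ∑ i, a i j).factorial) ≤
      (n * (r ^ 32) ^ k) ^ (∑ i, ∑ j, a i j) * (2 * (Real.exp 9 * r ^ k) ^ k) := by
  have hr := h.pos
  set s := ∑ i, ∑ j, a i j with hs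
  have hs' : ∑ j, ∑ i, a i j = s := Finset.sum_comm
  have hs3 : s ≤ 3 * k := by
    rw [← hs']
    exact (Finset.sum_le_sum fun j _ => hcol j).trans (by simp)
  have h1 : (r ^ 32) ^ D ≤ (r ^ k) ^ k := by
    rw [← pow_mul, ← pow_mul]
    exact pow_le_pow_of_le_one hr.le h.lt_one.le (by rwa [← sq])
  have h2 : Real.exp (k * ∑ i, ∑ j, (r ^ 32) ^ (k - a i j)) ≤ Real.exp 9 ^ k := by
    rw [← Real.exp_nat_mul, Real.exp_le_exp]
    refine mul_le_mul_of_nonneg_left ?_ (Nat.cast_nonneg _)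
    calc _ ≤ ∑ _i : Fin 3, ∑ _j : Fin 3, (1 : ℝ) :=
          Finset.sum_le_sum fun i _ => Finset.sum_le_sum fun j _ => h.pow_sub_le_one _
      _ = 9 := by norm_num
  have h3 := (prod_factorial_div_le_pow hcol).trans
    (le_of_le_of_eq (h.pow_le_two_mul_pow (hs'.le.trans hs3)) (by rw [hs']))
  calc _ ≤ (r ^ k) ^ k * Real.exp 9 ^ k * (2 * (n * (r ^ 32) ^ k) ^ s) := by gcongr
    _ = _ := by ring

/-- The weight of a pair which is close to being equal up to a permutation of the labels. -/
lemma weight_le_of_le_overlap (h : SecondMomentRange r k n) (hrow : ∀ i, ∑ j, a i j ≤ k)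
    {σ : Equiv.Perm (Fin 3)} (ha : ∀ i, k ≤ 4 * a i (σ i))
    (hD : k * (3 * k) ≤ 4 * D + k * ∑ i, a i (σ i)) :
    (r ^ 32) ^ D * Real.exp (k * ∑ i, ∑ j, (r ^ 32) ^ (k - a i j)) *
        ∏ j, ((k.factorial : ℝ) / (k - ∑ i, a i j).factorial) ≤
      (k : ℝ) ^ 3 * (n * (r ^ 32) ^ k) ^ (∑ i, ∑ j, a i j) *
        (2 * Real.exp 4 * (k * r ^ k) ^ (3 * k - ∑ i, a i (σ i))) := by
  have hr := h.pos
  set s := ∑ i, ∑ j, a i j with hs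
  set T := 3 * k - ∑ i, a i (σ i) with hT
  have hs3 : s ≤ 3 * k := (Finset.sum_le_sum fun i _ => hrow i).trans (by simp)
  have hdiag : ∑ i, a i (σ i) ≤ s :=
    Finset.sum_le_sum fun i _ =>
      Finset.single_le_sum (f := fun j => a i j) (fun j _ => Nat.zero_le _) (Finset.mem_univ _)
  have h1 : (r ^ 32) ^ D ≤ (r ^ k) ^ T := by
    rw [← pow_mul, ← pow_mul]
    refine pow_le_pow_of_le_one hr.le h.lt_one.le ?_
    rw [hT, Nat.mul_sub]
    omega
  have h2 : Real.exp (k * ∑ i, ∑ j, (r ^ 32) ^ (k - a i j)) ≤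
      Real.exp 1 * Real.exp (3 * k) := by
    rw [← Real.exp_add, Real.exp_le_exp]
    have hi : ∀ i, ∑ j, (r ^ 32) ^ (k - a i j) ≤ 1 + 2 * r ^ k := by
      intro i
      rw [← Finset.add_sum_erase _ _ (Finset.mem_univ (σ i))]
      refine add_le_add (h.pow_sub_le_one _) ?_
      calc _ ≤ ∑ _j ∈ Finset.univ.erase (σ i), r ^ k := Finset.sum_le_sum fun j hj => by
            refine h.pow_sub_le ?_
            have h1 := hrow i
            rw [← Finset.add_sum_erase _ _ (Finset.mem_univ (σ i))] at h1
            have h2 := Finset.single_le_sum (f := fun j => a i j) (fun j _ => Nat.zero_le _) hj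
            have h3 := ha i
            omega
        _ = _ := by simp [Finset.card_erase_of_mem]
    have h3 := h.pow_mul_le' (show 1 ≤ 5 by norm_num)
    rw [pow_one] at h3
    have := mul_le_mul_of_nonneg_left (Finset.sum_le_sum fun i (_ : i ∈ Finset.univ) => hi i)
      (Nat.cast_nonneg (α := ℝ) k)
    simp only [Finset.sum_const, Finset.card_univ, Fintype.card_fin, nsmul_eq_mul] at this
    push_cast at this
    linarith
  have h3 : ∏ j, ((k.factorial : ℝ) / (k - ∑ i, a i j).factorial) ≤
      Real.exp 3 * k ^ 3 * (2 * (n * (r ^ 32) ^ k) ^ s) * k ^ T * Real.exp (-(3 * k)) := by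
    refine (prod_factorial_div_le_factorial_pow k _).trans ?_
    refine (pow_le_pow_left₀ (by positivity) (factorial_le_exp_mul h.one_le) 3).trans ?_
    have e1 : Real.exp 1 ^ 3 = Real.exp 3 := by rw [← Real.exp_nat_mul]; norm_num
    have e2 : Real.exp (-k : ℝ) ^ 3 = Real.exp (-(3 * k)) := by
      rw [← Real.exp_nat_mul]
      congr 1
      push_cast
      ring
    have e3 : ((k : ℝ) ^ (k + 1)) ^ 3 = k ^ 3 * (k ^ s * k ^ (3 * k - s)) := by
      rw [← pow_add, Nat.add_sub_cancel' hs3, ← pow_mul, ← pow_add]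
      congr 1
      ring
    rw [mul_pow, mul_pow, e1, e2, e3]
    have e4 : (k : ℝ) ^ (3 * k - s) ≤ k ^ T := pow_le_pow_right₀ h.one_le_cast (by omega)
    have e5 := h.pow_le_two_mul_pow hs3
    calc _ ≤ Real.exp 3 * (k ^ 3 * ((2 * (n * (r ^ 32) ^ k) ^ s) * k ^ T)) *
          Real.exp (-(3 * k)) := by gcongr
      _ = _ := by ring
  calc _ ≤ (r ^ k) ^ T * (Real.exp 1 * Real.exp (3 * k)) *
        (Real.exp 3 * k ^ 3 * (2 * (n * (r ^ 32) ^ k) ^ s) * k ^ T * Real.exp (-(3 * k))) := by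
        gcongr
    _ = (Real.exp (3 * k) * Real.exp (-(3 * k))) * ((k : ℝ) ^ 3 * (n * (r ^ 32) ^ k) ^ s *
        (2 * (Real.exp 1 * Real.exp 3) * (k * r ^ k) ^ T)) := by ring
    _ = _ := by
        rw [← Real.exp_add, ← Real.exp_add, add_neg_cancel, Real.exp_zero, one_mul]
        norm_num

lemma mul_weight_le (h : SecondMomentRange r k n) (hrow : ∀ i, ∑ j, a i j ≤ k)
    (hcol : ∀ j, ∑ i, a i j ≤ k)
    (hD : ((∀ i j, 4 * a i j ≤ k) ∧ k * (∑ i, ∑ j, a i j) ≤ 2 * D) ∨ k ^ 2 ≤ 32 * D ∨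
      ∃ σ : Equiv.Perm (Fin 3), (∀ i, k ≤ 4 * a i (σ i)) ∧
        k * (3 * k) ≤ 4 * D + k * ∑ i, a i (σ i))
    {N : ℕ} (hN : N ≤ k ^ 3) (hN1 : ∀ σ : Equiv.Perm (Fin 3), (∀ i, a i (σ i) = k) → N ≤ 1) :
    N * ((r ^ 32) ^ D * Real.exp (k * ∑ i, ∑ j, (r ^ 32) ^ (k - a i j)) *
        ∏ j, ((k.factorial : ℝ) / (k - ∑ i, a i j).factorial)) ≤
      (k : ℝ) ^ 3 * (n * (r ^ 32) ^ k) ^ (∑ i, ∑ j, a i j) * overlapBound r k a := by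
  have hr := h.pos
  have hNR : (N : ℝ) ≤ (k : ℝ) ^ 3 := by exact_mod_cast hN
  have t1 : 0 ≤ 2 * Real.exp 1 * (r ^ k) ^ (∑ i, ∑ j, a i j) := by positivity
  have t2 : 0 ≤ 2 * (Real.exp 9 * r ^ k) ^ k := by positivity
  have t3 : ∀ σ : Equiv.Perm (Fin 3),
      0 ≤ 2 * Real.exp 4 * ((k : ℝ) ^ 4 * r ^ k) ^ (3 * k - ∑ i, a i (σ i)) := fun σ => by
    positivity
  have t3' := Finset.sum_nonneg fun σ (_ : σ ∈ Finset.univ) => t3 σ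
  rcases hD with ⟨h1, h2⟩ | h1 | ⟨σ, h1, h2⟩
  · refine (mul_le_mul hNR (h.weight_le_of_overlap_le hcol h1 h2) (by positivity)
      (by positivity)).trans ?_
    rw [← mul_assoc]
    refine mul_le_mul_of_nonneg_left ?_ (by positivity)
    unfold overlapBound
    linarith
  · refine (mul_le_mul hNR (h.weight_le_of_le_defect hcol h1) (by positivity)
      (by positivity)).trans ?_
    rw [← mul_assoc]
    refine mul_le_mul_of_nonneg_left ?_ (by positivity)
    unfold overlapBound
    linarith
  · refine (mul_le_mul_of_nonneg_left (h.weight_le_of_le_overlap hrow h1 h2)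
      (Nat.cast_nonneg _)).trans ?_
    set T := 3 * k - ∑ i, a i (σ i) with hT
    have hNT : (N : ℝ) ≤ ((k : ℝ) ^ 3) ^ T := by
      by_cases hT0 : T = 0
      · rw [hT0, pow_zero]
        have hle : ∀ i, a i (σ i) ≤ k := fun i => (Finset.single_le_sum (f := fun j => a i j)
          (fun j _ => Nat.zero_le _) (Finset.mem_univ _)).trans (hrow i)
        have : ∀ i, a i (σ i) = k := by
          have h0 := hle 0
          have h1 := hle 1
          have h2 := hle 2
          rw [hT, Fin.sum_univ_three] at hT0
          intro i
          fin_cases i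
          · change a 0 (σ 0) = k
            omega
          · change a 1 (σ 1) = k
            omega
          · change a 2 (σ 2) = k
            omega
        exact_mod_cast hN1 σ this
      · exact hNR.trans (le_self_pow₀ (one_le_pow₀ h.one_le_cast) hT0)
    have hsum : 2 * Real.exp 4 * ((k : ℝ) ^ 4 * r ^ k) ^ T ≤ overlapBound r k a := by
      have := Finset.single_le_sum (fun σ _ => t3 σ) (Finset.mem_univ σ)
      unfold overlapBound
      linarith
    calc _ ≤ ((k : ℝ) ^ 3) ^ T * ((k : ℝ) ^ 3 * (n * (r ^ 32) ^ k) ^ (∑ i, ∑ j, a i j) *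
          (2 * Real.exp 4 * (k * r ^ k) ^ T)) := by gcongr
      _ = (k : ℝ) ^ 3 * (n * (r ^ 32) ^ k) ^ (∑ i, ∑ j, a i j) *
          (2 * Real.exp 4 * ((k : ℝ) ^ 4 * r ^ k) ^ T) := by
          rw [mul_pow, mul_pow, ← pow_mul, ← pow_mul]
          ring
      _ ≤ _ := by gcongr

end SecondMomentRange

end PairWeight

/-! ### The second moment -/

section SecondMoment

variable {V : Type*} [Fintype V] [DecidableEq V] {p r : ℝ} {k : ℕ}

lemma sum_option_fin_three_ite (b₀ : Option (Fin 3)) (c : ℝ) :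
    ∑ b : Option (Fin 3), (if b = b₀ then 1 else c) = 1 + 3 * c := by
  have h : ∀ b : Option (Fin 3), (if b = b₀ then 1 else c) = (if b = b₀ then 1 - c else 0) + c := by
    intro b
    split_ifs <;> ring
  simp only [h, Finset.sum_add_distrib, Finset.sum_ite_eq', Finset.mem_univ, if_true,
    Finset.sum_const, Finset.card_univ, Fintype.card_option, Fintype.card_fin, nsmul_eq_mul]
  push_cast
  ring

/-- The total overlap weight of the balanced labellings is bounded. -/
lemma sum_overlapBound_le (h : SecondMomentRange r k (Fintype.card V)) {φ : V → Option (Fin 3)}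
    (hφ : ∀ i, (labelClass φ i).card = k) :
    ∑ ψ ∈ balancedLabellings V k,
      (∏ j, ((k - ∑ i, overlap φ ψ i j).factorial /
        (Fintype.card V : ℝ) ^ (k - ∑ i, overlap φ ψ i j))) * overlapBound r k (overlap φ ψ) ≤
      2 * Real.exp 1 * Real.exp 1 + 2 + 6 * (2 * Real.exp 4 * Real.exp 1) := by
  have hη := h.pow_pos
  have hcard : (labelSupport φ).card = 3 * k := by
    rw [card_labelSupport]
    simp [hφ]
  have hV : 0 < Fintype.card V := by exact_mod_cast h.n_pos
  set M : (V → Option (Fin 3)) → ℝ := fun ψ => ∏ j, ((k - ∑ i, overlap φ ψ i j).factorial /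
    (Fintype.card V : ℝ) ^ (k - ∑ i, overlap φ ψ i j)) with hM
  have key : ∀ u : V → Option (Fin 3) → ℝ, (∀ w b, 0 ≤ u w b) →
      ∑ ψ ∈ balancedLabellings V k, M ψ * ∏ w ∈ labelSupport φ, u w (ψ w) ≤
        ∏ w ∈ labelSupport φ, ∑ b, u w b := by
    intro u hu
    have := sum_balancedLabellings_le (k := k) hV (labelSupport φ) u hu
    simpa only [labelCount_labelSupport] using this
  have h1 : ∑ ψ ∈ balancedLabellings V k,
      M ψ * (2 * Real.exp 1 * (r ^ k) ^ (∑ i, ∑ j, overlap φ ψ i j)) ≤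
        2 * Real.exp 1 * Real.exp 1 := by
    have := key (fun _ b => if b = none then 1 else r ^ k) fun w b => by
      split_ifs <;> positivity
    simp only [prod_ite_none_labelSupport, sum_option_fin_three_ite, Finset.prod_const,
      hcard] at this
    have h2 := h.one_add_pow_le_exp (show 0 ≤ 4 by norm_num)
    rw [pow_zero, one_mul] at h2
    calc _ = 2 * Real.exp 1 * ∑ ψ ∈ balancedLabellings V k,
          M ψ * (r ^ k) ^ (∑ i, ∑ j, overlap φ ψ i j) := by
          rw [Finset.mul_sum]
          exact Finset.sum_congr rfl fun ψ _ => by ring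
      _ ≤ _ := mul_le_mul_of_nonneg_left (this.trans h2) (by positivity)
  have h2 : ∑ ψ ∈ balancedLabellings V k, M ψ * (2 * (Real.exp 9 * r ^ k) ^ k) ≤ 2 := by
    have := key (fun _ _ => 1) fun w b => zero_le_one
    simp only [Finset.prod_const_one, mul_one, Finset.sum_const, Finset.card_univ,
      Fintype.card_option, Fintype.card_fin, Finset.prod_const, hcard, nsmul_eq_mul] at this
    rw [← Finset.sum_mul]
    calc _ ≤ ((3 + 1 : ℕ) : ℝ) ^ (3 * k) * (2 * (Real.exp 9 * r ^ k) ^ k) := by gcongr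
      _ = 2 * (64 * Real.exp 9 * r ^ k) ^ k := by
          rw [pow_mul]
          norm_num [mul_pow]
          ring
      _ ≤ 2 * 1 := by
          gcongr
          exact pow_le_one₀ (by positivity) h.exp_mul_le
      _ = 2 := by norm_num
  have h3 : ∀ σ : Equiv.Perm (Fin 3), ∑ ψ ∈ balancedLabellings V k,
      M ψ * (2 * Real.exp 4 * ((k : ℝ) ^ 4 * r ^ k) ^ (3 * k - ∑ i, overlap φ ψ i (σ i))) ≤
        2 * Real.exp 4 * Real.exp 1 := by
    intro σ
    have := key (fun w b => if b = (φ w).map σ then 1 else (k : ℝ) ^ 4 * r ^ k) fun w b => by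
      split_ifs <;> positivity
    simp only [prod_ite_map_labelSupport hφ, sum_option_fin_three_ite, Finset.prod_const,
      hcard] at this
    calc _ = 2 * Real.exp 4 * ∑ ψ ∈ balancedLabellings V k,
          M ψ * ((k : ℝ) ^ 4 * r ^ k) ^ (3 * k - ∑ i, overlap φ ψ i (σ i)) := by
          rw [Finset.mul_sum]
          exact Finset.sum_congr rfl fun ψ _ => by ring
      _ ≤ _ := mul_le_mul_of_nonneg_left (this.trans (h.one_add_pow_le_exp le_rfl))
          (by positivity)
  simp only [overlapBound, mul_add, Finset.sum_add_distrib, Finset.mul_sum] at h1 h2 ⊢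
  rw [Finset.sum_comm]
  have h4 := Finset.sum_le_sum fun σ (_ : σ ∈ Finset.univ) => h3 σ
  have hperm : Fintype.card (Equiv.Perm (Fin 3)) = 6 := by
    rw [Fintype.card_perm]
    rfl
  rw [Finset.sum_const, Finset.card_univ, hperm, nsmul_eq_mul] at h4
  push_cast at h4
  linarith

lemma bitProb_inter_le_of_defect (hp : p ∈ Set.Ioo (0 : ℝ) 1) (hpr : 1 - p = r ^ 32)
    (h : SecondMomentRange r k (Fintype.card V)) {φ ψ : V → Option (Fin 3)} (x y : Fin 3 → V)
    (hφ : ∀ i, (labelClass φ i).card = k) (hψ : ∀ i, (labelClass ψ i).card = k) {D : ℕ}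
    (hD : (crossGraph φ ⊔ crossGraph ψ).edgeFinset.card + k * ∑ i, ∑ j, overlap φ ψ i j =
      6 * k ^ 2 + D) :
    bitProb p (specialEvent φ x ∩ specialEvent ψ y) * (r ^ 32) ^ 6 *
        ((r ^ 32) ^ k) ^ (∑ i, ∑ j, overlap φ ψ i j) ≤
      (r ^ 32) ^ (6 * k ^ 2) * Real.exp (1 - 6 * k) *
        ((r ^ 32) ^ D * Real.exp (k * ∑ i, ∑ j, (r ^ 32) ^ (k - overlap φ ψ i j))) := by
  have hr := h.pos
  have hb := bitProb_specialEvent_inter_le hp x y hφ hψ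
  rw [hpr] at hb
  set q := r ^ 32 with hq
  have hq0 : 0 < q := by positivity
  set s := ∑ i, ∑ j, overlap φ ψ i j
  have hle : ∀ i j, overlap φ ψ i j ≤ k := fun i j =>
    ((Finset.single_le_sum (f := fun j => overlap φ ψ i j) (fun j _ => Nat.zero_le _)
      (Finset.mem_univ j)).trans (sum_overlap_le φ ψ i)).trans (hφ i).le
  have hsum : ∑ i, ∑ j, q ^ (2 * k - overlap φ ψ i j) =
      q ^ k * ∑ i, ∑ j, q ^ (k - overlap φ ψ i j) := by
    simp only [Finset.mul_sum, ← pow_add]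
    refine Finset.sum_congr rfl fun i _ => Finset.sum_congr rfl fun j _ => ?_
    congr 1
    have := hle i j
    omega
  set A := ∑ i, ∑ j, q ^ (k - overlap φ ψ i j)
  have hA : 0 ≤ A := Finset.sum_nonneg fun i _ => Finset.sum_nonneg fun j _ => by positivity
  have hm1 : ((labelSupport φ ∪ labelSupport ψ)ᶜ.card : ℝ) ≤ Fintype.card V := by
    exact_mod_cast Finset.card_le_univ _
  have hm2 : (Fintype.card V : ℝ) - 6 * k ≤ (labelSupport φ ∪ labelSupport ψ)ᶜ.card := by
    have h1 := Finset.card_union_le (labelSupport φ) (labelSupport ψ)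
    have h2 := Finset.card_compl_add_card (labelSupport φ ∪ labelSupport ψ)
    rw [card_labelSupport φ, card_labelSupport ψ] at h1
    simp only [hφ, hψ, Finset.sum_const, Finset.card_univ, Fintype.card_fin, smul_eq_mul] at h1
    have h3 : Fintype.card V ≤ (labelSupport φ ∪ labelSupport ψ)ᶜ.card + 6 * k := by omega
    have : (Fintype.card V : ℝ) ≤ (labelSupport φ ∪ labelSupport ψ)ᶜ.card + 6 * k := by
      exact_mod_cast h3
    linarith
  set m : ℝ := ((labelSupport φ ∪ labelSupport ψ)ᶜ.card : ℝ)
  have hexp : m * (-6 * q ^ k + 6 * q ^ (2 * k) + q ^ k * A) ≤ 1 - 6 * k + k * A := by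
    have hβ := h.beta_pos
    have hβk := h.pow_mul_beta_le (show 1 ≤ 5 by norm_num)
    have hβ0 := h.pow_mul_beta_le (show 0 ≤ 5 by norm_num)
    have hle := h.le
    have hge := h.ge
    rw [← hq] at hβ hβk hβ0 hle hge
    rw [pow_one] at hβk
    rw [pow_zero, one_mul] at hβ0
    rw [show q ^ (2 * k) = q ^ k * q ^ k by rw [← pow_add]; congr 1; ring]
    set β := q ^ k
    have e1 : m * β ≤ k := (mul_le_mul_of_nonneg_right hm1 hβ.le).trans hle
    have e2 : k - β - 6 * (k * β) ≤ m * β := by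
      have := mul_le_mul_of_nonneg_right hm2 hβ.le
      linarith
    have e3 : m * β * β ≤ k * β := mul_le_mul_of_nonneg_right e1 hβ.le
    have e4 : m * β * A ≤ k * A := mul_le_mul_of_nonneg_right e1 hA
    have : m * (-6 * β + 6 * (β * β) + β * A) = -6 * (m * β) + 6 * (m * β * β) + m * β * A := by
      ring
    rw [this]
    linarith
  rw [hsum] at hb
  calc _ ≤ q ^ (crossGraph φ ⊔ crossGraph ψ).edgeFinset.card * Real.exp (1 - 6 * k + k * A) *
        (q ^ k) ^ s := by
        refine mul_le_mul_of_nonneg_right (hb.trans ?_) (by positivity)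
        gcongr
    _ = (q ^ (crossGraph φ ⊔ crossGraph ψ).edgeFinset.card * (q ^ k) ^ s) *
        (Real.exp (1 - 6 * k) * Real.exp (k * A)) := by
        rw [Real.exp_add]
        ring
    _ = _ := by
        rw [← pow_mul q, ← pow_add, hD, pow_add]
        ring

end SecondMoment

section SecondMomentSum

variable {V : Type*} [Fintype V] [DecidableEq V] {p r : ℝ} {k : ℕ}

omit [DecidableEq V] in
lemma card_piFinset_labelClass {φ : V → Option (Fin 3)} (hφ : ∀ i, (labelClass φ i).card = k) :
    (Fintype.piFinset (labelClass φ)).card = k ^ 3 := by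
  simp [Fintype.card_piFinset, hφ]

/-- The constant bounding the sum of all weights. -/
noncomputable def weightConst : ℝ :=
  2 * Real.exp 1 * Real.exp 1 + 2 + 6 * (2 * Real.exp 4 * Real.exp 1)

lemma weightConst_pos : 0 < weightConst := by
  unfold weightConst
  positivity

lemma sum_bitProb_inter_le (hp : p ∈ Set.Ioo (0 : ℝ) 1) (hpr : 1 - p = r ^ 32)
    (h : SecondMomentRange r k (Fintype.card V)) {φ ψ : V → Option (Fin 3)} {x : Fin 3 → V}
    (hφ : ∀ i, (labelClass φ i).card = k) (hx : ∀ i, φ (x i) = some i)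
    (hψ : ∀ i, (labelClass ψ i).card = k) :
    (∑ y ∈ Fintype.piFinset (labelClass ψ), bitProb p (specialEvent φ x ∩ specialEvent ψ y)) *
        (r ^ 32) ^ 6 ≤
      ((r ^ 32) ^ (6 * k ^ 2) * Real.exp (1 - 6 * k) * k ^ 3 *
        ((Fintype.card V : ℝ) ^ (3 * k) / k.factorial ^ 3)) *
        ((∏ j, ((k - ∑ i, overlap φ ψ i j).factorial /
          (Fintype.card V : ℝ) ^ (k - ∑ i, overlap φ ψ i j))) *
          overlapBound r k (overlap φ ψ)) := by
  classical
  have hr := h.pos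
  have hn := h.n_pos
  obtain ⟨D, hD, htri⟩ := exists_overlap_defect h.one_le hφ hψ
  set a := overlap φ ψ with ha
  set s := ∑ i, ∑ j, a i j with hs
  have hs' : ∑ j, ∑ i, a i j = s := Finset.sum_comm
  set q := r ^ 32 with hq
  have hq0 : 0 < q := by positivity
  have hrow : ∀ i, ∑ j, a i j ≤ k := fun i => (sum_overlap_le φ ψ i).trans (hφ i).le
  have hcol : ∀ j, ∑ i, a i j ≤ k := by
    intro j
    have : ∀ i, a i j = overlap ψ φ j i := fun i => by rw [ha, overlap, overlap, Finset.inter_comm]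
    simp only [this]
    exact (sum_overlap_le ψ φ j).trans (hψ j).le
  set Y := (Fintype.piFinset (labelClass ψ)).filter fun y =>
    (specialEvent φ x ∩ specialEvent ψ y).Nonempty with hY
  have hYk : Y.card ≤ k ^ 3 :=
    (Finset.card_filter_le _ _).trans (card_piFinset_labelClass hψ).le
  have hY1 : ∀ σ : Equiv.Perm (Fin 3), (∀ i, a i (σ i) = k) → Y.card ≤ 1 := by
    intro σ hσ
    refine Finset.card_le_one.2 fun y hy y' hy' => ?_
    have hσ' : ∀ i, overlap φ ψ i (σ i) = (labelClass φ i).card := fun i => by rw [hφ]; exact hσ i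
    rw [eq_comp_symm_of_specialEvent_inter hσ' hx (Finset.mem_filter.1 hy).2,
      eq_comp_symm_of_specialEvent_inter hσ' hx (Finset.mem_filter.1 hy').2]
  have hw := h.mul_weight_le hrow hcol htri hYk hY1
  rw [← hq] at hw
  set B := q ^ D * Real.exp (k * ∑ i, ∑ j, q ^ (k - a i j)) with hB
  set E := q ^ (6 * k ^ 2) * Real.exp (1 - 6 * k) with hE
  have hE0 : 0 < E := by positivity
  set F := ∏ j, ((k.factorial : ℝ) / (k - ∑ i, a i j).factorial) with hF
  set M := ∏ j, (((k - ∑ i, a i j).factorial : ℝ) / (Fintype.card V : ℝ) ^ (k - ∑ i, a i j)) with hM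
  have hF0 : 0 < F := Finset.prod_pos fun j _ => by positivity
  have hMF : (Fintype.card V : ℝ) ^ (3 * k) / k.factorial ^ 3 * M * F =
      (Fintype.card V : ℝ) ^ s := by
    have h1 : M * F = ∏ j, ((k.factorial : ℝ) / (Fintype.card V : ℝ) ^ k *
        (Fintype.card V : ℝ) ^ (∑ i, a i j)) := by
      rw [hM, hF, ← Finset.prod_mul_distrib]
      refine Finset.prod_congr rfl fun j _ => ?_
      have : (Fintype.card V : ℝ) ^ k =
          (Fintype.card V : ℝ) ^ (k - ∑ i, a i j) * (Fintype.card V : ℝ) ^ (∑ i, a i j) := by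
        rw [← pow_add, Nat.sub_add_cancel (hcol j)]
      rw [this]
      field_simp
    rw [mul_assoc, h1, Finset.prod_mul_distrib, Finset.prod_pow_eq_pow_sum, hs']
    simp only [Finset.prod_const, Finset.card_univ, Fintype.card_fin]
    rw [mul_comm 3 k, pow_mul, div_pow]
    field_simp
  have hsum : (∑ y ∈ Fintype.piFinset (labelClass ψ),
      bitProb p (specialEvent φ x ∩ specialEvent ψ y)) =
      ∑ y ∈ Y, bitProb p (specialEvent φ x ∩ specialEvent ψ y) := by
    refine (Finset.sum_filter_of_ne fun y _ hy => ?_).symm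
    by_contra hempty
    rw [Set.not_nonempty_iff_eq_empty] at hempty
    exact hy (by simp [hempty, bitProb, bitExp])
  have hterm : (∑ y ∈ Y, bitProb p (specialEvent φ x ∩ specialEvent ψ y)) * q ^ 6 *
      (q ^ k) ^ s ≤ Y.card * (E * B) := by
    rw [Finset.sum_mul, Finset.sum_mul, ← nsmul_eq_mul]
    exact Finset.sum_le_card_nsmul _ _ _ fun y _ =>
      bitProb_inter_le_of_defect hp hpr h x y hφ hψ hD
  rw [hsum]
  refine le_of_mul_le_mul_right ?_ (show 0 < (q ^ k) ^ s * F by positivity)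
  calc _ = ((∑ y ∈ Y, bitProb p (specialEvent φ x ∩ specialEvent ψ y)) * q ^ 6 *
        (q ^ k) ^ s) * F := by ring
    _ ≤ Y.card * (E * B) * F := mul_le_mul_of_nonneg_right hterm hF0.le
    _ = E * (Y.card * (B * F)) := by ring
    _ ≤ E * ((k : ℝ) ^ 3 * (Fintype.card V * q ^ k) ^ s * overlapBound r k a) :=
        mul_le_mul_of_nonneg_left hw hE0.le
    _ = _ := by
        rw [mul_pow, ← hMF]
        ring

/-- The conditional second moment: the expected number of special tuples compatible with a given
one. -/
lemma sum_sum_bitProb_inter_le (hp : p ∈ Set.Ioo (0 : ℝ) 1) (hpr : 1 - p = r ^ 32)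
    (h : SecondMomentRange r k (Fintype.card V)) {φ : V → Option (Fin 3)} {x : Fin 3 → V}
    (hφ : ∀ i, (labelClass φ i).card = k) (hx : ∀ i, φ (x i) = some i) :
    (∑ ψ ∈ balancedLabellings V k, ∑ y ∈ Fintype.piFinset (labelClass ψ),
      bitProb p (specialEvent φ x ∩ specialEvent ψ y)) * (r ^ 32) ^ 6 ≤
      (r ^ 32) ^ (6 * k ^ 2) * Real.exp (1 - 6 * k) * k ^ 3 *
        (2 * (balancedLabellings V k).card) * weightConst := by
  have hr := h.pos
  have hN : (Fintype.card V : ℝ) ^ (3 * k) / k.factorial ^ 3 ≤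
      2 * (balancedLabellings V k).card := by
    rw [div_le_iff₀ (by positivity)]
    have h1 : ((Fintype.card V - 3 * k : ℕ) : ℝ) ^ (3 * k) ≤
        (balancedLabellings V k).card * (k.factorial : ℝ) ^ 3 := by
      exact_mod_cast pow_le_card_balancedLabellings (V := V) k
    linarith [h.pow_le_two_mul]
  rw [Finset.sum_mul]
  refine (Finset.sum_le_sum fun ψ hψ => sum_bitProb_inter_le hp hpr h hφ hx
    (mem_balancedLabellings.1 hψ)).trans ?_
  rw [← Finset.mul_sum]
  have := sum_overlapBound_le h hφ
  exact mul_le_mul (mul_le_mul_of_nonneg_left hN (by positivity)) this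
    (Finset.sum_nonneg fun ψ _ => by unfold overlapBound; positivity) (by positivity)

/-- The number of labelled special triples of size `k`. -/
noncomputable def specialCount (V : Type*) [Fintype V] [DecidableEq V] (k : ℕ)
    (ω : Sym2 V → Bool) : ℝ :=
  ∑ φ ∈ balancedLabellings V k, ∑ x ∈ Fintype.piFinset (labelClass φ),
    (specialEvent φ x).indicator 1 ω

lemma le_bitExp_specialCount (hp : p ∈ Set.Ioo (0 : ℝ) 1) (hpr : 1 - p = r ^ 32)
    (h : SecondMomentRange r k (Fintype.card V)) :
    (balancedLabellings V k).card * ((k : ℝ) ^ 3 * (p ^ 3 * (r ^ 32) ^ (3 * k ^ 2) *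
      (Real.exp (-1) * Real.exp (-3 * k)))) ≤ bitExp p (specialCount V k) := by
  have hr := h.pos
  have hp0 := hp.1
  unfold specialCount
  rw [bitExp_sum, ← nsmul_eq_mul]
  refine Finset.card_nsmul_le_sum _ _ _ fun φ hφ => ?_
  have hφ' := mem_balancedLabellings.1 hφ
  rw [bitExp_sum, ← Nat.cast_pow, ← card_piFinset_labelClass hφ', ← nsmul_eq_mul]
  refine Finset.card_nsmul_le_sum _ _ _ fun x hx => ?_
  have hx' : ∀ i, φ (x i) = some i := fun i => by simpa using Fintype.mem_piFinset.1 hx i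
  have h0 := h.pow_mul_beta_le (show 0 ≤ 5 by norm_num)
  rw [pow_zero, one_mul] at h0
  have := le_bitProb_specialEvent (k := k) hp hφ' hx' (by rw [hpr]; linarith)
  rw [hpr] at this
  refine le_trans ?_ this
  exact mul_le_mul_of_nonneg_left h.exp_neg_le_pow (by positivity)

lemma bitExp_specialCount_sq_le (hp : p ∈ Set.Ioo (0 : ℝ) 1) (hpr : 1 - p = r ^ 32)
    (h : SecondMomentRange r k (Fintype.card V)) :
    bitExp p (fun ω => specialCount V k ω ^ 2) * (r ^ 32) ^ 6 ≤
      (balancedLabellings V k).card * ((k : ℝ) ^ 3 * ((r ^ 32) ^ (6 * k ^ 2) *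
        Real.exp (1 - 6 * k) * k ^ 3 * (2 * (balancedLabellings V k).card) * weightConst)) := by
  have hsq : (fun ω => specialCount V k ω ^ 2) = fun ω => ∑ φ ∈ balancedLabellings V k,
      ∑ x ∈ Fintype.piFinset (labelClass φ), ∑ ψ ∈ balancedLabellings V k,
        ∑ y ∈ Fintype.piFinset (labelClass ψ),
          (specialEvent φ x ∩ specialEvent ψ y).indicator 1 ω := by
    funext ω
    rw [sq, specialCount, Finset.sum_mul]
    refine Finset.sum_congr rfl fun φ _ => ?_
    rw [Finset.sum_mul]
    refine Finset.sum_congr rfl fun x _ => ?_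
    rw [Finset.mul_sum]
    refine Finset.sum_congr rfl fun ψ _ => ?_
    rw [Finset.mul_sum]
    refine Finset.sum_congr rfl fun y _ => ?_
    rw [Set.inter_indicator_one]
    rfl
  rw [hsq, bitExp_sum, Finset.sum_mul, ← nsmul_eq_mul]
  refine Finset.sum_le_card_nsmul _ _ _ fun φ hφ => ?_
  have hφ' := mem_balancedLabellings.1 hφ
  rw [bitExp_sum, Finset.sum_mul]
  refine (Finset.sum_le_card_nsmul _ _ _ fun x hx => ?_).trans_eq (by
    rw [nsmul_eq_mul, card_piFinset_labelClass hφ', Nat.cast_pow])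
  have hx' : ∀ i, φ (x i) = some i := fun i => by simpa using Fintype.mem_piFinset.1 hx i
  refine le_of_eq_of_le ?_ (sum_sum_bitProb_inter_le hp hpr h hφ' hx')
  simp only [bitExp_sum]
  rfl

end SecondMomentSum

lemma le_bitProb_countX_pos {p r : ℝ} {k n : ℕ} (hp : p ∈ Set.Ioo (0 : ℝ) 1)
    (hpr : 1 - p = r ^ 32) (h : SecondMomentRange r k n) :
    p ^ 6 * (1 - p) ^ 6 * Real.exp (-2) / (2 * Real.exp 1 * weightConst) ≤
      bitProb p {ω : Sym2 (Fin n) → Bool |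
        graphOfBits ω ∈ {G : SimpleGraph (Fin n) | 0 < countX G k k k}} := by
  have hr := h.pos
  have hp0 := hp.1
  have hC := weightConst_pos
  have h' : SecondMomentRange r k (Fintype.card (Fin n)) := by rwa [Fintype.card_fin]
  have hE := le_bitExp_specialCount hp hpr h'
  have hE2 := bitExp_specialCount_sq_le hp hpr h'
  set A : Set (Sym2 (Fin n) → Bool) :=
    {ω | graphOfBits ω ∈ {G : SimpleGraph (Fin n) | 0 < countX G k k k}} with hA
  have hsupp : ∀ ω, specialCount (Fin n) k ω ≠ 0 → ω ∈ A := by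
    intro ω hω
    obtain ⟨φ, hφ, hφ0⟩ := Finset.exists_ne_zero_of_sum_ne_zero hω
    obtain ⟨x, hx, hx0⟩ := Finset.exists_ne_zero_of_sum_ne_zero hφ0
    exact countX_pos_of_mem_specialEvent (mem_balancedLabellings.1 hφ)
      (fun i => by simpa using Fintype.mem_piFinset.1 hx i) (Set.mem_of_indicator_ne_zero hx0)
  have hCS := sq_bitExp_le hp hsupp
  have hN : 0 < ((balancedLabellings (Fin n) k).card : ℝ) := by
    have h1 : ((n - 3 * k : ℕ) : ℝ) ^ (3 * k) ≤
        (balancedLabellings (Fin n) k).card * (k.factorial : ℝ) ^ 3 := by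
      have := pow_le_card_balancedLabellings (V := Fin n) k
      rw [Fintype.card_fin] at this
      exact_mod_cast this
    have h2 := h.pow_le_two_mul
    have h3 := _root_.pow_pos h.n_pos (3 * k)
    refine pos_of_mul_pos_left (b := (k.factorial : ℝ) ^ 3) ?_ (by positivity)
    linarith
  have hk := h.one_le_cast
  set N : ℝ := ((balancedLabellings (Fin n) k).card : ℝ)
  set q := r ^ 32
  have hq0 : 0 < q := by positivity
  set U := N ^ 2 * (k : ℝ) ^ 6 * q ^ (6 * k ^ 2) * Real.exp (-6 * k) with hU
  have hU0 : 0 < U := by positivity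
  have e1 : Real.exp (-1) * Real.exp (-1) = Real.exp (-2) := by rw [← Real.exp_add]; norm_num
  have e2 : Real.exp (-3 * k : ℝ) * Real.exp (-3 * k) = Real.exp (-6 * k) := by
    rw [← Real.exp_add]
    congr 1
    ring
  have e3 : q ^ (3 * k ^ 2) * q ^ (3 * k ^ 2) = q ^ (6 * k ^ 2) := by
    rw [← pow_add]
    congr 1
    ring
  have e4 : Real.exp (1 - 6 * k : ℝ) = Real.exp 1 * Real.exp (-6 * k) := by
    rw [← Real.exp_add]
    congr 1
    ring
  have hL : U * (p ^ 6 * Real.exp (-2)) ≤ bitExp p (specialCount (Fin n) k) ^ 2 := by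
    refine le_of_eq_of_le ?_ (pow_le_pow_left₀ (by positivity) hE 2)
    rw [hU, ← e1, ← e2, ← e3]
    ring
  rw [e4] at hE2
  rw [hpr, div_le_iff₀ (by positivity)]
  refine le_of_mul_le_mul_left ?_ hU0
  have hP0 : 0 ≤ bitProb p A := bitProb_nonneg hp A
  calc U * (p ^ 6 * q ^ 6 * Real.exp (-2)) = U * (p ^ 6 * Real.exp (-2)) * q ^ 6 := by ring
    _ ≤ bitExp p (fun ω => specialCount (Fin n) k ω ^ 2) * bitProb p A * q ^ 6 :=
        mul_le_mul_of_nonneg_right (hL.trans hCS) (by positivity)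
    _ = bitExp p (fun ω => specialCount (Fin n) k ω ^ 2) * q ^ 6 * bitProb p A := by ring
    _ ≤ _ := mul_le_mul_of_nonneg_right hE2 hP0
    _ = _ := by
        rw [hU]
        ring

theorem stmt15 {p : ℝ} (hp : p ∈ Set.Ioo (0 : ℝ) 1) :
    (∃ c' : ℝ, 0 < c' ∧ ∃ K : ℕ, ∀ k : ℕ, K ≤ k →
      c' ≤ ((gnp (nseq2 p k) p) {G : SimpleGraph (Fin (nseq2 p k)) |
        0 < countX G k k k}).toReal) ∧
    0 < Filter.liminf (fun k : ℕ =>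
      ((gnp (nseq2 p k) p) {G : SimpleGraph (Fin (nseq2 p k)) |
        0 < countX G k k k}).toReal) atTop := by
  have hq : 0 < 1 - p := by linarith [hp.2]
  have hpr : 1 - p = ((1 - p) ^ (1 / 32 : ℝ)) ^ 32 := by
    rw [← Real.rpow_natCast, ← Real.rpow_mul hq.le]
    norm_num
  have hc : 0 < p ^ 6 * (1 - p) ^ 6 * Real.exp (-2) / (2 * Real.exp 1 * weightConst) := by
    have := hp.1
    have := weightConst_pos
    positivity
  set c := p ^ 6 * (1 - p) ^ 6 * Real.exp (-2) / (2 * Real.exp 1 * weightConst)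
  have hev : ∀ᶠ k in atTop, c ≤ ((gnp (nseq2 p k) p) {G : SimpleGraph (Fin (nseq2 p k)) |
      0 < countX G k k k}).toReal := by
    filter_upwards [eventually_secondMomentRange hp (Real.rpow_pos_of_pos hq _) hpr] with k hk
    rw [gnp_toReal hp]
    exact le_bitProb_countX_pos hp hpr hk
  refine ⟨⟨c, hc, eventually_atTop.1 hev⟩, hc.trans_le (le_liminf_of_le ?_ hev)⟩
  refine (isBoundedUnder_of ⟨1, fun k => ?_⟩).isCoboundedUnder_ge
  rw [gnp_toReal hp]
  exact (bitProb_mono hp (Set.subset_univ _)).trans bitProb_univ.le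
end

section
/- Fix p ∈ (0,1). The probability under G(n,p) that there exist three pairwise disjoint nonempty sets X₁, X₂, X₃ of vertices such that each Xᵢ dominates {1,…,n} ∖ (X₁ ∪ X₂ ∪ X₃) and there are no edges between Xᵢ and Xⱼ for any distinct i, j ∈ {1,2,3}, tends to 0 as n → ∞. -/
open MeasureTheory Filter Real

section RandomGraph

open ProbabilityTheory unitInterval

section Coin

variable {ι : Type*} [Fintype ι]

/-- The product measure on `ι → Bool` under which coordinates are independently `true` with
probability `p`. -/
noncomputable def coinMeasure (ι : Type*) [Fintype ι] (p : I) : Measure (ι → Bool) :=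
  Measure.pi fun _ => bernoulliMeasure true false p

instance (p : I) : IsProbabilityMeasure (coinMeasure ι p) := by
  unfold coinMeasure; infer_instance

lemma coinMeasure_real_forall_false (p : I) (S : Finset ι) :
    (coinMeasure ι p).real {ω | ∀ i ∈ S, ω i = false} = (1 - p : ℝ) ^ S.card := by
  classical
  have h : {ω : ι → Bool | ∀ i ∈ S, ω i = false} =
      Set.univ.pi (fun i => if i ∈ S then {false} else Set.univ) := by
    ext ω
    simp only [Set.mem_ofPred_eq, Set.mem_pi, Set.mem_univ, forall_const]
    refine forall_congr' fun i => ?_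
    by_cases hi : i ∈ S <;> simp [hi]
  rw [h, coinMeasure, measureReal_def, Measure.pi_pi, ENNReal.toReal_prod]
  have : ∀ i : ι, (bernoulliMeasure true false p (if i ∈ S then {false} else Set.univ)).toReal =
      if i ∈ S then (1 - p : ℝ) else 1 := by
    intro i
    split_ifs
    · rw [bernoulliMeasure_apply p (by measurability)]
      simp
    · simp
  simp_rw [this]
  simp

/-- Events determined by disjoint sets of coordinates are independent. -/
lemma coinMeasure_real_inter (p : I) {S T : Finset ι} (hST : Disjoint S T)
    {E F : Set (ι → Bool)} (hE : DependsOn (· ∈ E) (S : Set ι))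
    (hF : DependsOn (· ∈ F) (T : Set ι)) :
    (coinMeasure ι p).real (E ∩ F) = (coinMeasure ι p).real E * (coinMeasure ι p).real F := by
  classical
  have hpre : ∀ {S : Finset ι} {E : Set (ι → Bool)}, DependsOn (· ∈ E) (S : Set ι) →
      (fun (ω : ι → Bool) (i : S) => ω i) ⁻¹' ((fun (ω : ι → Bool) (i : S) => ω i) '' E) = E := by
    intro S E hE
    refine Set.Subset.antisymm ?_ (Set.subset_preimage_image _ _)
    rintro ω ⟨ω', hω', h⟩
    have := hE (x := ω') (y := ω) fun i hi => congrFun h ⟨i, hi⟩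
    exact this.mp hω'
  have hind : iIndepFun (fun i (ω : ι → Bool) => ω i) (coinMeasure ι p) :=
    iIndepFun_pi (X := fun _ b => b) fun _ => aemeasurable_id
  have h2 := (hind.indepFun_finset S T hST fun i => measurable_pi_apply i).measure_inter_preimage_eq_mul
    ((fun (ω : ι → Bool) (i : S) => ω i) '' E) ((fun (ω : ι → Bool) (i : T) => ω i) '' F)
    (.of_discrete) (.of_discrete)
  rw [hpre hE, hpre hF] at h2
  rw [measureReal_def, h2, ENNReal.toReal_mul]
  rfl

lemma coinMeasure_real_biInter (p : I) {J : Type*} (s : Finset J)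
    {S : J → Finset ι} (hS : (s : Set J).PairwiseDisjoint S) {E : J → Set (ι → Bool)}
    (hE : ∀ j, DependsOn (· ∈ E j) (S j : Set ι)) :
    (coinMeasure ι p).real (⋂ j ∈ s, E j) = ∏ j ∈ s, (coinMeasure ι p).real (E j) := by
  classical
  induction s using Finset.induction_on with
  | empty => simp
  | insert j s hj ih =>
    rw [Finset.set_biInter_insert, Finset.prod_insert hj,
      coinMeasure_real_inter p (S := S j) (T := s.biUnion S) _ (hE j), ih]
    · exact hS.subset (by simp)
    · intro ω ω' h
      simp only [Set.mem_iInter, eq_iff_iff]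
      refine forall₂_congr fun k hk => ?_
      exact iff_of_eq (hE k fun i hi => h i (by
        simp only [Finset.coe_biUnion, Set.mem_iUnion]; exact ⟨k, hk, hi⟩))
    · rw [Finset.disjoint_biUnion_right]
      intro k hk
      exact hS (by simp) (by simp [hk]) (by rintro rfl; exact hj hk)

end Coin

/-- The graph whose edges are the non-diagonal pairs marked `true`. -/
def graphOf {n : ℕ} (ω : Sym2 (Fin n) → Bool) : SimpleGraph (Fin n) :=
  SimpleGraph.fromEdgeSet {e | ω e = true}

lemma graphOf_adj {n : ℕ} (ω : Sym2 (Fin n) → Bool) (u v : Fin n) :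
    (graphOf ω).Adj u v ↔ ω s(u, v) = true ∧ u ≠ v := by
  simp [graphOf]

lemma coinMeasure_graphOf_preimage_singleton {n : ℕ} (p : I) (G : SimpleGraph (Fin n)) :
    coinMeasure (Sym2 (Fin n)) p (graphOf ⁻¹' {G}) =
      ENNReal.ofReal ((p : ℝ) ^ Nat.card G.edgeSet *
        (1 - p : ℝ) ^ (n * (n - 1) / 2 - Nat.card G.edgeSet)) := by
  classical
  have h : graphOf ⁻¹' {G} = Set.univ.pi (fun e : Sym2 (Fin n) =>
      if e.IsDiag then Set.univ else {decide (e ∈ G.edgeSet)}) := by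
    ext ω
    simp only [Set.mem_preimage, Set.mem_singleton_iff, Set.mem_pi, Set.mem_univ, forall_const]
    constructor
    · rintro rfl e
      split_ifs with he
      · trivial
      · induction e with
        | _ u v =>
          simp only [SimpleGraph.mem_edgeSet, graphOf_adj, Set.mem_singleton_iff]
          have : u ≠ v := he
          simp [this]
    · intro h
      ext u v
      rw [graphOf_adj]
      by_cases huv : u = v
      · subst huv; simp
      · have := h s(u, v)
        simp only [Sym2.mk_isDiag_iff, huv, if_false, Set.mem_singleton_iff,
          SimpleGraph.mem_edgeSet] at this
        simp [this, huv]
  have hval : ∀ e : Sym2 (Fin n), bernoulliMeasure true false p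
      (if e.IsDiag then Set.univ else {decide (e ∈ G.edgeSet)}) =
      ENNReal.ofReal (if e.IsDiag then 1 else if e ∈ G.edgeSet then (p : ℝ) else 1 - p) := by
    intro e
    have h0 : ∀ x : I, ((unitInterval.toNNReal x : NNReal) : ENNReal) = ENNReal.ofReal x := by
      intro x
      rw [ENNReal.ofReal, Real.toNNReal_of_nonneg x.2.1]
      rfl
    split_ifs with h1 h2
    · simp
    · rw [bernoulliMeasure_apply p (by measurability)]
      simp [h2, h0]
    · rw [bernoulliMeasure_apply p (by measurability)]
      simp [h2, h0]
  rw [h, coinMeasure, Measure.pi_pi, Finset.prod_congr rfl fun e _ => hval e,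
    ← ENNReal.ofReal_prod_of_nonneg]
  · congr 1
    rw [Finset.prod_ite, Finset.prod_ite]
    simp only [Finset.prod_const, one_pow, one_mul, Finset.filter_filter]
    have hc : (Finset.univ.filter fun e : Sym2 (Fin n) => ¬ e.IsDiag ∧ e ∈ G.edgeSet).card =
        Nat.card G.edgeSet := by
      rw [Nat.card_eq_fintype_card, ← Set.toFinset_card]
      congr 1
      ext e
      simp only [Finset.mem_filter, Finset.mem_univ, true_and, Set.mem_toFinset,
        and_iff_right_iff_imp]
      exact fun he => G.not_isDiag_of_mem_edgeSet he
    have ht : (Finset.univ.filter fun e : Sym2 (Fin n) => ¬ e.IsDiag).card = n * (n - 1) / 2 := by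
      rw [← Fintype.card_subtype, Sym2.card_subtype_not_diag, Fintype.card_fin, Nat.choose_two_right]
    have hs := Finset.card_filter_add_card_filter_not
      (s := Finset.univ.filter fun e : Sym2 (Fin n) => ¬ e.IsDiag) (fun e => e ∈ G.edgeSet)
    rw [Finset.filter_filter, Finset.filter_filter, hc, ht] at hs
    rw [hc]
    congr 2
    omega
  · intro e _
    have := p.2.1
    have := p.2.2
    split_ifs <;> linarith

lemma gnp_eq_coinMeasure {n : ℕ} (p : I) (A : Set (SimpleGraph (Fin n))) :
    gnp n p A = coinMeasure (Sym2 (Fin n)) p (graphOf ⁻¹' A) := by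
  classical
  have h : graphOf ⁻¹' A = ⋃ G ∈ A.toFinset, (graphOf (n := n)) ⁻¹' {G} := by
    ext ω; simp
  rw [h, measure_biUnion_finset _ fun _ _ => .of_discrete, gnp,
    Measure.sum_apply _ (MeasurableSpace.measurableSet_top), tsum_fintype]
  · rw [← Finset.sum_filter_add_sum_filter_not Finset.univ (fun G => G ∈ A), Finset.sum_eq_zero
      (s := Finset.univ.filter fun G => ¬ G ∈ A), add_zero]
    · refine Finset.sum_congr (by ext; simp) fun G hG => ?_
      have hG : G ∈ A := by simpa using hG
      rw [coinMeasure_graphOf_preimage_singleton, Measure.smul_apply,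
        Measure.dirac_apply' _ MeasurableSpace.measurableSet_top]
      simp [hG]
    · intro G hG
      have hG : G ∉ A := by simpa using hG
      rw [Measure.smul_apply, Measure.dirac_apply' _ MeasurableSpace.measurableSet_top]
      simp [hG]
  · intro G _ G' _ hGG'
    exact Disjoint.preimage _ (by simpa using hGG')

lemma coinMeasure_real_exists_true {n : ℕ} (p : I) (v : Fin n) (X : Finset (Fin n)) :
    (coinMeasure (Sym2 (Fin n)) p).real {ω | ∃ u ∈ X, ω s(v, u) = true} =
      1 - (1 - p : ℝ) ^ X.card := by
  classical
  have hinj : Set.InjOn (fun u => s(v, u)) (X : Set (Fin n)) := by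
    intro a _ b _ h
    exact Sym2.congr_right.mp h
  have h := coinMeasure_real_forall_false p (X.image fun u => s(v, u))
  rw [Finset.card_image_of_injOn hinj] at h
  rw [← h, ← probReal_compl_eq_one_sub .of_discrete]
  congr 1
  ext ω
  simp

/-- The probability that three given disjoint sets have no edges between them and each dominate
all vertices outside of their union. -/
lemma coinMeasure_real_dominating_triple {n : ℕ} (p : I) (X : Fin 3 → Finset (Fin n))
    (hX : Pairwise fun i j => Disjoint (X i) (X j)) :
    (coinMeasure (Sym2 (Fin n)) p).real
      ({ω | ∀ v, (∀ i, v ∉ X i) → ∀ i, ∃ u ∈ X i, ω s(v, u) = true} ∩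
       {ω | ∀ i j, i ≠ j → ∀ u ∈ X i, ∀ v ∈ X j, ω s(u, v) = false}) =
      (∏ i, (1 - (1 - p : ℝ) ^ (X i).card)) ^ (n - ∑ i, (X i).card) *
      (1 - p : ℝ) ^ ((X 0).card * (X 1).card + (X 0).card * (X 2).card
        + (X 1).card * (X 2).card) := by
  classical
  set U : Finset (Fin n) := Finset.univ.biUnion X with hU
  have hUmem : ∀ v, v ∈ U ↔ ∃ i, v ∈ X i := by intro v; simp [hU]
  have hUcard : U.card = ∑ i, (X i).card :=
    Finset.card_biUnion fun i _ j _ hij => hX hij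
  have h01 : Disjoint (X 0) (X 1) := hX (by decide)
  have h02 : Disjoint (X 0) (X 2) := hX (by decide)
  have h12 : Disjoint (X 1) (X 2) := hX (by decide)
  set J : Finset (Fin n × Fin 3) := Uᶜ ×ˢ Finset.univ with hJ
  set S : Fin n × Fin 3 → Finset (Sym2 (Fin n)) :=
    fun j => (X j.2).image fun u => s(j.1, u) with hS
  set P : Finset (Fin n × Fin n) := X 0 ×ˢ X 1 ∪ X 0 ×ˢ X 2 ∪ X 1 ×ˢ X 2 with hP
  set C : Finset (Sym2 (Fin n)) := P.image fun x => s(x.1, x.2) with hC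
  have hCcard : C.card = (X 0).card * (X 1).card + (X 0).card * (X 2).card
        + (X 1).card * (X 2).card := by
    rw [hC, Finset.card_image_of_injOn, hP, Finset.card_union_of_disjoint,
      Finset.card_union_of_disjoint, Finset.card_product, Finset.card_product,
      Finset.card_product]
    · exact Finset.disjoint_product.mpr (Or.inr h12)
    · rw [Finset.disjoint_union_left]
      exact ⟨Finset.disjoint_product.mpr (Or.inl h01), Finset.disjoint_product.mpr (Or.inl h01)⟩
    · rintro ⟨a, b⟩ hab ⟨c, d⟩ hcd h
      rw [Finset.disjoint_left] at h01 h02 h12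
      simp only [hP, Finset.coe_union, Finset.coe_product, Set.mem_union, Set.mem_prod,
        Finset.mem_coe] at hab hcd
      simp only [Sym2.eq_iff] at h
      rcases h with ⟨rfl, rfl⟩ | ⟨rfl, rfl⟩
      · rfl
      · exfalso
        rcases hab with (hab | hab) | hab <;> rcases hcd with (hcd | hcd) | hcd <;> grind
  have hD : {ω : Sym2 (Fin n) → Bool | ∀ v, (∀ i, v ∉ X i) → ∀ i, ∃ u ∈ X i, ω s(v, u) = true} =
      ⋂ j ∈ J, {ω | ∃ u ∈ X j.2, ω s(j.1, u) = true} := by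
    ext ω
    simp [hJ, hUmem, Prod.forall]
    grind
  have hCset : {ω : Sym2 (Fin n) → Bool |
      ∀ i j, i ≠ j → ∀ u ∈ X i, ∀ v ∈ X j, ω s(u, v) = false} =
      {ω | ∀ e ∈ C, ω e = false} := by
    ext ω
    simp only [Set.mem_ofPred_eq, hC, hP, Finset.mem_image, Finset.mem_union, Finset.mem_product,
      Prod.exists, forall_exists_index, and_imp]
    constructor
    · rintro h e u v huv rfl
      rcases huv with (huv | huv) | huv
      · exact h 0 1 (by decide) _ huv.1 _ huv.2
      · exact h 0 2 (by decide) _ huv.1 _ huv.2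
      · exact h 1 2 (by decide) _ huv.1 _ huv.2
    · intro h i j hij u hu v hv
      have h1 := fun t => h s(u, v) u v t rfl
      have h2 := fun t => h s(u, v) v u t Sym2.eq_swap
      clear h
      fin_cases i <;> fin_cases j <;> simp only [Fin.reduceFinMk, Fin.zero_eta, Fin.mk_one,
        Fin.isValue, ne_eq, not_true_eq_false] at hu hv hij <;> tauto
  have hdepE : ∀ j, DependsOn (· ∈ {ω : Sym2 (Fin n) → Bool | ∃ u ∈ X j.2, ω s(j.1, u) = true})
      (S j : Set (Sym2 (Fin n))) := by
    intro j ω ω' h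
    simp only [Set.mem_ofPred_eq, eq_iff_iff]
    refine exists_congr fun u => and_congr_right fun hu => ?_
    rw [h _ (by simp only [hS, Finset.coe_image]; exact ⟨u, hu, rfl⟩)]
  have hSdisj : (J : Set (Fin n × Fin 3)).PairwiseDisjoint S := by
    rintro ⟨v, i⟩ hv ⟨w, j⟩ hw hne
    simp only [hJ, Finset.coe_product, Set.mem_prod, Finset.mem_coe, Finset.mem_compl, hUmem,
      not_exists] at hv hw
    rw [Function.onFun, Finset.disjoint_left]
    intro e he he'
    simp only [hS, Finset.mem_image] at he he'
    obtain ⟨u, hu, rfl⟩ := he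
    obtain ⟨u', hu', h⟩ := he'
    rcases Sym2.eq_iff.mp h with ⟨rfl, rfl⟩ | ⟨rfl, rfl⟩
    · have hij : i ≠ j := by rintro rfl; exact hne rfl
      exact Finset.disjoint_left.mp (hX hij) hu hu'
    · exact hw.1 _ hu
  have hSC : Disjoint (J.biUnion S) C := by
    rw [Finset.disjoint_left]
    intro e he he'
    simp only [hS, hJ, Finset.mem_biUnion, Finset.mem_image, Finset.mem_product,
      Finset.mem_compl, hUmem] at he
    obtain ⟨⟨v, i⟩, hv, u, hu, rfl⟩ := he
    simp only [hC, Finset.mem_image, Prod.exists] at he'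
    obtain ⟨a, b, hab, h⟩ := he'
    have hab' : (∃ i, a ∈ X i) ∧ ∃ i, b ∈ X i := by
      simp only [hP, Finset.mem_union, Finset.mem_product] at hab
      rcases hab with (hab | hab) | hab <;> exact ⟨⟨_, hab.1⟩, ⟨_, hab.2⟩⟩
    rcases Sym2.eq_iff.mp h with ⟨rfl, rfl⟩ | ⟨rfl, rfl⟩
    · exact hv.1 hab'.1
    · exact hv.1 hab'.2
  rw [hD, hCset, coinMeasure_real_inter p hSC, coinMeasure_real_biInter p J hSdisj hdepE,
    coinMeasure_real_forall_false, hCcard]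
  · congr 1
    simp_rw [coinMeasure_real_exists_true]
    rw [hJ, Finset.prod_product]
    dsimp only
    rw [Finset.prod_const, Finset.card_compl, Fintype.card_fin, hUcard]
  · intro ω ω' h
    simp only [Set.mem_iInter, eq_iff_iff]
    refine forall₂_congr fun k hk => ?_
    exact iff_of_eq (hdepE k fun i hi => h i (by
      simp only [Finset.coe_biUnion, Set.mem_iUnion]; exact ⟨k, hk, hi⟩))
  · intro ω ω' h
    simp only [Set.mem_ofPred_eq, eq_iff_iff]
    refine forall₂_congr fun e he => ?_
    rw [h e he]

/-- The probability that every vertex outside two given disjoint sets `X`, `Y` which has a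
neighbour in `Y` also has one in `X`. -/
lemma coinMeasure_real_pair_le {n : ℕ} (p : I) {X Y : Finset (Fin n)} (hXY : Disjoint X Y)
    (hY : Y.Nonempty) :
    (coinMeasure (Sym2 (Fin n)) p).real
      {ω | ∀ v, v ∉ X → v ∉ Y → (∃ u ∈ Y, ω s(v, u) = true) → ∃ u ∈ X, ω s(v, u) = true} ≤
      (1 - p * (1 - p : ℝ) ^ X.card) ^ (n - (X.card + Y.card)) := by
  classical
  set μ := coinMeasure (Sym2 (Fin n)) p
  have hp0 : (0 : ℝ) ≤ p := p.2.1
  have hp1 : (p : ℝ) ≤ 1 := p.2.2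
  set E : Fin n → Set (Sym2 (Fin n) → Bool) := fun v =>
    {ω | (∃ u ∈ Y, ω s(v, u) = true) → ∃ u ∈ X, ω s(v, u) = true} with hE
  set S : Fin n → Finset (Sym2 (Fin n)) := fun v => (X ∪ Y).image fun u => s(v, u) with hS
  have hset : {ω : Sym2 (Fin n) → Bool |
      ∀ v, v ∉ X → v ∉ Y → (∃ u ∈ Y, ω s(v, u) = true) → ∃ u ∈ X, ω s(v, u) = true} =
      ⋂ v ∈ (X ∪ Y)ᶜ, E v := by
    ext ω
    simp [hE]
  have hdep : ∀ v, DependsOn (· ∈ E v) (S v : Set (Sym2 (Fin n))) := by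
    intro v ω ω' h
    have h' : ∀ u, u ∈ X ∨ u ∈ Y → ω s(v, u) = ω' s(v, u) := fun u hu => h _ (by
      simp only [hS, Finset.coe_image]; exact ⟨u, by simpa using hu, rfl⟩)
    simp only [hE, Set.mem_ofPred_eq, eq_iff_iff]
    refine imp_congr ?_ ?_
    · refine exists_congr fun u => and_congr_right fun hu => ?_
      rw [h' u (Or.inr hu)]
    · refine exists_congr fun u => and_congr_right fun hu => ?_
      rw [h' u (Or.inl hu)]
  have hdisj : (((X ∪ Y)ᶜ : Finset (Fin n)) : Set (Fin n)).PairwiseDisjoint S := by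
    intro v hv w hw hne
    rw [Function.onFun, Finset.disjoint_left]
    intro e he he'
    simp only [hS, Finset.mem_image] at he he'
    obtain ⟨u, hu, rfl⟩ := he
    obtain ⟨u', hu', h⟩ := he'
    rcases Sym2.eq_iff.mp h with ⟨rfl, rfl⟩ | ⟨rfl, rfl⟩
    · exact hne rfl
    · simp at hw hu
      tauto
  have hEv : ∀ v, μ.real (E v) ≤ 1 - p * (1 - p : ℝ) ^ X.card := by
    intro v
    have h1 : (E v)ᶜ ∪ {ω | ∃ u ∈ X, ω s(v, u) = true}
        = {ω | ∃ u ∈ X ∪ Y, ω s(v, u) = true} := by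
      ext ω
      simp only [hE, Set.mem_union, Set.mem_compl_iff, Set.mem_ofPred_eq, Finset.mem_union]
      grind
    have h2 := measureReal_union_le (μ := μ) (E v)ᶜ {ω | ∃ u ∈ X, ω s(v, u) = true}
    rw [h1, coinMeasure_real_exists_true, coinMeasure_real_exists_true,
      probReal_compl_eq_one_sub .of_discrete, Finset.card_union_of_disjoint hXY, pow_add] at h2
    have h3 : (1 - p : ℝ) ^ Y.card ≤ 1 - p := by
      simpa using pow_le_pow_of_le_one (by linarith : (0 : ℝ) ≤ 1 - p) (by linarith)
        (Finset.one_le_card.mpr hY)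
    have h4 : (0 : ℝ) ≤ (1 - p : ℝ) ^ X.card := pow_nonneg (by linarith) _
    nlinarith
  rw [hset, coinMeasure_real_biInter p _ hdisj hdep]
  refine (Finset.prod_le_prod (fun _ _ => measureReal_nonneg) fun v _ => hEv v).trans_eq ?_
  rw [Finset.prod_const, Finset.card_compl, Fintype.card_fin, Finset.card_union_of_disjoint hXY]

lemma sum_finset_apply_card {n : ℕ} (f : ℕ → ℝ) :
    ∑ X : Finset (Fin n), f X.card = ∑ k ∈ Finset.range (n + 1), (n.choose k : ℝ) * f k := by
  have h := Finset.sum_powerset_apply_card f (x := (Finset.univ : Finset (Fin n)))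
  simpa using h

/-- The graphs with three nonempty disjoint pairwise non-adjacent sets which each dominate all the
vertices outside their union. -/
def dominatingTripleEvent (n : ℕ) : Set (SimpleGraph (Fin n)) :=
  {G | ∃ X₁ X₂ X₃ : Finset (Fin n),
        X₁.Nonempty ∧ X₂.Nonempty ∧ X₃.Nonempty ∧
        Disjoint X₁ X₂ ∧ Disjoint X₁ X₃ ∧ Disjoint X₂ X₃ ∧
        (∀ v : Fin n, v ∉ X₁ → v ∉ X₂ → v ∉ X₃ →
          (∃ u ∈ X₁, G.Adj v u) ∧ (∃ u ∈ X₂, G.Adj v u) ∧ (∃ u ∈ X₃, G.Adj v u)) ∧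
        (∀ u ∈ X₁, ∀ v ∈ X₂, ¬ G.Adj u v) ∧
        (∀ u ∈ X₁, ∀ v ∈ X₃, ¬ G.Adj u v) ∧
        (∀ u ∈ X₂, ∀ v ∈ X₃, ¬ G.Adj u v)}

lemma exists_sorted_of_mem_dominatingTripleEvent {n : ℕ} {ω : Sym2 (Fin n) → Bool}
    (h : graphOf ω ∈ dominatingTripleEvent n) :
    ∃ X : Fin 3 → Finset (Fin n), (∀ i, (X i).Nonempty) ∧
      (Pairwise fun i j => Disjoint (X i) (X j)) ∧ (Monotone fun i => (X i).card) ∧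
      (∀ v, (∀ i, v ∉ X i) → ∀ i, ∃ u ∈ X i, ω s(v, u) = true) ∧
      ∀ i j, i ≠ j → ∀ u ∈ X i, ∀ v ∈ X j, ω s(u, v) = false := by
  obtain ⟨X₁, X₂, X₃, n1, n2, n3, d12, d13, d23, hd, e12, e13, e23⟩ := h
  set X : Fin 3 → Finset (Fin n) := ![X₁, X₂, X₃] with hX
  have hne : ∀ i, (X i).Nonempty := by
    intro i; fin_cases i <;> simpa [hX]
  have hdisj : Pairwise fun i j => Disjoint (X i) (X j) := by
    intro i j hij
    fin_cases i <;> fin_cases j <;> simp [hX] at hij ⊢ <;>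
      first | assumption | exact Disjoint.symm (by assumption)
  have hadj : ∀ u v, u ≠ v → ¬ (graphOf ω).Adj u v → ω s(u, v) = false := by
    intro u v huv h
    rw [graphOf_adj] at h
    simpa [huv] using h
  have hdom : ∀ v, (∀ i, v ∉ X i) → ∀ i, ∃ u ∈ X i, ω s(v, u) = true := by
    intro v hv i
    obtain ⟨h1, h2, h3⟩ := hd v (hv 0) (hv 1) (hv 2)
    simp only [graphOf_adj] at h1 h2 h3
    fin_cases i
    · obtain ⟨u, hu, h, -⟩ := h1; exact ⟨u, hu, h⟩
    · obtain ⟨u, hu, h, -⟩ := h2; exact ⟨u, hu, h⟩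
    · obtain ⟨u, hu, h, -⟩ := h3; exact ⟨u, hu, h⟩
  have hedge : ∀ i j, i < j → ∀ u ∈ X i, ∀ v ∈ X j, ω s(u, v) = false := by
    intro i j hij u hu v hv
    refine hadj u v ?_ ?_
    · rintro rfl
      exact Finset.disjoint_left.mp (hdisj hij.ne) hu hv
    · fin_cases i <;> fin_cases j <;> simp at hij
      · exact e12 u hu v hv
      · exact e13 u hu v hv
      · exact e23 u hu v hv
  set τ := Tuple.sort fun i => (X i).card
  refine ⟨X ∘ τ, fun i => hne _, fun i j hij => hdisj (τ.injective.ne hij),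
    Tuple.monotone_sort fun i => (X i).card, ?_, ?_⟩
  · intro v hv i
    exact hdom v (fun j => by simpa using hv (τ.symm j)) _
  · intro i j hij u hu v hv
    rcases lt_or_gt_of_ne (τ.injective.ne hij) with h | h
    · exact hedge _ _ h u hu v hv
    · rw [Sym2.eq_swap]
      exact hedge _ _ h v hv u hu

/-- First moment bound, where the pairs of sizes satisfying `R` are treated by looking at two of
the three sets only. -/
lemma coinMeasure_real_dominatingTripleEvent_le {n : ℕ} (p : I) (R : ℕ → ℕ → Prop)
    [∀ a b, Decidable (R a b)] :
    (coinMeasure (Sym2 (Fin n)) p).real (graphOf ⁻¹' dominatingTripleEvent n) ≤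
      (∑ a ∈ Finset.range (n + 1), (n.choose a : ℝ) * ∑ b ∈ Finset.range (n + 1),
        (n.choose b : ℝ) *
          if 0 < b ∧ R a b then (1 - p * (1 - p : ℝ) ^ a) ^ (n - (a + b)) else 0) +
      ∑ a ∈ Finset.range (n + 1), (n.choose a : ℝ) * ∑ b ∈ Finset.range (n + 1),
        (n.choose b : ℝ) * ∑ c ∈ Finset.range (n + 1), (n.choose c : ℝ) *
          if 0 < a ∧ a ≤ b ∧ b ≤ c ∧ ¬ R a b then
            ((1 - (1 - p : ℝ) ^ a) * (1 - (1 - p : ℝ) ^ b) * (1 - (1 - p : ℝ) ^ c))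
              ^ (n - (a + b + c)) * (1 - p : ℝ) ^ (a * b + a * c + b * c) else 0 := by
  classical
  have hp0 : (0 : ℝ) ≤ p := p.2.1
  have hp1 : (p : ℝ) ≤ 1 := p.2.2
  have hq : ∀ k : ℕ, (1 - p : ℝ) ^ k ≤ 1 := fun k => pow_le_one₀ (by linarith) (by linarith)
  have hq0 : ∀ k : ℕ, 0 ≤ (1 - p : ℝ) ^ k := fun k => pow_nonneg (by linarith) _
  set μ := coinMeasure (Sym2 (Fin n)) p
  set F := Finset (Fin n)
  set E₂ : F × F → Set (Sym2 (Fin n) → Bool) := fun x => {ω | (Disjoint x.1 x.2 ∧ x.2.Nonempty ∧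
    R x.1.card x.2.card) ∧
    ∀ v, v ∉ x.1 → v ∉ x.2 → (∃ u ∈ x.2, ω s(v, u) = true) → ∃ u ∈ x.1, ω s(v, u) = true} with hE₂
  set E₃ : F × F × F → Set (Sym2 (Fin n) → Bool) := fun x => {ω |
    ((Pairwise fun i j => Disjoint (![x.1, x.2.1, x.2.2] i) (![x.1, x.2.1, x.2.2] j)) ∧
      0 < x.1.card ∧ x.1.card ≤ x.2.1.card ∧ x.2.1.card ≤ x.2.2.card ∧ ¬ R x.1.card x.2.1.card) ∧
    ω ∈ ({ω | ∀ v, (∀ i, v ∉ ![x.1, x.2.1, x.2.2] i) →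
        ∀ i, ∃ u ∈ ![x.1, x.2.1, x.2.2] i, ω s(v, u) = true} ∩
       {ω | ∀ i j, i ≠ j → ∀ u ∈ ![x.1, x.2.1, x.2.2] i, ∀ v ∈ ![x.1, x.2.1, x.2.2] j,
        ω s(u, v) = false})} with hE₃
  have hsub : graphOf ⁻¹' dominatingTripleEvent n ⊆
      (⋃ x ∈ (Finset.univ : Finset (F × F)), E₂ x) ∪
        ⋃ x ∈ (Finset.univ : Finset (F × F × F)), E₃ x := by
    intro ω hω
    obtain ⟨X, hne, hd, hm, hdom, hedge⟩ := exists_sorted_of_mem_dominatingTripleEvent hω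
    by_cases hR : R (X 0).card (X 1).card
    · left
      refine Set.mem_biUnion (x := (X 0, X 1)) (by simp) ?_
      refine ⟨⟨hd (by decide), hne 1, hR⟩, ?_⟩
      rintro v hv0 hv1 ⟨u, hu, huv⟩
      by_cases hv2 : v ∈ X 2
      · have := hedge 2 1 (by decide) v hv2 u hu
        simp [this] at huv
      · refine hdom v (fun i => ?_) 0
        fin_cases i <;> assumption
    · right
      refine Set.mem_biUnion (x := (X 0, X 1, X 2)) (by simp) ?_
      have hX : ![X 0, X 1, X 2] = X := by
        ext i; fin_cases i <;> rfl
      simp only [hE₃, hX]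
      exact ⟨⟨hd, (hne 0).card_pos, hm (by decide), hm (by decide), hR⟩, hdom, hedge⟩
  have h₂ : ∀ x, μ.real (E₂ x) ≤ if 0 < x.2.card ∧ R x.1.card x.2.card then
      (1 - p * (1 - p : ℝ) ^ x.1.card) ^ (n - (x.1.card + x.2.card)) else 0 := by
    intro x
    by_cases h : Disjoint x.1 x.2 ∧ x.2.Nonempty ∧ R x.1.card x.2.card
    · rw [if_pos ⟨h.2.1.card_pos, h.2.2⟩]
      refine (measureReal_mono (fun ω hω => hω.2)).trans (coinMeasure_real_pair_le p h.1 h.2.1)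
    · have : E₂ x = ∅ := by simp only [hE₂, h, false_and]; rfl
      rw [this, measureReal_empty]
      split_ifs
      · refine pow_nonneg ?_ _
        nlinarith [hq x.1.card, hq0 x.1.card]
      · exact le_rfl
  have h₃ : ∀ x, μ.real (E₃ x) ≤
      if 0 < x.1.card ∧ x.1.card ≤ x.2.1.card ∧ x.2.1.card ≤ x.2.2.card ∧
        ¬ R x.1.card x.2.1.card then
        ((1 - (1 - p : ℝ) ^ x.1.card) * (1 - (1 - p : ℝ) ^ x.2.1.card) *
          (1 - (1 - p : ℝ) ^ x.2.2.card))
          ^ (n - (x.1.card + x.2.1.card + x.2.2.card)) *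
          (1 - p : ℝ) ^ (x.1.card * x.2.1.card + x.1.card * x.2.2.card
            + x.2.1.card * x.2.2.card) else 0 := by
    intro x
    by_cases h : (Pairwise fun i j =>
      Disjoint (![x.1, x.2.1, x.2.2] i) (![x.1, x.2.1, x.2.2] j)) ∧
      0 < x.1.card ∧ x.1.card ≤ x.2.1.card ∧ x.2.1.card ≤ x.2.2.card ∧ ¬ R x.1.card x.2.1.card
    · rw [if_pos h.2]
      refine (measureReal_mono (fun ω hω => hω.2)).trans ?_
      rw [coinMeasure_real_dominating_triple p _ h.1]
      simp [Fin.prod_univ_three, Fin.sum_univ_three]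
    · have : E₃ x = ∅ := by simp only [hE₃, h, false_and]; rfl
      rw [this, measureReal_empty]
      split_ifs
      · refine mul_nonneg (pow_nonneg (mul_nonneg (mul_nonneg ?_ ?_) ?_) _) (hq0 _) <;>
          exact sub_nonneg.mpr (hq _)
      · exact le_rfl
  refine (measureReal_mono hsub).trans ((measureReal_union_le _ _).trans (add_le_add ?_ ?_))
  · refine (measureReal_biUnion_finset_le _ _).trans
      ((Finset.sum_le_sum fun x _ => h₂ x).trans_eq ?_)
    rw [Fintype.sum_prod_type, ← sum_finset_apply_card (fun a => ∑ b ∈ Finset.range (n + 1),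
        (n.choose b : ℝ) *
          if 0 < b ∧ R a b then (1 - p * (1 - p : ℝ) ^ a) ^ (n - (a + b)) else 0)]
    refine Finset.sum_congr rfl fun X _ => ?_
    exact sum_finset_apply_card fun b => if 0 < b ∧ R X.card b then
      (1 - p * (1 - p : ℝ) ^ X.card) ^ (n - (X.card + b)) else 0
  · refine (measureReal_biUnion_finset_le _ _).trans
      ((Finset.sum_le_sum fun x _ => h₃ x).trans_eq ?_)
    rw [Fintype.sum_prod_type, ← sum_finset_apply_card (fun a => ∑ b ∈ Finset.range (n + 1),
        (n.choose b : ℝ) * ∑ c ∈ Finset.range (n + 1), (n.choose c : ℝ) *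
          if 0 < a ∧ a ≤ b ∧ b ≤ c ∧ ¬ R a b then
            ((1 - (1 - p : ℝ) ^ a) * (1 - (1 - p : ℝ) ^ b) * (1 - (1 - p : ℝ) ^ c))
              ^ (n - (a + b + c)) * (1 - p : ℝ) ^ (a * b + a * c + b * c) else 0)]
    refine Finset.sum_congr rfl fun X _ => ?_
    rw [Fintype.sum_prod_type, ← sum_finset_apply_card (fun b =>
      ∑ c ∈ Finset.range (n + 1), (n.choose c : ℝ) *
          if 0 < X.card ∧ X.card ≤ b ∧ b ≤ c ∧ ¬ R X.card b then
            ((1 - (1 - p : ℝ) ^ X.card) * (1 - (1 - p : ℝ) ^ b) * (1 - (1 - p : ℝ) ^ c))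
              ^ (n - (X.card + b + c)) * (1 - p : ℝ) ^ (X.card * b + X.card * c + b * c) else 0)]
    refine Finset.sum_congr rfl fun Y _ => ?_
    exact sum_finset_apply_card fun c => if 0 < X.card ∧ X.card ≤ Y.card ∧ Y.card ≤ c ∧
      ¬ R X.card Y.card then
        ((1 - (1 - p : ℝ) ^ X.card) * (1 - (1 - p : ℝ) ^ Y.card) * (1 - (1 - p : ℝ) ^ c))
          ^ (n - (X.card + Y.card + c)) *
          (1 - p : ℝ) ^ (X.card * Y.card + X.card * c + Y.card * c) else 0

section Estimates

/-- A lower bound for the remainder in the inequality `1 + w ≤ exp w`. -/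
lemma one_add_add_sq_div_le_exp (w : ℝ) : 1 + w + w ^ 2 / (2 + |w|) ≤ exp w := by
  rcases le_or_gt 0 w with hw | hw
  · rw [abs_of_nonneg hw]
    have h1 := Real.quadratic_le_exp_of_nonneg hw
    have h2 : w ^ 2 / (2 + w) ≤ w ^ 2 / 2 := by gcongr; linarith
    linarith
  · rw [abs_of_neg hw]
    have h1 : 0 ≤ exp (-w) - 1 := by have := Real.add_one_le_exp (-w); linarith
    have h2 := Real.le_log_one_add_of_nonneg h1
    rw [add_sub_cancel, Real.log_exp, div_le_iff₀ (by linarith), exp_neg] at h2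
    have h3 := exp_pos w
    have h4 : 2 * (1 - exp w) ≤ -w * (1 + exp w) := by
      have := mul_le_mul_of_nonneg_right h2 h3.le
      have h5 : (exp w)⁻¹ * exp w = 1 := inv_mul_cancel₀ h3.ne'
      linear_combination this - (2 + w) * h5
    have h6 : 1 + w + w ^ 2 / (2 + -w) = (2 + w) / (2 + -w) := by
      field_simp [(by linarith : 2 + -w ≠ 0)]
      ring
    rw [h6, div_le_iff₀ (by linarith)]
    linarith

/-- Gaussian sums over well-spaced points are uniformly bounded. -/
lemma exists_sum_exp_neg_sq_le {l κ : ℝ} (hl : 0 < l) (hκ : 0 < κ) :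
    ∃ K : ℝ, ∀ (F : Finset ℕ) (w : ℕ → ℝ),
      (∀ a ∈ F, ∀ b ∈ F, l * |(a : ℝ) - b| ≤ |w a - w b|) →
      ∑ a ∈ F, exp (-(κ * w a ^ 2)) ≤ K := by
  set c : ℝ := κ * (l / 2) ^ 2
  have hc : 0 < c := by positivity
  have hsN : Summable fun j : ℕ => exp (-(c * (j : ℝ))) := by
    have := Real.summable_exp_nat_mul_iff (a := -c) |>.mpr (by linarith)
    refine this.congr fun j => ?_
    congr 1; ring
  have hs : Summable fun j : ℤ => exp (-(c * |(j : ℝ)|)) := by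
    refine Summable.of_nat_of_neg ?_ ?_ <;> simpa using hsN
  refine ⟨∑' j : ℤ, exp (-(c * |(j : ℝ)|)), fun F w hw => ?_⟩
  rcases F.eq_empty_or_nonempty with rfl | hF
  · simpa using tsum_nonneg fun j => (exp_pos _).le
  obtain ⟨m, hm, hmin⟩ := F.exists_min_image (fun a => |w a|) hF
  have hterm : ∀ a ∈ F, exp (-(κ * w a ^ 2)) ≤ exp (-(c * |((a - m : ℤ) : ℝ)|)) := by
    intro a ha
    rw [exp_le_exp, neg_le_neg_iff]
    push_cast
    have h1 := hw a ha m hm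
    have h2 := hmin a ha
    have h3 : |w a - w m| ≤ 2 * |w a| := by
      have := abs_sub (w a) (w m); linarith
    have h4 : l / 2 * |(a : ℝ) - m| ≤ |w a| := by linarith
    have h5 : |(a : ℝ) - m| ≤ |(a : ℝ) - m| ^ 2 := by
      have : |(a : ℝ) - m| = ((|(a : ℤ) - m| : ℤ) : ℝ) := by push_cast; rfl
      rw [this]
      exact_mod_cast Int.le_self_sq _
    calc c * |(a : ℝ) - m| ≤ c * |(a : ℝ) - m| ^ 2 := by gcongr
      _ = κ * (l / 2 * |(a : ℝ) - m|) ^ 2 := by simp only [c]; ring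
      _ ≤ κ * |w a| ^ 2 := by gcongr
      _ = κ * w a ^ 2 := by rw [sq_abs]
  calc ∑ a ∈ F, exp (-(κ * w a ^ 2)) ≤ ∑ a ∈ F, exp (-(c * |((a - m : ℤ) : ℝ)|)) :=
        Finset.sum_le_sum hterm
    _ = ∑ j ∈ F.image (fun a : ℕ => (a - m : ℤ)), exp (-(c * |(j : ℝ)|)) := by
        rw [Finset.sum_image]
        intro a _ b _ h
        simpa using h
    _ ≤ _ := hs.sum_le_tsum _ fun j _ => (exp_pos _).le

lemma choose_le_exp_mul_log {n : ℕ} (hn : 0 < n) (a : ℕ) :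
    (n.choose a : ℝ) ≤ exp (a * log n) := by
  have h : (n.choose a : ℝ) ≤ (n : ℝ) ^ a := by exact_mod_cast Nat.choose_le_pow n a
  rwa [exp_nat_mul, exp_log (by exact_mod_cast hn)]

lemma choose_le_inv_sqrt_mul_exp {n a : ℕ} (hn : 0 < n) (ha : 0 < a) :
    (n.choose a : ℝ) ≤ (√a)⁻¹ * exp (a * log n - a * log a + a) := by
  have ha' : (0 : ℝ) < a := by exact_mod_cast ha
  have h1 : (n.choose a : ℝ) ≤ (n : ℝ) ^ a / (a.factorial : ℝ) := Nat.choose_le_pow_div a n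
  have h2 : √a * exp (a * log a - a) ≤ (a.factorial : ℝ) := by
    refine le_trans ?_ (Stirling.le_factorial_stirling a)
    have h3 : exp (a * log a - a) = ((a : ℝ) / exp 1) ^ a := by
      rw [← mul_sub_one, exp_nat_mul, exp_sub, exp_log ha']
    rw [h3]
    gcongr
    nlinarith [Real.pi_gt_three]
  calc (n.choose a : ℝ) ≤ (n : ℝ) ^ a / (a.factorial : ℝ) := h1
    _ ≤ (n : ℝ) ^ a / (√a * exp (a * log a - a)) := by gcongr
    _ = _ := by
      rw [add_comm_sub, exp_add, exp_nat_mul, exp_log (by exact_mod_cast hn),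
        ← neg_sub (a * log a) (a : ℝ), exp_neg]
      field_simp

lemma one_sub_pow_le_exp {x : ℝ} (hx1 : x ≤ 1) (m : ℕ) :
    (1 - x) ^ m ≤ exp (-(x * m)) := by
  calc (1 - x) ^ m ≤ exp (-x) ^ m := pow_le_pow_left₀ (by linarith) (one_sub_le_exp_neg x) m
    _ = _ := by rw [← exp_nat_mul]; congr 1; ring

/-- Contribution of pairs of sizes of which the first is below the critical range. -/
lemma pair_term_le {n a b : ℕ} {l A : ℝ} (hn : 0 < n) (hl : 0 < l) (hA : log n = l * A)
    (ha : (a : ℝ) < 0.95 * A) (hb : (b : ℝ) < 4 * A) (hAn : 5 * A ≤ n / 2) :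
    (n.choose a : ℝ) * ((n.choose b : ℝ) *
      (1 - (1 - exp (-l)) * (exp (-l)) ^ a) ^ (n - (a + b))) ≤
    exp (5 * log n * A - (1 - exp (-l)) / 2 * exp (0.05 * log n)) := by
  have hn' : (0 : ℝ) < n := by exact_mod_cast hn
  have hL : 0 ≤ log n := Real.log_natCast_nonneg n
  have hp0 : 0 < 1 - exp (-l) := by simpa using hl
  have hp1 : 1 - exp (-l) ≤ 1 := by linarith [exp_pos (-l)]
  set p := 1 - exp (-l)
  have hqa : exp (-l) ^ a = exp (-(l * a)) := by rw [← exp_nat_mul]; congr 1; ring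
  have hqa1 : exp (-(l * a)) ≤ 1 := exp_le_one_iff.mpr (by simp; positivity)
  have hx : p * exp (-(l * a)) ≤ 1 := mul_le_one₀ hp1 (exp_pos _).le hqa1
  have hm : (n : ℝ) / 2 ≤ ((n - (a + b) : ℕ) : ℝ) := by
    have h : (n : ℝ) ≤ ((n - (a + b) : ℕ) : ℝ) + (a + b) := by exact_mod_cast (by omega)
    linarith
  have hq : exp (-(0.95 * log n)) ≤ exp (-(l * a)) := by
    rw [exp_le_exp, hA]; nlinarith
  have hpow : (1 - p * exp (-l) ^ a) ^ (n - (a + b)) ≤ exp (-(p / 2 * exp (0.05 * log n))) := by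
    rw [hqa]
    refine (one_sub_pow_le_exp hx _).trans ?_
    rw [exp_le_exp, neg_le_neg_iff]
    have h1 : exp (0.05 * log n) = exp (-(0.95 * log n)) * n := by
      nth_rewrite 3 [← exp_log hn']
      rw [← exp_add]; congr 1; ring
    rw [h1]
    calc p / 2 * (exp (-(0.95 * log n)) * n) = p * exp (-(0.95 * log n)) * (n / 2) := by ring
      _ ≤ _ := by gcongr
  calc _ ≤ exp (a * log n) * (exp (b * log n) * exp (-(p / 2 * exp (0.05 * log n)))) := by
        gcongr
        · exact mul_nonneg (by positivity) (pow_nonneg (by rw [hqa]; linarith) _)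
        · exact choose_le_exp_mul_log hn a
        · exact pow_nonneg (by rw [hqa]; linarith) _
        · exact choose_le_exp_mul_log hn b
    _ = exp ((a + b) * log n - p / 2 * exp (0.05 * log n)) := by
        rw [← exp_add, ← exp_add]; congr 1; ring
    _ ≤ _ := by
        rw [exp_le_exp]
        nlinarith

lemma quadratic_gap {A a b c : ℝ} (hA : 0 ≤ A) (ha : 0 ≤ a) (hab : a ≤ b) (hbc : b ≤ c)
    (h1 : a < 0.95 * A → 4 * A ≤ b) (h2 : 0.95 * A ≤ a → 1.25 * A < c) :
    (a + b + c) * A - (a * b + a * c + b * c) ≤ -(0.1 * A ^ 2) := by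
  rcases lt_or_ge a (0.95 * A) with h | h
  · have hb := h1 h
    nlinarith [mul_nonneg ha (ha.trans hab), mul_nonneg ha (ha.trans (hab.trans hbc)),
      mul_nonneg (sub_nonneg.mpr hb) (ha.trans (hab.trans hbc)),
      mul_nonneg hA (sub_nonneg.mpr (hb.trans hbc)), mul_nonneg hA (sub_nonneg.mpr hbc),
      mul_nonneg hA (sub_nonneg.mpr (hab.trans hbc)), sq_nonneg A]
  · have hc := h2 h
    obtain ⟨x, rfl⟩ : ∃ x, a = 0.95 * A + x := ⟨a - 0.95 * A, by ring⟩
    obtain ⟨y, rfl⟩ : ∃ y, b = 0.95 * A + y := ⟨b - 0.95 * A, by ring⟩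
    obtain ⟨z, rfl⟩ : ∃ z, c = 0.95 * A + z := ⟨c - 0.95 * A, by ring⟩
    have hx : 0 ≤ x := by linarith
    have hy : 0 ≤ y := by linarith
    have hz : 0.3 * A ≤ z := by linarith
    have hz0 : 0 ≤ z := by linarith
    nlinarith [mul_nonneg hx hy, mul_nonneg hx hz0, mul_nonneg hy hz0, mul_nonneg hA hx,
      mul_nonneg hA hy, mul_nonneg hA (sub_nonneg.mpr hz)]

/-- Contribution of triples of sizes outside the critical range. -/
lemma triple_term_le_of_gap {n a b c : ℕ} {l A : ℝ} (hn : 0 < n) (hl : 0 < l)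
    (hA : log n = l * A) (hab : a ≤ b) (hbc : b ≤ c)
    (h1 : (a : ℝ) < 0.95 * A → 4 * A ≤ b) (h2 : 0.95 * A ≤ a → 1.25 * A < c) :
    (n.choose a : ℝ) * ((n.choose b : ℝ) * ((n.choose c : ℝ) *
      (((1 - exp (-l) ^ a) * (1 - exp (-l) ^ b) * (1 - exp (-l) ^ c)) ^ (n - (a + b + c)) *
        exp (-l) ^ (a * b + a * c + b * c)))) ≤ exp (-(0.1 * log n * A)) := by
  have hL : 0 ≤ log n := Real.log_natCast_nonneg n
  have hA0 : 0 ≤ A := by by_contra h; push Not at h; nlinarith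
  have hgap := quadratic_gap hA0 (Nat.cast_nonneg a) (by exact_mod_cast hab : (a : ℝ) ≤ b)
    (by exact_mod_cast hbc : (b : ℝ) ≤ c) h1 h2
  have hq : ∀ k : ℕ, 0 ≤ 1 - exp (-l) ^ k ∧ 1 - exp (-l) ^ k ≤ 1 := fun k =>
    ⟨sub_nonneg.mpr (pow_le_one₀ (exp_pos _).le (exp_le_one_iff.mpr (by linarith))),
      sub_le_self _ (pow_nonneg (exp_pos _).le _)⟩
  have hbase0 : 0 ≤ (1 - exp (-l) ^ a) * (1 - exp (-l) ^ b) * (1 - exp (-l) ^ c) :=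
    mul_nonneg (mul_nonneg (hq a).1 (hq b).1) (hq c).1
  have hbase1 : (1 - exp (-l) ^ a) * (1 - exp (-l) ^ b) * (1 - exp (-l) ^ c) ≤ 1 :=
    mul_le_one₀ (mul_le_one₀ (hq a).2 (hq b).1 (hq b).2) (hq c).1 (hq c).2
  have hpow := pow_le_one₀ hbase0 hbase1 (n := n - (a + b + c))
  calc _ ≤ exp (a * log n) * (exp (b * log n) * (exp (c * log n) *
        (1 * exp (-l) ^ (a * b + a * c + b * c)))) := by
        gcongr <;> exact choose_le_exp_mul_log hn _
    _ = exp (l * (((a : ℝ) + b + c) * A - (a * b + a * c + b * c))) := by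
        rw [one_mul, ← exp_nat_mul, ← exp_add, ← exp_add, ← exp_add, hA]
        push_cast
        congr 1; ring
    _ ≤ _ := by
        rw [exp_le_exp, hA]
        nlinarith

/-- With `w = log n - l a - log a`, this is the exponent of the contribution of a set of size `a`
in the critical range. -/
lemma critical_exponent_le {L l A a : ℝ} (hl : 0 < l) (hA : L = l * A) (hL : 12 ≤ L)
    (hA1 : 1 ≤ 0.95 * A) (hlog : log (1.25 * A) ≤ 0.05 * L)
    (ha1 : 0.95 * A ≤ a) (ha2 : a ≤ 1.25 * A) :
    a * L - a * log a + a - exp (L - l * a) - l * a ^ 2 ≤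
      -(2 / l * (L - l * a - log a) ^ 2) := by
  have ha0 : 0 < a := by linarith
  set w := L - l * a - log a with hw
  have hexp : exp (L - l * a) = a * exp w := by
    rw [hw, exp_sub _ (log a), exp_log ha0]; field_simp
  have hlog0 : 0 ≤ log a := log_nonneg (by linarith)
  have hlog1 : log a ≤ 0.05 * L := (log_le_log ha0 ha2).trans hlog
  have hla1 : 0.95 * L ≤ l * a := by rw [hA]; nlinarith
  have hla2 : l * a ≤ 1.25 * L := by rw [hA]; nlinarith
  have hwabs : |w| ≤ 0.3 * L := by rw [abs_le]; constructor <;> linarith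
  have h1 := one_add_add_sq_div_le_exp w
  have h2 : 2 / l * w ^ 2 ≤ a * (w ^ 2 / (2 + |w|)) := by
    have h3 : 2 / l ≤ a / (2 + |w|) := by
      rw [div_le_div_iff₀ hl (by positivity)]
      linarith
    calc 2 / l * w ^ 2 ≤ a / (2 + |w|) * w ^ 2 := by gcongr
      _ = _ := by ring
  have h4 : a * L - a * log a - l * a ^ 2 = a * w := by rw [hw]; ring
  have h5 := mul_le_mul_of_nonneg_left h1 ha0.le
  rw [hexp]
  linarith

lemma mul_abs_sub_le_abs_sub {L l a b : ℝ} (ha : 0 < a) (hb : 0 < b) :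
    l * |a - b| ≤ |(L - l * a - log a) - (L - l * b - log b)| := by
  wlog hab : a ≤ b generalizing a b
  · rw [abs_sub_comm a b, abs_sub_comm (L - l * a - log a)]
    exact this hb ha (le_of_not_ge hab)
  have h := log_le_log ha hab
  rw [abs_sub_comm, abs_of_nonneg (by linarith : 0 ≤ b - a)]
  refine le_trans ?_ (le_abs_self _)
  linarith

/-- Contribution of triples of sizes inside the critical range. -/
lemma triple_term_le_of_critical {n a b c : ℕ} {l A : ℝ} (hn : 0 < n) (hl : 0 < l)
    (hA : log n = l * A) (hL : 12 ≤ log n) (hA1 : 1 ≤ 0.95 * A)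
    (hlog : log (1.25 * A) ≤ 0.05 * log n) (hexp : exp (-(0.95 * log n)) * (3.75 * A) ≤ 1)
    (ha1 : 0.95 * A ≤ a) (ha2 : a ≤ 1.25 * A) (hb1 : 0.95 * A ≤ b) (hb2 : b ≤ 1.25 * A)
    (hc1 : 0.95 * A ≤ c) (hc2 : c ≤ 1.25 * A) :
    (n.choose a : ℝ) * ((n.choose b : ℝ) * ((n.choose c : ℝ) *
      (((1 - exp (-l) ^ a) * (1 - exp (-l) ^ b) * (1 - exp (-l) ^ c)) ^ (n - (a + b + c)) *
        exp (-l) ^ (a * b + a * c + b * c)))) ≤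
    exp 3 * (((√a)⁻¹ * exp (-(1 / (2 * l) * (log n - l * a - log a) ^ 2))) *
      (((√b)⁻¹ * exp (-(1 / (2 * l) * (log n - l * b - log b) ^ 2))) *
      ((√c)⁻¹ * exp (-(1 / (2 * l) * (log n - l * c - log c) ^ 2))))) := by
  have hn' : (0 : ℝ) < n := by exact_mod_cast hn
  have ha0 : (0 : ℝ) < a := by linarith
  have hb0 : (0 : ℝ) < b := by linarith
  have hc0 : (0 : ℝ) < c := by linarith
  set L := log n with hLdef
  have hm : (n : ℝ) - 3.75 * A ≤ ((n - (a + b + c) : ℕ) : ℝ) := by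
    have h : (n : ℝ) ≤ ((n - (a + b + c) : ℕ) : ℝ) + (a + b + c) := by exact_mod_cast (by omega)
    linarith
  have hdom : ∀ k : ℕ, 0.95 * A ≤ k →
      (1 - exp (-l) ^ k) ^ (n - (a + b + c)) ≤ exp (1 - exp (L - l * k)) := by
    intro k hk
    have hqk : exp (-l) ^ k = exp (-(l * k)) := by rw [← exp_nat_mul]; congr 1; ring
    rw [hqk]
    refine (one_sub_pow_le_exp (exp_le_one_iff.mpr (by simp; positivity)) _).trans ?_
    rw [exp_le_exp]
    have h1 : exp (L - l * k) = exp (-(l * k)) * n := by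
      rw [sub_eq_neg_add, exp_add, hLdef, exp_log hn']
    have h2 : exp (-(l * k)) ≤ exp (-(0.95 * L)) := by
      rw [exp_le_exp, hA]; nlinarith
    have h3 : exp (-(l * k)) * (3.75 * A) ≤ 1 :=
      (mul_le_mul_of_nonneg_right h2 (by linarith)).trans hexp
    have h4 := mul_le_mul_of_nonneg_left hm (exp_pos (-(l * k))).le
    rw [h1]
    linarith
  have hq : ∀ k : ℕ, 0 ≤ 1 - exp (-l) ^ k := fun k =>
    sub_nonneg.mpr (pow_le_one₀ (exp_pos _).le (exp_le_one_iff.mpr (by linarith)))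
  have hna : 0 < a := by exact_mod_cast ha0
  have hnb : 0 < b := by exact_mod_cast hb0
  have hnc : 0 < c := by exact_mod_cast hc0
  have hpow : ((1 - exp (-l) ^ a) * (1 - exp (-l) ^ b) * (1 - exp (-l) ^ c)) ^ (n - (a + b + c)) ≤
      exp (1 - exp (L - l * a)) * exp (1 - exp (L - l * b)) * exp (1 - exp (L - l * c)) := by
    rw [mul_pow, mul_pow]
    have := fun k => pow_nonneg (hq k) (n - (a + b + c))
    gcongr
    · exact this c
    · exact this b
    · exact hdom a ha1
    · exact hdom b hb1
    · exact hdom c hc1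
  have hbase : 0 ≤ ((1 - exp (-l) ^ a) * (1 - exp (-l) ^ b) * (1 - exp (-l) ^ c)) ^
      (n - (a + b + c)) := pow_nonneg (mul_nonneg (mul_nonneg (hq a) (hq b)) (hq c)) _
  have hqq : exp (-l) ^ (a * b + a * c + b * c) =
      exp (-(l * ((a : ℝ) * b + a * c + b * c))) := by
    rw [← exp_nat_mul]; push_cast; congr 1; ring
  have hsq : ∀ x y : ℝ, 0 < x → 0 < y → l * (x - y) ^ 2 ≤
      1 / l * ((L - l * x - log x) - (L - l * y - log y)) ^ 2 := by
    intro x y hx hy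
    have h1 := mul_abs_sub_le_abs_sub (L := L) (l := l) hx hy
    have h2 := pow_le_pow_left₀ (by positivity) h1 2
    rw [mul_pow, sq_abs, sq_abs] at h2
    rw [one_div, inv_mul_eq_div, le_div_iff₀ hl]
    linarith
  have ea := critical_exponent_le hl hA hL hA1 hlog ha1 ha2
  have eb := critical_exponent_le hl hA hL hA1 hlog hb1 hb2
  have ec := critical_exponent_le hl hA hL hA1 hlog hc1 hc2
  have sab := hsq a b ha0 hb0
  have sac := hsq a c ha0 hc0
  have sbc := hsq b c hb0 hc0
  set wa := L - l * a - log a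
  set wb := L - l * b - log b
  set wc := L - l * c - log c
  have hfin : (a * L - a * log a + a) + (b * L - b * log b + b) + (c * L - c * log c + c)
      - exp (L - l * a) - exp (L - l * b) - exp (L - l * c)
      - l * ((a : ℝ) * b + a * c + b * c) ≤
      -(1 / (2 * l) * wa ^ 2) - (1 / (2 * l) * wb ^ 2) - (1 / (2 * l) * wc ^ 2) := by
    have hl1 : 1 / (2 * l) = 1 / l / 2 := by field_simp
    have hl2 : 2 / l = 2 * (1 / l) := by ring
    rw [hl1]
    rw [hl2] at ea eb ec
    have hi : 0 < 1 / l := by positivity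
    linarith [mul_nonneg hi.le (sq_nonneg (wa + wb + wc))]
  calc _ ≤ ((√a)⁻¹ * exp (a * L - a * log a + a)) * (((√b)⁻¹ * exp (b * L - b * log b + b)) *
        (((√c)⁻¹ * exp (c * L - c * log c + c)) *
        ((exp (1 - exp (L - l * a)) * exp (1 - exp (L - l * b)) * exp (1 - exp (L - l * c))) *
          exp (-(l * ((a : ℝ) * b + a * c + b * c)))))) := by
        rw [hqq]
        gcongr
        · exact choose_le_inv_sqrt_mul_exp hn hna
        · exact choose_le_inv_sqrt_mul_exp hn hnb
        · exact choose_le_inv_sqrt_mul_exp hn hnc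
    _ = (√a)⁻¹ * (√b)⁻¹ * (√c)⁻¹ * exp (3 +
        ((a * L - a * log a + a) + (b * L - b * log b + b) + (c * L - c * log c + c)
      - exp (L - l * a) - exp (L - l * b) - exp (L - l * c)
      - l * ((a : ℝ) * b + a * c + b * c))) := by
        rw [show ∀ x₁ x₂ x₃ e₁ e₂ e₃ e₄ e₅ e₆ e₇ : ℝ, x₁ * e₁ * (x₂ * e₂ * (x₃ * e₃ *
          (e₄ * e₅ * e₆ * e₇))) = x₁ * x₂ * x₃ * (e₁ * e₂ * e₃ * e₄ * e₅ * e₆ * e₇) from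
          fun _ _ _ _ _ _ _ _ _ _ => by ring]
        simp only [← exp_add]
        congr 2; ring
    _ ≤ (√a)⁻¹ * (√b)⁻¹ * (√c)⁻¹ * exp (3 +
        (-(1 / (2 * l) * wa ^ 2) - (1 / (2 * l) * wb ^ 2) - (1 / (2 * l) * wc ^ 2))) := by
        gcongr
    _ = _ := by
        rw [show ∀ x₁ x₂ x₃ e₁ e₂ e₃ e₄ : ℝ, e₁ * (x₁ * e₂ * (x₂ * e₃ * (x₃ * e₄))) =
          x₁ * x₂ * x₃ * (e₁ * e₂ * e₃ * e₄) from fun _ _ _ _ _ _ _ => by ring]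
        simp only [← exp_add]
        congr 2; ring

end Estimates

section Assembly

open Asymptotics

/-- Total contribution of pairs of sizes in the range where two sets already suffice. -/
lemma pair_sum_le {n : ℕ} {l A : ℝ} (hn : 0 < n) (hl : 0 < l) (hA : log n = l * A)
    (hAn : 5 * A ≤ n / 2) (R : ℕ → ℕ → Prop) [∀ a b, Decidable (R a b)]
    (hR : ∀ a b, R a b → (a : ℝ) < 0.95 * A ∧ (b : ℝ) < 4 * A) :
    (∑ a ∈ Finset.range (n + 1), (n.choose a : ℝ) * ∑ b ∈ Finset.range (n + 1),
      (n.choose b : ℝ) * if 0 < b ∧ R a b then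
        (1 - (1 - exp (-l)) * exp (-l) ^ a) ^ (n - (a + b)) else 0) ≤
    ((n : ℝ) + 1) ^ 2 * exp (5 * log n * A - (1 - exp (-l)) / 2 * exp (0.05 * log n)) := by
  set B := exp (5 * log n * A - (1 - exp (-l)) / 2 * exp (0.05 * log n))
  have hterm : ∀ a b : ℕ, (n.choose a : ℝ) * ((n.choose b : ℝ) * if 0 < b ∧ R a b then
      (1 - (1 - exp (-l)) * exp (-l) ^ a) ^ (n - (a + b)) else 0) ≤ B := by
    intro a b
    split_ifs with h
    · exact pair_term_le hn hl hA (hR a b h.2).1 (hR a b h.2).2 hAn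
    · simpa using (exp_pos _).le
  simp only [Finset.mul_sum]
  refine (Finset.sum_le_sum fun a _ => Finset.sum_le_sum fun b _ => hterm a b).trans_eq ?_
  simp only [Finset.sum_const, Finset.card_range, nsmul_eq_mul]
  push_cast; ring

/-- Total contribution of triples of sizes outside the range covered by pairs. -/
lemma triple_sum_le {n : ℕ} {l A K : ℝ} (hn : 0 < n) (hl : 0 < l) (hA : log n = l * A)
    (hL : 12 ≤ log n) (hA1 : 1 ≤ 0.95 * A) (hlog : log (1.25 * A) ≤ 0.05 * log n)
    (hexp : exp (-(0.95 * log n)) * (3.75 * A) ≤ 1)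
    (hK : ∀ (F : Finset ℕ) (w : ℕ → ℝ), (∀ a ∈ F, ∀ b ∈ F, l * |(a : ℝ) - b| ≤ |w a - w b|) →
      ∑ a ∈ F, exp (-(1 / (2 * l) * w a ^ 2)) ≤ K)
    (R : ℕ → ℕ → Prop) [∀ a b, Decidable (R a b)]
    (hR : ∀ a b : ℕ, (a : ℝ) < 0.95 * A → (b : ℝ) < 4 * A → R a b) :
    (∑ a ∈ Finset.range (n + 1), (n.choose a : ℝ) * ∑ b ∈ Finset.range (n + 1),
      (n.choose b : ℝ) * ∑ c ∈ Finset.range (n + 1), (n.choose c : ℝ) *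
        if 0 < a ∧ a ≤ b ∧ b ≤ c ∧ ¬ R a b then
          ((1 - exp (-l) ^ a) * (1 - exp (-l) ^ b) * (1 - exp (-l) ^ c)) ^ (n - (a + b + c)) *
            exp (-l) ^ (a * b + a * c + b * c) else 0) ≤
    ((n : ℝ) + 1) ^ 3 * exp (-(0.1 * log n * A)) + exp 3 * ((√(0.95 * A))⁻¹ * K) ^ 3 := by
  classical
  set L := log n with hLdef
  set W : Finset ℕ := {a ∈ Finset.range (n + 1) | 0.95 * A ≤ (a : ℝ) ∧ (a : ℝ) ≤ 1.25 * A} with hW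
  set g : ℕ → ℝ := fun a => (√a)⁻¹ * exp (-(1 / (2 * l) * (L - l * a - log a) ^ 2)) with hg
  have hg0 : ∀ a, 0 ≤ g a := fun a => by positivity
  set h : ℕ → ℝ := fun a => if a ∈ W then g a else 0 with hh
  have hh0 : ∀ a, 0 ≤ h a := fun a => by simp only [hh]; split_ifs; exacts [hg0 a, le_rfl]
  set B := exp (-(0.1 * L * A)) with hB
  have hterm : ∀ a ∈ Finset.range (n + 1), ∀ b ∈ Finset.range (n + 1),
      ∀ c ∈ Finset.range (n + 1), (n.choose a : ℝ) * ((n.choose b : ℝ) * ((n.choose c : ℝ) *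
        if 0 < a ∧ a ≤ b ∧ b ≤ c ∧ ¬ R a b then
          ((1 - exp (-l) ^ a) * (1 - exp (-l) ^ b) * (1 - exp (-l) ^ c)) ^ (n - (a + b + c)) *
            exp (-l) ^ (a * b + a * c + b * c) else 0)) ≤ B + exp 3 * (h a * (h b * h c)) := by
    intro a ha b hb c hc
    have hpos : 0 ≤ exp 3 * (h a * (h b * h c)) :=
      mul_nonneg (exp_pos _).le (mul_nonneg (hh0 a) (mul_nonneg (hh0 b) (hh0 c)))
    split_ifs with H
    · obtain ⟨_, hab, hbc, hnR⟩ := H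
      have habR : (a : ℝ) ≤ b := by exact_mod_cast hab
      have hbcR : (b : ℝ) ≤ c := by exact_mod_cast hbc
      by_cases hcr : 0.95 * A ≤ a ∧ (c : ℝ) ≤ 1.25 * A
      · have haW : a ∈ W := by simp only [hW, Finset.mem_filter]; exact ⟨ha, hcr.1, by linarith⟩
        have hbW : b ∈ W := by
          simp only [hW, Finset.mem_filter]; exact ⟨hb, by linarith, by linarith⟩
        have hcW : c ∈ W := by simp only [hW, Finset.mem_filter]; exact ⟨hc, by linarith, hcr.2⟩
        have := triple_term_le_of_critical hn hl hA hL hA1 hlog hexp (a := a) (b := b) (c := c)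
          hcr.1 (by linarith) (by linarith) (by linarith) (by linarith) hcr.2
        simp only [hh, if_pos haW, if_pos hbW, if_pos hcW]
        exact this.trans (le_add_of_nonneg_left (exp_pos _).le)
      · refine (triple_term_le_of_gap hn hl hA hab hbc (fun h1 => ?_) (fun h2 => ?_)).trans
          (le_add_of_nonneg_right hpos)
        · by_contra h4
          exact hnR (hR a b h1 (not_le.mp h4))
        · by_contra h3
          exact hcr ⟨h2, not_lt.mp h3⟩
    · simpa using add_nonneg (exp_pos _).le hpos
  have hsum : ∑ a ∈ Finset.range (n + 1), h a ≤ (√(0.95 * A))⁻¹ * K := by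
    have h1 : ∑ a ∈ Finset.range (n + 1), h a = ∑ a ∈ W, g a := by
      simp only [hh]
      rw [← Finset.sum_filter]
      congr 1
      ext a
      simp only [hW, Finset.mem_filter]
      tauto
    have hWle : ∀ a ∈ W, 0.95 * A ≤ (a : ℝ) := fun a ha => by
      simp only [hW, Finset.mem_filter] at ha; exact ha.2.1
    rw [h1]
    calc ∑ a ∈ W, g a
        ≤ ∑ a ∈ W, (√(0.95 * A))⁻¹ * exp (-(1 / (2 * l) * (L - l * a - log a) ^ 2)) := by
          refine Finset.sum_le_sum fun a ha => ?_
          have := hWle a ha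
          have h0 : 0 < √(0.95 * A) := Real.sqrt_pos.mpr (by linarith)
          simp only [hg]
          gcongr
      _ ≤ (√(0.95 * A))⁻¹ * K := by
          rw [← Finset.mul_sum]
          refine mul_le_mul_of_nonneg_left (hK W _ fun a ha b hb => ?_) (by positivity)
          have := hWle a ha
          have := hWle b hb
          exact mul_abs_sub_le_abs_sub (by linarith) (by linarith)
  have hsum0 : 0 ≤ ∑ a ∈ Finset.range (n + 1), h a := Finset.sum_nonneg fun a _ => hh0 a
  simp only [Finset.mul_sum]
  refine (Finset.sum_le_sum fun a ha => Finset.sum_le_sum fun b hb => Finset.sum_le_sum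
    fun c hc => hterm a ha b hb c hc).trans ?_
  simp only [Finset.sum_add_distrib, ← Finset.mul_sum, ← Finset.sum_mul, Finset.sum_const,
    Finset.card_range, nsmul_eq_mul]
  refine add_le_add (le_of_eq (by push_cast; ring)) ?_
  refine mul_le_mul_of_nonneg_left ?_ (exp_pos _).le
  calc _ = (∑ a ∈ Finset.range (n + 1), h a) ^ 3 := by ring
    _ ≤ _ := pow_le_pow_left₀ hsum0 hsum 3

/-- The bound on the probability of `dominatingTripleEvent`, as a function of `L = log n`. -/
lemma tendsto_union_bound {l r K : ℝ} (hl : 0 < l) (hr : 0 < r) :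
    Tendsto (fun L : ℝ => exp (4 * L) * exp (5 * L * (L / l) - r / 2 * exp (0.05 * L)) +
      (exp (6 * L) * exp (-(0.1 * L * (L / l))) + exp 3 * ((√(0.95 * (L / l)))⁻¹ * K) ^ 3))
      atTop (nhds 0) := by
  have hneg : Tendsto (fun L : ℝ => exp (-L)) atTop (nhds 0) := Real.tendsto_exp_neg_atTop_nhds_zero
  have t1 : Tendsto (fun L : ℝ => exp (4 * L) * exp (5 * L * (L / l) - r / 2 * exp (0.05 * L)))
      atTop (nhds 0) := by
    refine squeeze_zero' (Eventually.of_forall fun L => by positivity) ?_ hneg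
    have hc : 0 < r / 2 / (5 + 5 / l) := by positivity
    have ho := (isLittleO_pow_exp_pos_mul_atTop 2 (by norm_num : (0 : ℝ) < 0.05)).bound hc
    filter_upwards [ho, eventually_ge_atTop 1] with L h1 h2
    rw [Real.norm_of_nonneg (by positivity), Real.norm_of_nonneg (by positivity),
      div_mul_eq_mul_div, le_div_iff₀ (by positivity)] at h1
    rw [← exp_add]
    refine exp_le_exp.mpr ?_
    have h3 : 5 * L * (L / l) = 5 / l * L ^ 2 := by ring
    nlinarith
  have t2 : Tendsto (fun L : ℝ => exp (6 * L) * exp (-(0.1 * L * (L / l)))) atTop (nhds 0) := by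
    refine squeeze_zero' (Eventually.of_forall fun L => by positivity) ?_ hneg
    filter_upwards [eventually_ge_atTop (70 * l), eventually_ge_atTop 0] with L h1 h2
    rw [← exp_add]
    refine exp_le_exp.mpr ?_
    have h3 : 70 ≤ L / l := (le_div_iff₀ hl).mpr h1
    nlinarith [mul_le_mul_of_nonneg_left h3 h2]
  have t3 : Tendsto (fun L : ℝ => exp 3 * ((√(0.95 * (L / l)))⁻¹ * K) ^ 3) atTop (nhds 0) := by
    have h1 : Tendsto (fun L : ℝ => 0.95 * (L / l)) atTop atTop :=
      (tendsto_id.atTop_div_const hl).const_mul_atTop (by norm_num)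
    have h2 := tendsto_inv_atTop_zero.comp (Real.tendsto_sqrt_atTop.comp h1)
    simpa using ((h2.mul_const K).pow 3).const_mul (exp 3)
  simpa using t1.add (t2.add t3)

lemma eventually_size_conditions {l : ℝ} (hl : 0 < l) : ∀ᶠ L : ℝ in atTop,
    12 ≤ L ∧ 1 ≤ 0.95 * (L / l) ∧ log (1.25 * (L / l)) ≤ 0.05 * L ∧
      exp (-(0.95 * L)) * (3.75 * (L / l)) ≤ 1 ∧ 5 * (L / l) ≤ exp L / 2 := by
  have hdiv : Tendsto (fun L : ℝ => L / l) atTop atTop := tendsto_id.atTop_div_const hl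
  have h1 : Tendsto (fun L : ℝ => 1.25 * (L / l)) atTop atTop :=
    hdiv.const_mul_atTop (by norm_num)
  have elog := h1.eventually (Real.isLittleO_log_id_atTop.bound (by positivity : 0 < 0.04 * l))
  have eexp := (isLittleO_pow_exp_pos_mul_atTop 1 (by norm_num : (0 : ℝ) < 0.95)).bound
    (by positivity : 0 < l / 10)
  filter_upwards [elog, eexp, hdiv.eventually_ge_atTop 2, eventually_ge_atTop 12]
    with L h2 h3 h4 h5
  rw [Real.norm_of_nonneg (by positivity), Real.norm_of_nonneg (by positivity), pow_one] at h3
  have h6 : L / l ≤ exp (0.95 * L) / 10 := by rw [div_le_iff₀ hl]; linarith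
  refine ⟨h5, by linarith, ?_, ?_, ?_⟩
  · refine (le_abs_self _).trans (h2.trans_eq ?_)
    rw [id, Real.norm_of_nonneg (by positivity)]
    field_simp
    norm_num
  · rw [exp_neg, inv_mul_le_iff₀ (exp_pos _)]
    linarith [exp_pos (0.95 * L)]
  · have : exp (0.95 * L) ≤ exp L := exp_le_exp.mpr (by linarith)
    linarith

lemma tendsto_gnp_dominatingTripleEvent (p : I) (hp0 : 0 < (p : ℝ)) (hp1 : (p : ℝ) < 1) :
    Tendsto (fun n : ℕ => (gnp n p (dominatingTripleEvent n)).toReal) atTop (nhds 0) := by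
  classical
  set l := -log (1 - p) with hldef
  have hl : 0 < l := neg_pos.mpr (log_neg (by linarith) (by linarith))
  have hq : (1 - p : ℝ) = exp (-l) := by rw [hldef, neg_neg, exp_log (by linarith)]
  have hp : (p : ℝ) = 1 - exp (-l) := by linarith
  obtain ⟨K, hK⟩ := exists_sum_exp_neg_sq_le hl (by positivity : 0 < 1 / (2 * l))
  have hlogn : Tendsto (fun n : ℕ => log (n : ℝ)) atTop atTop :=
    Real.tendsto_log_atTop.comp tendsto_natCast_atTop_atTop
  refine squeeze_zero' (Eventually.of_forall fun n => ENNReal.toReal_nonneg) ?_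
    ((tendsto_union_bound (K := K) hl hp0).comp hlogn)
  filter_upwards [hlogn.eventually (eventually_size_conditions hl), eventually_ge_atTop 2]
    with n ⟨h1, h2, h3, h4, h5⟩ hn2
  have hn : 0 < n := by omega
  have hn' : (0 : ℝ) < n := by exact_mod_cast hn
  have hA : log (n : ℝ) = l * (log n / l) := by field_simp
  rw [exp_log hn'] at h5
  set R : ℕ → ℕ → Prop := fun a b =>
    (a : ℝ) < 0.95 * (log n / l) ∧ (b : ℝ) < 4 * (log n / l) with hR
  have hb := coinMeasure_real_dominatingTripleEvent_le (n := n) p R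
  simp only [hq] at hb
  simp only [hp] at hb
  have e2 := pair_sum_le hn hl hA h5 R fun a b h => h
  have e3 := triple_sum_le hn hl hA h1 h2 h3 h4 hK R fun a b ha hb => ⟨ha, hb⟩
  have hn1 : (n : ℝ) + 1 ≤ exp (2 * log n) := by
    rw [two_mul, exp_add, exp_log hn']
    have : (2 : ℝ) ≤ n := by exact_mod_cast hn2
    nlinarith
  have hpow : ∀ k : ℕ, ((n : ℝ) + 1) ^ k ≤ exp (k * (2 * log n)) := fun k => by
    rw [exp_nat_mul]
    exact pow_le_pow_left₀ (by positivity) hn1 k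
  have hp2 := hpow 2
  have hp3 := hpow 3
  rw [gnp_eq_coinMeasure]
  refine hb.trans (add_le_add (e2.trans ?_) (e3.trans (add_le_add_left ?_ _)))
  · rw [hp]
    refine mul_le_mul_of_nonneg_right (hp2.trans_eq ?_) (exp_pos _).le
    congr 1; push_cast; ring
  · refine mul_le_mul_of_nonneg_right (hp3.trans_eq ?_) (exp_pos _).le
    congr 1; push_cast; ring

end Assembly

end RandomGraph

theorem stmt16 {p : ℝ} (hp : p ∈ Set.Ioo (0 : ℝ) 1) :
    Tendsto (fun n : ℕ =>
      ((gnp n p) {G : SimpleGraph (Fin n) | ∃ X₁ X₂ X₃ : Finset (Fin n),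
        X₁.Nonempty ∧ X₂.Nonempty ∧ X₃.Nonempty ∧
        Disjoint X₁ X₂ ∧ Disjoint X₁ X₃ ∧ Disjoint X₂ X₃ ∧
        (∀ v : Fin n, v ∉ X₁ → v ∉ X₂ → v ∉ X₃ →
          (∃ u ∈ X₁, G.Adj v u) ∧ (∃ u ∈ X₂, G.Adj v u) ∧ (∃ u ∈ X₃, G.Adj v u)) ∧
        (∀ u ∈ X₁, ∀ v ∈ X₂, ¬ G.Adj u v) ∧
        (∀ u ∈ X₁, ∀ v ∈ X₃, ¬ G.Adj u v) ∧
        (∀ u ∈ X₂, ∀ v ∈ X₃, ¬ G.Adj u v)}).toReal) atTop (nhds 0) := by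
  exact tendsto_gnp_dominatingTripleEvent ⟨p, hp.1.le, hp.2.le⟩ hp.1 hp.2
end
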